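/- arXiv:2209.08753 — 2 statements merged into one kernel-verified Lean document; each statement's English description precedes it below -/
import Mathlib

section
/- Let T be a theory of fields in a language L expanding the language of rings. If T is NTP_1 (resp. NTP_2, resp. NATP), then ACF_T is NTP_1 (resp. NTP_2, resp. NATP). -/
open FirstOrder FirstOrder.Language FirstOrder.Ring

universe u v

namespace NATPPaper

/-! ### Tree properties -/

section TreeProps

variable {L : FirstOrder.Language.{u, v}}

def TreeComparable (η ν : List Bool) : Prop := η <+: ν ∨ ν <+: η

def IsTreeAntichain (X : Set (List Bool)) : Prop :=
  ∀ η ∈ X, ∀ ν ∈ X, η ≠ ν → ¬ TreeComparable η ν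

def ATPWitness {M : Type w} [L.Structure M] {n m : ℕ}
    (φ : L.Formula (Fin n ⊕ Fin m)) (a : List Bool → Fin m → M) : Prop :=
  (∀ X : Finset (List Bool), IsTreeAntichain ↑X →
      ∃ b : Fin n → M, ∀ η ∈ X, φ.Realize (Sum.elim b (a η))) ∧
  (∀ η ν : List Bool, η ≠ ν → TreeComparable η ν →
      ¬ ∃ b : Fin n → M, φ.Realize (Sum.elim b (a η)) ∧ φ.Realize (Sum.elim b (a ν)))

def _root_.FirstOrder.Language.Theory.HasATP (T : L.Theory) : Prop :=
  ∃ (M : Theory.ModelType.{u, v, max u v} T) (n m : ℕ)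
    (φ : L.Formula (Fin n ⊕ Fin m)) (a : List Bool → Fin m → M), ATPWitness φ a

def _root_.FirstOrder.Language.Theory.IsNATP (T : L.Theory) : Prop := ¬ T.HasATP

/-- Witness of the tree property of the first kind. -/
def TP1Witness {M : Type w} [L.Structure M] {n m : ℕ}
    (φ : L.Formula (Fin n ⊕ Fin m)) (a : List ℕ → Fin m → M) : Prop :=
  (∀ (f : ℕ → ℕ) (k : ℕ), ∃ b : Fin n → M,
      ∀ i ≤ k, φ.Realize (Sum.elim b (a ((List.range i).map f)))) ∧
  (∀ η ν : List ℕ, ¬ η <+: ν → ¬ ν <+: η →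
      ¬ ∃ b : Fin n → M, φ.Realize (Sum.elim b (a η)) ∧ φ.Realize (Sum.elim b (a ν)))

def _root_.FirstOrder.Language.Theory.HasTP1 (T : L.Theory) : Prop :=
  ∃ (M : Theory.ModelType.{u, v, max u v} T) (n m : ℕ)
    (φ : L.Formula (Fin n ⊕ Fin m)) (a : List ℕ → Fin m → M), TP1Witness φ a

def _root_.FirstOrder.Language.Theory.IsNTP1 (T : L.Theory) : Prop := ¬ T.HasTP1

/-- Witness of the tree property of the second kind. -/
def TP2Witness {M : Type w} [L.Structure M] {n m : ℕ}
    (φ : L.Formula (Fin n ⊕ Fin m)) (a : ℕ → ℕ → Fin m → M) : Prop :=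
  (∀ (f : ℕ → ℕ) (k : ℕ), ∃ b : Fin n → M,
      ∀ i ≤ k, φ.Realize (Sum.elim b (a i (f i)))) ∧
  (∀ (i j j' : ℕ), j ≠ j' →
      ¬ ∃ b : Fin n → M, φ.Realize (Sum.elim b (a i j)) ∧ φ.Realize (Sum.elim b (a i j')))

def _root_.FirstOrder.Language.Theory.HasTP2 (T : L.Theory) : Prop :=
  ∃ (M : Theory.ModelType.{u, v, max u v} T) (n m : ℕ)
    (φ : L.Formula (Fin n ⊕ Fin m)) (a : ℕ → ℕ → Fin m → M), TP2Witness φ a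

def _root_.FirstOrder.Language.Theory.IsNTP2 (T : L.Theory) : Prop := ¬ T.HasTP2

end TreeProps

/-! ### The theory `ACF_T` of pairs -/

section ACFT

variable (L' : FirstOrder.Language.{u, v})

/-- The language `L ⊇ L_ring`. -/
abbrev ringLang' : FirstOrder.Language.{u, v} := Language.ring.sum L'

/-- The language with one additional unary predicate `P`. -/
def pLang : FirstOrder.Language.{u, v} := ⟨fun _ => PEmpty, fun n => ULift (PLift (n = 1))⟩

/-- The language `L_P = L ∪ {P}`. -/
abbrev LP : FirstOrder.Language.{u, v} := (ringLang' L').sum (pLang)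

/-- The predicate symbol `P`. -/
def pSym : (LP L').Relations 1 := Sum.inr ⟨⟨rfl⟩⟩

variable (M : Type (max u v)) [(LP L').Structure M]

/-- The `L`-reduct of an `L_P`-structure. -/
def lOfLP : (ringLang' L').Structure M :=
  (LHom.sumInl : ringLang' L' →ᴸ LP L').reduct M

/-- The `L_ring`-reduct of an `L_P`-structure. -/
def rOfLP : Language.ring.Structure M :=
  ((LHom.sumInl : ringLang' L' →ᴸ LP L').comp
    (LHom.sumInl : Language.ring →ᴸ ringLang' L')).reduct M

/-- The set `P(M)`. -/
def PSet : Set M := {x | Structure.RelMap (pSym L') ![x]}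

/-- The induced `L`-structure on `P`, given that `P` is closed under the `L`-functions. -/
def pStructOn
    (hcl : ∀ (n : ℕ) (f : (ringLang' L').Functions n) (w : Fin n → M),
      (∀ i, w i ∈ PSet L' M) → @Structure.funMap _ M (lOfLP L' M) n f w ∈ PSet L' M) :
    (ringLang' L').Structure ↥(PSet L' M) where
  funMap {n} f w := ⟨@Structure.funMap _ M (lOfLP L' M) n f (fun i => (w i).1),
    hcl n f _ (fun i => (w i).2)⟩
  RelMap {n} r w := @Structure.RelMap _ M (lOfLP L' M) n r (fun i => (w i).1)

variable [Field M] [IsAlgClosed M] (T : (ringLang' L').Theory)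

/-- `M` is a model of `ACF_T`: an algebraically closed field (with the ring symbols interpreted
by the field operations) in which `P` is a model of `T`, the extra function symbols map tuples
from `P` into `P` and vanish on tuples not entirely in `P`, the extra relation symbols are
contained in the appropriate power of `P`, and the extension over `P` has infinite degree. -/
structure IsACFTModel : Prop where
  compat_add : ∀ x y : M, @Structure.funMap _ M (rOfLP L' M) 2 ringFunc.add ![x, y] = x + y
  compat_mul : ∀ x y : M, @Structure.funMap _ M (rOfLP L' M) 2 ringFunc.mul ![x, y] = x * y
  compat_neg : ∀ x : M, @Structure.funMap _ M (rOfLP L' M) 1 ringFunc.neg ![x] = -x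
  compat_zero : @Structure.funMap _ M (rOfLP L' M) 0 ringFunc.zero ![] = 0
  compat_one : @Structure.funMap _ M (rOfLP L' M) 0 ringFunc.one ![] = 1
  pcl : ∀ (n : ℕ) (f : (ringLang' L').Functions n) (w : Fin n → M),
    (∀ i, w i ∈ PSet L' M) → @Structure.funMap _ M (lOfLP L' M) n f w ∈ PSet L' M
  p_models_T : @Theory.Model (ringLang' L') ↥(PSet L' M) (pStructOn L' M pcl) T
  extra_fun_zero : ∀ (n : ℕ) (f : L'.Functions n) (w : Fin n → M),
    ¬ (∀ i, w i ∈ PSet L' M) →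
      @Structure.funMap _ M (lOfLP L' M) n (Sum.inr f) w = 0
  extra_rel_sub : ∀ (n : ℕ) (r : L'.Relations n) (w : Fin n → M),
    @Structure.RelMap _ M (lOfLP L' M) n (Sum.inr r) w → ∀ i, w i ∈ PSet L' M
  inf_degree : ∃ a : ℕ → M, ∀ (n : ℕ) (c : Fin n → M), (∀ i, c i ∈ PSet L' M) →
    ∑ i : Fin n, c i * a i = 0 → ∀ i, c i = 0

end ACFT

universe w

section FieldExtension

open Cardinal in
theorem exists_ringEquiv_of_trdeg_eq {R K L : Type w} [CommRing R] [IsDomain R] [Field K] [Field L]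
    [Algebra R K] [Algebra R L] [FaithfulSMul R K] [FaithfulSMul R L]
    [IsAlgClosed K] [IsAlgClosed L]
    (h : Algebra.trdeg R K = Algebra.trdeg R L) :
    ∃ τ : K ≃+* L, ∀ x : R, τ (algebraMap R K x) = algebraMap R L x := by
  obtain ⟨s, hs⟩ := exists_isTranscendenceBasis R K
  obtain ⟨t, ht⟩ := exists_isTranscendenceBasis R L
  rw [← hs.cardinalMk_eq_trdeg, ← ht.cardinalMk_eq_trdeg] at h
  obtain ⟨e⟩ := Cardinal.eq.1 h
  let := IsAlgClosed.isAlgClosure_of_transcendence_basis _ hs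
  let := IsAlgClosed.isAlgClosure_of_transcendence_basis _ ht
  let f : Algebra.adjoin R (Set.range ((↑) : s → K)) ≃ₐ[R]
      Algebra.adjoin R (Set.range ((↑) : t → L)) :=
    hs.1.aevalEquiv.symm.trans ((MvPolynomial.renameEquiv R e).trans ht.1.aevalEquiv)
  refine ⟨IsAlgClosure.equivOfEquiv K L f.toRingEquiv, fun x => ?_⟩
  have h₁ : algebraMap R K x = algebraMap (Algebra.adjoin R (Set.range ((↑) : s → K))) K
      (algebraMap R _ x) := IsScalarTower.algebraMap_apply _ _ _ _
  rw [h₁, IsAlgClosure.equivOfEquiv_algebraMap]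
  have h₂ : f.toRingEquiv (algebraMap R _ x) = algebraMap R _ x := f.commutes x
  rw [h₂]
  exact (IsScalarTower.algebraMap_apply _ _ _ _).symm

/-- An isomorphism between the base fields of two extensions of the same transcendence degree
with the same algebraically closed top extends to the top. -/
theorem exists_ringEquiv_extending_aux {k k' N : Type w} [Field k] [Field k'] [Field N]
    [IsAlgClosed N] [i₁ : Algebra k N] [Algebra k' N] (h : Algebra.trdeg k N = Algebra.trdeg k' N)
    (σ : k ≃+* k') :
    ∃ τ : N ≃+* N, ∀ x : k, τ (algebraMap k N x) = algebraMap k' N (σ x) := by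
  have f₁ : FaithfulSMul k N := inferInstance
  let A₂ : Algebra k N := ((algebraMap k' N).comp (σ : k →+* k')).toAlgebra
  let A₃ : Algebra k k' := (σ : k →+* k').toAlgebra
  have tow : @IsScalarTower k k' N A₃.toSMul _ A₂.toSMul :=
    @IsScalarTower.of_algebraMap_eq' k k' N _ _ _ A₃ _ A₂ rfl
  have h0 : Algebra.trdeg k k' = 0 := by
    have : Algebra.IsAlgebraic k k' := ⟨fun x => by
      obtain ⟨y, rfl⟩ := σ.surjective x
      exact isAlgebraic_algebraMap (R := k) (A := k') y⟩
    exact trdeg_eq_zero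
  have h1 := @trdeg_add_eq k k' _ _ A₃ _ N _ _ A₂ _ _ _ tow
  rw [h0, zero_add, ← h] at h1
  have f₂ : @FaithfulSMul k N A₂.toSMul := by
    let := A₂
    infer_instance
  exact @exists_ringEquiv_of_trdeg_eq k N N _ _ _ _ i₁ A₂ f₁ f₂ _ _ h1

/-- A field automorphism of a subfield of an algebraically closed field extends. -/
theorem exists_ringEquiv_extending {N : Type w} [Field N] [IsAlgClosed N] (P : Subfield N)
    (σ : P ≃+* P) : ∃ τ : N ≃+* N, ∀ x : P, τ x = σ x :=
  exists_ringEquiv_extending_aux rfl σ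

theorem exists_ringEquiv_of_injective {k A N : Type w} [Field k] [CommRing A] [IsDomain A]
    [Field N] [IsAlgClosed N] [Algebra k A] [Algebra k N] [Algebra.FiniteType k A]
    (φ ψ : A →ₐ[k] N) (hφ : Function.Injective φ) (hψ : Function.Injective ψ) :
    ∃ τ : N ≃+* N, ∀ a, τ (φ a) = ψ a := by
  let A₁ : Algebra A N := φ.toRingHom.toAlgebra
  let A₂ : Algebra A N := ψ.toRingHom.toAlgebra
  have f₁ : @FaithfulSMul A N A₁.toSMul := by
    let := A₁
    exact (faithfulSMul_iff_algebraMap_injective A N).2 hφ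
  have f₂ : @FaithfulSMul A N A₂.toSMul := by
    let := A₂
    exact (faithfulSMul_iff_algebraMap_injective A N).2 hψ
  have t₁ : @IsScalarTower k A N _ A₁.toSMul _ := by
    let := A₁
    exact IsScalarTower.of_algebraMap_eq fun z => (φ.commutes z).symm
  have t₂ : @IsScalarTower k A N _ A₂.toSMul _ := by
    let := A₂
    exact IsScalarTower.of_algebraMap_eq fun z => (ψ.commutes z).symm
  have : FaithfulSMul k A := (faithfulSMul_iff_algebraMap_injective k A).2 (RingHom.injective _)
  have h₁ := @trdeg_add_eq k A _ _ _ _ N _ _ _ A₁ _ f₁ t₁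
  have h₂ := @trdeg_add_eq k A _ _ _ _ N _ _ _ A₂ _ f₂ t₂
  have h₃ := (add_comm _ _).trans <| (h₁.trans h₂.symm).trans (add_comm _ _)
  have hfin : Algebra.trdeg k A < Cardinal.aleph0 := trdeg_lt_aleph0_of_finiteType
  replace h₃ := (Cardinal.add_right_inj_of_lt_aleph0 hfin).1 h₃
  exact @exists_ringEquiv_of_trdeg_eq A N N _ _ _ _ A₁ A₂ f₁ f₂ _ _ h₃

theorem exists_ringEquiv_of_same_kernel {k B N : Type w} [Field k] [CommRing B]
    [Field N] [IsAlgClosed N] [Algebra k B] [Algebra k N] [Algebra.FiniteType k B]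
    (φ ψ : B →ₐ[k] N) (h : ∀ b, φ b = 0 ↔ ψ b = 0) :
    ∃ τ : N ≃+* N, ∀ b, τ (φ b) = ψ b := by
  have hψ : ∀ a ∈ RingHom.ker φ, ψ a = 0 := fun a ha => (h a).1 ha
  have : (RingHom.ker φ).IsPrime := RingHom.ker_isPrime φ.toRingHom
  let φ' : (B ⧸ RingHom.ker φ) →ₐ[k] N := Ideal.Quotient.liftₐ _ φ fun a ha => ha
  let ψ' : (B ⧸ RingHom.ker φ) →ₐ[k] N := Ideal.Quotient.liftₐ _ ψ hψ
  have iφ : Function.Injective φ' := by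
    rw [injective_iff_map_eq_zero]
    intro a ha
    obtain ⟨a, rfl⟩ := Ideal.Quotient.mk_surjective a
    exact Ideal.Quotient.eq_zero_iff_mem.2 ha
  have iψ : Function.Injective ψ' := by
    rw [injective_iff_map_eq_zero]
    intro a ha
    obtain ⟨a, rfl⟩ := Ideal.Quotient.mk_surjective a
    exact Ideal.Quotient.eq_zero_iff_mem.2 ((h a).2 ha)
  obtain ⟨τ, hτ⟩ := exists_ringEquiv_of_injective φ' ψ' iφ iψ
  exact ⟨τ, fun b => hτ (Ideal.Quotient.mk _ b)⟩

/-- Two finite tuples with the same polynomial relations over a subfield of an algebraically closed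
field are conjugate over the subfield. -/
theorem exists_ringEquiv_of_same_relations {N : Type w} {ι : Type} [Finite ι] [Field N]
    [IsAlgClosed N] (P : Subfield N) (x y : ι → N)
    (h : ∀ q : MvPolynomial ι P, MvPolynomial.aeval x q = 0 ↔ MvPolynomial.aeval y q = 0) :
    ∃ τ : N ≃+* N, (∀ a : P, τ a = a) ∧ ∀ i, τ (x i) = y i := by
  obtain ⟨τ, hτ⟩ := exists_ringEquiv_of_same_kernel (MvPolynomial.aeval (R := P) x)
    (MvPolynomial.aeval y) h
  refine ⟨τ, fun a => ?_, fun i => ?_⟩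
  · have := hτ (algebraMap P _ a)
    rwa [AlgHom.commutes, AlgHom.commutes] at this
  · simpa using hτ (MvPolynomial.X i)

end FieldExtension

section CoefficientFunctionals

open MvPolynomial

variable {K Ω : Type w} [Field K] [Field Ω] [Algebra K Ω] {σ : Type}

/-- Application of a linear functional to the coefficients of a polynomial. -/
noncomputable def coeffApply (l : Ω →ₗ[K] K) (p : MvPolynomial σ Ω) : MvPolynomial σ K :=
  ∑ m ∈ p.support, monomial m (l (coeff m p))

theorem coeff_coeffApply (l : Ω →ₗ[K] K) (p : MvPolynomial σ Ω) (m : σ →₀ ℕ) :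
    coeff m (coeffApply l p) = l (coeff m p) := by
  classical
  simp only [coeffApply, coeff_sum, coeff_monomial]
  rw [Finset.sum_ite_eq']
  split_ifs with h
  · rfl
  · rw [notMem_support_iff.1 h, map_zero]

theorem coeffApply_add (l : Ω →ₗ[K] K) (p q : MvPolynomial σ Ω) :
    coeffApply l (p + q) = coeffApply l p + coeffApply l q := by
  ext m
  simp [coeff_coeffApply]

theorem coeffApply_mul_map (l : Ω →ₗ[K] K) (p : MvPolynomial σ Ω) (g : MvPolynomial σ K) :
    coeffApply l (p * map (algebraMap K Ω) g) = coeffApply l p * g := by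
  classical
  ext m
  simp only [coeff_coeffApply, coeff_mul, map_sum, coeff_map]
  refine Finset.sum_congr rfl fun x _ => ?_
  rw [mul_comm, ← Algebra.smul_def, map_smul, smul_eq_mul, mul_comm]

theorem coeffApply_mem {I : Ideal (MvPolynomial σ K)} {p : MvPolynomial σ Ω}
    (hp : p ∈ I.map (map (algebraMap K Ω))) (l : Ω →ₗ[K] K) : coeffApply l p ∈ I := by
  suffices h : ∀ r, coeffApply l (r * p) ∈ I by simpa using h 1
  refine Submodule.span_induction (p := fun p _ => ∀ r, coeffApply l (r * p) ∈ I)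
    ?_ ?_ ?_ ?_ hp
  · rintro _ ⟨g, hg, rfl⟩ r
    rw [coeffApply_mul_map]
    exact I.mul_mem_left _ hg
  · intro r
    have : coeffApply l (0 : MvPolynomial σ Ω) = 0 := by
      ext m
      simp [coeff_coeffApply]
    rw [mul_zero, this]
    exact I.zero_mem
  · intro x y _ _ hx hy r
    rw [mul_add, coeffApply_add]
    exact I.add_mem (hx r) (hy r)
  · intro a x _ hx r
    rw [smul_eq_mul, ← mul_assoc]
    exact hx _

theorem exists_eq_sum_coeffApply (p : MvPolynomial σ Ω) :
    ∃ (ι : Type w) (T : Finset ι) (c : ι → Ω) (l : ι → (Ω →ₗ[K] K)),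
      p = ∑ i ∈ T, C (c i) * map (algebraMap K Ω) (coeffApply (l i) p) := by
  classical
  let b := Module.Basis.ofVectorSpace K Ω
  refine ⟨_, p.support.biUnion fun m => (b.repr (coeff m p)).support, b, b.coord, ?_⟩
  ext m
  simp only [coeff_sum, coeff_C_mul, coeff_map, coeff_coeffApply]
  conv_lhs => rw [← b.linearCombination_repr (coeff m p)]
  rw [Finsupp.linearCombination_apply, Finsupp.sum]
  by_cases hm : m ∈ p.support
  · rw [Finset.sum_subset (Finset.subset_biUnion_of_mem
      (fun m => (b.repr (coeff m p)).support) hm)]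
    · refine Finset.sum_congr rfl fun i _ => ?_
      rw [Algebra.smul_def, mul_comm]
      rfl
    · intro i _ hi
      rw [Finsupp.notMem_support_iff.1 hi, zero_smul]
  · rw [notMem_support_iff.1 hm]
    simp

theorem mem_map_of_coeffApply_mem {I : Ideal (MvPolynomial σ K)} {p : MvPolynomial σ Ω}
    (h : ∀ l : Ω →ₗ[K] K, coeffApply l p ∈ I) : p ∈ I.map (map (algebraMap K Ω)) := by
  obtain ⟨ι, T, c, l, hp⟩ := exists_eq_sum_coeffApply (K := K) p
  rw [hp]
  exact Ideal.sum_mem _ fun i _ => Ideal.mul_mem_left _ _ (Ideal.mem_map_of_mem _ (h _))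

theorem eval_coeffApply (l : Ω →ₗ[K] K) (p : MvPolynomial σ Ω) (x : σ → K) :
    eval x (coeffApply l p) = l (eval (fun i => algebraMap K Ω (x i)) p) := by
  have h := fun m => eval_monomial (f := x) (s := m) (a := l (coeff m p))
  simp only [coeffApply, map_sum, h, Finsupp.prod]
  rw [eval_eq, map_sum]
  refine Finset.sum_congr rfl fun m _ => ?_
  rw [← map_pow_prod (algebraMap K Ω) m x, mul_comm (coeff m p), ← Algebra.smul_def, map_smul,
    smul_eq_mul, mul_comm]
where
  map_pow_prod (f : K →+* Ω) (m : σ →₀ ℕ) (x : σ → K) :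
      f (∏ i ∈ m.support, x i ^ m i) = ∏ i ∈ m.support, f (x i) ^ m i := by simp

theorem map_mem_map_iff {I : Ideal (MvPolynomial σ K)} {p : MvPolynomial σ K} :
    map (algebraMap K Ω) p ∈ I.map (map (algebraMap K Ω)) ↔ p ∈ I := by
  refine ⟨fun h => ?_, Ideal.mem_map_of_mem _⟩
  obtain ⟨l, hl⟩ := exists_dual_one
  have := coeffApply_mem h l
  convert this using 1
  ext m
  rw [coeff_coeffApply, coeff_map, Algebra.algebraMap_eq_smul_one, map_smul, hl, smul_eq_mul,
    mul_one]
where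
  exists_dual_one : ∃ l : Ω →ₗ[K] K, l 1 = 1 := by
    obtain ⟨l, hl⟩ := LinearMap.exists_leftInverse_of_injective (Algebra.linearMap K Ω)
      (LinearMap.ker_eq_bot.2 (algebraMap K Ω).injective)
    exact ⟨l, by simpa using LinearMap.congr_fun hl 1⟩

/-- If a product of an arbitrary polynomial and a polynomial over `K` vanishes on the variety
of a prime ideal over `K`, then one of the factors does. -/
theorem mem_of_mul_vanishes [IsAlgClosed Ω] [Finite σ] {I : Ideal (MvPolynomial σ K)}
    (hI : I.IsPrime) {h : MvPolynomial σ K} {q : MvPolynomial σ Ω} {b : σ → Ω}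
    (hb : ∀ f ∈ I, aeval b f = 0) (hq : eval b q ≠ 0)
    (hv : ∀ x : σ → Ω, (∀ f ∈ I, aeval x f = 0) → eval x q * aeval x h = 0) : h ∈ I := by
  have h₁ : q * map (algebraMap K Ω) h ∈
      vanishingIdeal Ω (zeroLocus Ω (I.map (map (algebraMap K Ω)))) := by
    intro x hx
    have := hv x fun f hf => by
      simpa [aeval_map_algebraMap] using hx _ (Ideal.mem_map_of_mem _ hf)
    simpa [aeval_map_algebraMap, aeval_def] using this
  rw [vanishingIdeal_zeroLocus_eq_radical] at h₁
  obtain ⟨n, hn⟩ := h₁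
  rw [mul_pow, ← map_pow] at hn
  by_contra hh
  apply hq
  have h₂ : q ^ n ∈ I.map (map (algebraMap K Ω)) := mem_map_of_coeffApply_mem fun l => by
    have := coeffApply_mem hn l
    rw [coeffApply_mul_map] at this
    exact (hI.mem_or_mem this).resolve_right fun h' => hh (hI.mem_of_pow_mem _ h')
  have h₃ : I.map (map (algebraMap K Ω)) ≤ RingHom.ker (eval b) := by
    rw [Ideal.map_le_iff_le_comap]
    intro f hf
    rw [Ideal.mem_comap, RingHom.mem_ker, eval_map, ← aeval_def]
    exact hb f hf
  have := h₃ h₂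
  rw [RingHom.mem_ker, map_pow] at this
  exact eq_zero_of_pow_eq_zero this

theorem isPrime_map_of_isAlgClosed [IsAlgClosed K] [Finite σ] {I : Ideal (MvPolynomial σ K)}
    (hI : I.IsPrime) : (I.map (map (algebraMap K Ω))).IsPrime := by
  refine ⟨fun h => hI.ne_top ?_, fun {f g} hfg => ?_⟩
  · rw [Ideal.eq_top_iff_one] at h ⊢
    rw [← map_one (map (algebraMap K Ω))] at h
    exact map_mem_map_iff.1 h
  · by_contra! hc
    have h₁ : ∃ l : Ω →ₗ[K] K, coeffApply l f ∉ I := by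
      by_contra! h'
      exact hc.1 (mem_map_of_coeffApply_mem h')
    have h₂ : ∃ l : Ω →ₗ[K] K, coeffApply l g ∉ I := by
      by_contra! h'
      exact hc.2 (mem_map_of_coeffApply_mem h')
    obtain ⟨l, hl⟩ := h₁
    obtain ⟨l', hl'⟩ := h₂
    have h₃ : coeffApply l f * coeffApply l' g ∉ I := fun h => (hI.mem_or_mem h).elim hl hl'
    rw [← IsPrime.vanishingIdeal_zeroLocus (K := K) I, mem_vanishingIdeal_iff] at h₃
    push Not at h₃
    obtain ⟨x, hx, hx'⟩ := h₃
    have h₄ : I.map (map (algebraMap K Ω)) ≤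
        RingHom.ker (eval (fun i => algebraMap K Ω (x i))) := by
      rw [Ideal.map_le_iff_le_comap]
      intro p hp
      rw [Ideal.mem_comap, RingHom.mem_ker, eval_map, ← aeval_def]
      have h₅ := hx p hp
      rw [show (fun i => algebraMap K Ω (x i)) = algebraMap K Ω ∘ x from rfl,
        aeval_algebraMap_apply, h₅, map_zero]
    have h₆ := h₄ hfg
    rw [RingHom.mem_ker, map_mul, mul_eq_zero] at h₆
    rw [map_mul] at hx'
    apply hx'
    rw [aeval_eq_eval, eval_coeffApply, eval_coeffApply]
    rcases h₆ with h₆ | h₆ <;> simp [h₆]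

end CoefficientFunctionals

section GenericPoints

open MvPolynomial

theorem exists_algHom_injective_of_trdeg {k A Ω : Type w} [Field k] [CommRing A] [IsDomain A]
    [Field Ω] [IsAlgClosed Ω] [Algebra k A] [Algebra k Ω] [Algebra.FiniteType k A]
    (h : Cardinal.aleph0 ≤ Algebra.trdeg k Ω) : ∃ φ : A →ₐ[k] Ω, Function.Injective φ := by
  have : FaithfulSMul k A := (faithfulSMul_iff_algebraMap_injective k A).2 (RingHom.injective _)
  obtain ⟨s, hs⟩ := exists_isTranscendenceBasis k A
  obtain ⟨t, ht⟩ := exists_isTranscendenceBasis k Ω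
  have hle : Cardinal.mk s ≤ Cardinal.mk t := by
    rw [hs.cardinalMk_eq_trdeg, ht.cardinalMk_eq_trdeg]
    exact (trdeg_lt_aleph0_of_finiteType).le.trans h
  obtain ⟨e⟩ := hle
  have he : AlgebraicIndependent k (fun i => (e i : Ω)) := ht.1.comp e e.injective
  let R := MvPolynomial s k
  let i₁ : Algebra R A := (aeval ((↑) : s → A)).toRingHom.toAlgebra
  let i₂ : Algebra R Ω := (aeval (fun i : s => (e i : Ω))).toRingHom.toAlgebra
  have f₁ : FaithfulSMul R A := (faithfulSMul_iff_algebraMap_injective R A).2 hs.1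
  have f₂ : FaithfulSMul R Ω := (faithfulSMul_iff_algebraMap_injective R Ω).2 he
  have a₁ : Algebra.IsAlgebraic R A := by
    have := hs.isAlgebraic
    refine ⟨fun x => ?_⟩
    have := this.isAlgebraic x
    exact this.of_ringHom_of_comp_eq hs.1.aevalEquiv.toRingEquiv.toRingHom (RingHom.id A)
      hs.1.aevalEquiv.surjective Function.injective_id (by
        ext y
        · simp [i₁, RingHom.algebraMap_toAlgebra]
        · simp [i₁, RingHom.algebraMap_toAlgebra])
  let φ : A →ₐ[R] Ω := IsAlgClosed.lift
  have t₁ : IsScalarTower k R A := IsScalarTower.of_algebraMap_eq fun z => by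
    simp [i₁, RingHom.algebraMap_toAlgebra]
  have t₂ : IsScalarTower k R Ω := IsScalarTower.of_algebraMap_eq fun z => by
    simp [i₂, RingHom.algebraMap_toAlgebra]
  refine ⟨φ.restrictScalars k, ?_⟩
  change Function.Injective φ
  rw [injective_iff_map_eq_zero]
  intro a ha
  by_contra ha0
  refine Ideal.comap_ne_bot_of_algebraic_mem (R := R) (I := RingHom.ker φ) ha0 ha
    (Algebra.IsAlgebraic.isAlgebraic a) ?_
  rw [eq_bot_iff]
  intro r hr
  rw [Ideal.mem_comap, RingHom.mem_ker, AlgHom.commutes] at hr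
  exact (injective_iff_map_eq_zero _).1 (FaithfulSMul.algebraMap_injective R Ω) r hr

theorem exists_generic_point {k Ω : Type w} [Field k]
    [Field Ω] [IsAlgClosed Ω] [Algebra k Ω] {σ : Type} [Finite σ]
    (h : Cardinal.aleph0 ≤ Algebra.trdeg k Ω) (J : Ideal (MvPolynomial σ k)) (hJ : J.IsPrime) :
    ∃ b : σ → Ω, ∀ f, aeval b f = 0 ↔ f ∈ J := by
  obtain ⟨φ, hφ⟩ := exists_algHom_injective_of_trdeg (A := MvPolynomial σ k ⧸ J) h
  let ψ : MvPolynomial σ k →ₐ[k] Ω := φ.comp (Ideal.Quotient.mkₐ k J)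
  refine ⟨fun i => ψ (X i), fun f => ?_⟩
  have hψ : aeval (fun i => ψ (X i)) = ψ := (aeval_unique ψ).symm
  rw [hψ, ← Ideal.Quotient.eq_zero_iff_mem, ← map_eq_zero_iff φ hφ]
  rfl

theorem exists_generic_points_aux {K k Ω : Type w} [Field K] [Field k] [Field Ω] [Algebra K k]
    [Algebra k Ω] [Algebra K Ω] [IsScalarTower K k Ω] [IsAlgClosed k] [IsAlgClosed Ω]
    {σ : Type} [Finite σ] (h : Cardinal.aleph0 ≤ Algebra.trdeg k Ω)
    {I : Ideal (MvPolynomial σ K)} (hI : I ≠ ⊤) :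
    ∃ q : MvPolynomial σ Ω, ∀ (ρ : Type) [Finite ρ] (r : ρ → Ω), ∃ b : σ → Ω,
      (∀ f ∈ I, aeval b f = 0) ∧ eval b q ≠ 0 ∧
      ∀ g : MvPolynomial (σ ⊕ ρ) K, aeval (Sum.elim b r) g = 0 →
        ∀ x : σ → Ω, (∀ f ∈ I, aeval x f = 0) → eval x q ≠ 0 → aeval (Sum.elim x r) g = 0 := by
  classical
  let I' := I.map (map (algebraMap K k))
  have hI' : I' ≠ ⊤ := by
    intro h'
    rw [Ideal.eq_top_iff_one, ← map_one (map (algebraMap K k))] at h'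
    exact hI ((Ideal.eq_top_iff_one _).2 (map_mem_map_iff.1 h'))
  have hfin := I'.finite_minimalPrimes_of_isNoetherianRing
  obtain ⟨p, hp⟩ := Ideal.nonempty_minimalPrimes hI'
  have hpp : p.IsPrime := hp.1.1
  let s := hfin.toFinset.erase p
  have hs : ¬ s.inf id ≤ p := by
    rw [Ideal.IsPrime.inf_le' hpp]
    rintro ⟨i, hi, hip⟩
    have hi' : i ∈ I'.minimalPrimes := hfin.mem_toFinset.1 (Finset.mem_of_mem_erase hi)
    exact Finset.ne_of_mem_erase hi (le_antisymm hip (hp.2 hi'.1 hip))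
  obtain ⟨q₀, hq₀, hq₀'⟩ := SetLike.not_le_iff_exists.1 hs
  refine ⟨map (algebraMap k Ω) q₀, fun ρ _ r => ?_⟩
  let Λ := IntermediateField.adjoin k (Set.range r)
  have hΛ : Cardinal.aleph0 ≤ Algebra.trdeg Λ Ω := by
    by_contra! hlt
    have h₁ := trdeg_add_eq k Λ (A := Ω)
    have h₂ : Algebra.trdeg k Λ < Cardinal.aleph0 := by
      have : Algebra.EssFiniteType k Λ := by
        rw [IntermediateField.essFiniteType_iff]
        exact IntermediateField.fg_adjoin_of_finite (Set.finite_range r)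
      exact trdeg_lt_aleph0 k Λ
    exact (h₁ ▸ Cardinal.add_lt_aleph0 h₂ hlt).not_ge h
  have hJ : (p.map (map (algebraMap k Λ))).IsPrime := isPrime_map_of_isAlgClosed hpp
  obtain ⟨b, hb⟩ := exists_generic_point hΛ _ hJ
  have hbp : ∀ f ∈ p, aeval b f = 0 := fun f hf => by
    have := (hb _).2 (Ideal.mem_map_of_mem (map (algebraMap k Λ)) hf)
    rwa [aeval_map_algebraMap] at this
  have key : ∀ x : σ → Ω, (∀ f ∈ I, aeval x f = 0) → aeval x q₀ ≠ 0 →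
      ∀ f ∈ p, aeval x f = 0 := by
    intro x hx hq f hf
    have h₁ : f * q₀ ∈ I'.radical := by
      rw [← Ideal.sInf_minimalPrimes, Ideal.mem_sInf]
      intro P hP
      by_cases hPp : P = p
      · exact hPp ▸ Ideal.mul_mem_right _ _ hf
      · refine Ideal.mul_mem_left _ _ ?_
        exact (Finset.inf_le (f := id) (Finset.mem_erase.2 ⟨hPp, hfin.mem_toFinset.2 hP⟩)) hq₀
    obtain ⟨n, hn⟩ := h₁
    have h₂ : I' ≤ RingHom.ker (aeval (R := k) x) := by
      rw [Ideal.map_le_iff_le_comap]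
      intro f hf
      rw [Ideal.mem_comap, RingHom.mem_ker, aeval_map_algebraMap]
      exact hx f hf
    have h₃ := h₂ hn
    rw [RingHom.mem_ker, map_pow, map_mul] at h₃
    exact (mul_eq_zero.1 (eq_zero_of_pow_eq_zero h₃)).resolve_right hq
  refine ⟨b, fun f hf => ?_, ?_, fun g hg x hx hq => ?_⟩
  · have := hbp _ (hp.1.2 <| Ideal.mem_map_of_mem (map (algebraMap K k)) hf)
    rwa [aeval_map_algebraMap] at this
  · rw [eval_map, ← aeval_def]
    intro h0
    apply hq₀'
    rw [← map_mem_map_iff (Ω := Λ), ← hb, aeval_map_algebraMap]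
    exact h0
  · rw [eval_map, ← aeval_def] at hq
    have hxp := key x hx hq
    let r' : ρ → Λ := fun i => ⟨r i, IntermediateField.subset_adjoin k _ ⟨i, rfl⟩⟩
    have : IsScalarTower K Λ Ω := IsScalarTower.of_algebraMap_eq fun z => by
      rw [IsScalarTower.algebraMap_apply K k Ω, IsScalarTower.algebraMap_apply K k Λ]
      rfl
    let H : MvPolynomial σ Λ := aeval (Sum.elim X fun i => C (r' i)) g
    have hH : ∀ y : σ → Ω, aeval y H = aeval (Sum.elim y r) g := by
      intro y
      have : (aeval y : MvPolynomial σ Λ →ₐ[Λ] Ω) H =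
        ((aeval y : MvPolynomial σ Λ →ₐ[Λ] Ω).restrictScalars K) H := rfl
      rw [this]
      simp only [H]
      rw [← AlgHom.comp_apply, comp_aeval]
      congr 2
      ext i
      rcases i with i | i
      · simp
      · simp [r', IntermediateField.algebraMap_apply]
    rw [← hH, hb] at hg
    have h₂ : p.map (map (algebraMap k Λ)) ≤ RingHom.ker (aeval (R := Λ) x) := by
      rw [Ideal.map_le_iff_le_comap]
      intro f hf
      rw [Ideal.mem_comap, RingHom.mem_ker, aeval_map_algebraMap]
      exact hxp f hf
    rw [← hH]
    exact h₂ hg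

/-- A component of the variety of an ideal over `K` admits a polynomial, nonzero on it,
that cuts it out generically and such that there are points generic over any finite tuple. -/
theorem exists_generic_points {K Ω : Type w} [Field K] [Field Ω] [Algebra K Ω] [IsAlgClosed Ω]
    {σ : Type} [Finite σ] (h : Cardinal.aleph0 ≤ Algebra.trdeg K Ω)
    {I : Ideal (MvPolynomial σ K)} (hI : I ≠ ⊤) :
    ∃ q : MvPolynomial σ Ω, ∀ (ρ : Type) [Finite ρ] (r : ρ → Ω), ∃ b : σ → Ω,
      (∀ f ∈ I, aeval b f = 0) ∧ eval b q ≠ 0 ∧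
      ∀ g : MvPolynomial (σ ⊕ ρ) K, aeval (Sum.elim b r) g = 0 →
        ∀ x : σ → Ω, (∀ f ∈ I, aeval x f = 0) → eval x q ≠ 0 → aeval (Sum.elim x r) g = 0 := by
  have : IsAlgClosed (algebraicClosure K Ω) :=
    (IsAlgClosure.isAlgClosed K : IsAlgClosed (algebraicClosure K Ω))
  refine exists_generic_points_aux (k := algebraicClosure K Ω) ?_ hI
  have h₁ := trdeg_add_eq K (algebraicClosure K Ω) (A := Ω)
  rw [trdeg_eq_zero, zero_add] at h₁
  rwa [h₁]

end GenericPoints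

section BoundedDegree

open Polynomial

theorem finiteDimensional_of_isSeparable_of_natDegree_le {F E : Type w} [Field F] [Field E]
    [Algebra F E] [Algebra.IsSeparable F E] (d : ℕ)
    (h : ∀ x : E, (minpoly F x).natDegree ≤ d) : FiniteDimensional F E := by
  classical
  have hex : ∃ n, ∃ x : E, d - (minpoly F x).natDegree = n := ⟨_, 0, rfl⟩
  obtain ⟨x, hx⟩ := Nat.find_spec hex
  have hmax : ∀ y : E, (minpoly F y).natDegree ≤ (minpoly F x).natDegree := by
    intro y
    have := Nat.find_min' hex ⟨y, rfl⟩
    have h₁ := h x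
    have h₂ := h y
    omega
  have hint : ∀ y : E, IsIntegral F y := fun y => Algebra.IsIntegral.isIntegral y
  have htop : IntermediateField.adjoin F {x} = ⊤ := by
    rw [eq_top_iff]
    intro y _
    let G := IntermediateField.adjoin F ({x, y} : Set E)
    have : FiniteDimensional F G :=
      IntermediateField.finiteDimensional_adjoin fun z _ => hint z
    obtain ⟨z, hz⟩ := Field.exists_primitive_element F G
    have hzG : IntermediateField.adjoin F {(z : E)} = G := by
      have := congrArg (IntermediateField.map G.val) hz
      rw [IntermediateField.adjoin_map, Set.image_singleton] at this
      rw [← AlgHom.fieldRange_eq_map, IntermediateField.fieldRange_val] at this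
      exact this
    have hle : IntermediateField.adjoin F {x} ≤ G :=
      IntermediateField.adjoin.mono F _ _ (by simp)
    have hfr : Module.finrank F G ≤ Module.finrank F (IntermediateField.adjoin F {x}) := by
      rw [← hzG, IntermediateField.adjoin.finrank (hint _), IntermediateField.adjoin.finrank (hint _)]
      exact hmax _
    have := IntermediateField.eq_of_le_of_finrank_le hle hfr
    rw [this]
    exact IntermediateField.subset_adjoin F _ (by simp)
  have : FiniteDimensional F (IntermediateField.adjoin F {x}) :=
    IntermediateField.adjoin.finiteDimensional (hint x)
  rw [htop] at this
  exact IntermediateField.topEquiv.toLinearEquiv.finiteDimensional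

theorem perfectField_of_natDegree_le {F E : Type w} [Field F] [Field E] [IsAlgClosed E]
    [Algebra F E] (d : ℕ) (h : ∀ x : E, (minpoly F x).natDegree ≤ d) : PerfectField F := by
  obtain ⟨p, hp⟩ := ExpChar.exists F
  cases hp with
  | zero => infer_instance
  | @prime p hp =>
    have : Fact p.Prime := ⟨hp⟩
    have : ExpChar F p := .prime hp
    suffices hs : Function.Surjective (frobenius F p) by
      have := PerfectRing.ofSurjective F p hs
      exact PerfectRing.toPerfectField F p
    intro a
    obtain ⟨b, hb⟩ := IsAlgClosed.exists_pow_nat_eq (algebraMap F E a)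
      (n := p ^ (d + 1)) (pow_pos hp.pos _)
    have hbp : b ∈ perfectClosure F E := by
      rw [mem_perfectClosure_iff_pow_mem p]
      exact ⟨d + 1, a, hb.symm⟩
    obtain ⟨n, y, hny⟩ := IsPurelyInseparable.minpoly_eq_X_pow_sub_C F p (⟨b, hbp⟩ : perfectClosure F E)
    have hmin : minpoly F b = X ^ p ^ n - C y := by
      rw [← hny]
      exact minpoly.algebraMap_eq (A := F) (B := perfectClosure F E)
        (algebraMap (perfectClosure F E) E).injective ⟨b, hbp⟩
    have hn : n < d + 1 := by
      have h₁ := h b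
      rw [hmin, natDegree_X_pow_sub_C] at h₁
      have := Nat.lt_pow_self (n := n) hp.one_lt
      omega
    have hby : b ^ p ^ n = algebraMap F E y := by
      have := minpoly.aeval F b
      rw [hmin] at this
      simpa [sub_eq_zero] using this
    refine ⟨y ^ p ^ (d - n), (algebraMap F E).injective ?_⟩
    rw [frobenius_def, ← pow_mul, ← pow_succ, map_pow, ← hby, ← pow_mul, ← pow_add, ← hb]
    congr 2
    omega

theorem finiteDimensional_of_natDegree_le {F E : Type w} [Field F] [Field E] [IsAlgClosed E]
    [Algebra F E] [Algebra.IsAlgebraic F E] (d : ℕ)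
    (h : ∀ x : E, (minpoly F x).natDegree ≤ d) : FiniteDimensional F E := by
  have := perfectField_of_natDegree_le d h
  exact finiteDimensional_of_isSeparable_of_natDegree_le d h

open IntermediateField.algebraAdjoinAdjoin in
/-- An algebraically closed field that is finitely generated as a field extension of `k`
is finite over `k`. -/
theorem finiteDimensional_of_essFiniteType {k E : Type w} [Field k] [Field E] [IsAlgClosed E]
    [Algebra k E] [Algebra.EssFiniteType k E] : FiniteDimensional k E := by
  obtain ⟨s, hs⟩ := exists_isTranscendenceBasis k E
  rcases isEmpty_or_nonempty s with he | ⟨⟨b⟩⟩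
  · have : Algebra.IsAlgebraic k E := hs.isEmpty_iff_isAlgebraic.1 he
    exact Algebra.finite_of_essFiniteType_of_isAlgebraic
  exfalso
  let K := IntermediateField.adjoin k (s : Set E)
  have : Algebra.IsAlgebraic K E := by
    have := hs.isAlgebraic_field
    rwa [Subtype.range_coe] at this
  have : Algebra.EssFiniteType K E := Algebra.EssFiniteType.of_comp k K E
  have hfin : FiniteDimensional K E := Algebra.finite_of_essFiniteType_of_isAlgebraic
  let R := Algebra.adjoin k (s : Set E)
  let e : MvPolynomial s k ≃ₐ[k] R := by
    refine hs.1.aevalEquiv.trans (Subalgebra.equivOfEq _ _ ?_)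
    rw [Subtype.range_coe]
  have he : (e (MvPolynomial.X b) : E) = b := by
    simp [e]
  have : UniqueFactorizationMonoid R :=
    e.toMulEquiv.uniqueFactorizationMonoid inferInstance
  obtain ⟨p, hpD, hp⟩ := Nat.exists_infinite_primes (Module.finrank K E + 1)
  let t : K := ⟨b, IntermediateField.subset_adjoin k _ b.2⟩
  have hirr : Irreducible (X ^ p - C t) := by
    refine X_pow_sub_C_irreducible_of_prime hp fun x hx => ?_
    have hx' : x ^ p = algebraMap R K (e (MvPolynomial.X b)) := by
      rw [hx]
      exact Subtype.ext he.symm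
    obtain ⟨y, hy⟩ := IsIntegrallyClosed.exists_algebraMap_eq_of_isIntegral_pow (R := R) (K := K)
      hp.pos (hx' ▸ isIntegral_algebraMap)
    rw [← hy, ← map_pow] at hx'
    have hy' := IsFractionRing.injective R K hx'
    have hX : Irreducible (MvPolynomial.X b : MvPolynomial s k) := MvPolynomial.X_prime.irreducible
    rw [← MulEquiv.irreducible_iff e.toMulEquiv] at hX
    have hX' : Irreducible (y ^ p) := by
      rw [hy']
      exact hX
    exact not_irreducible_pow hp.ne_one hX'
  obtain ⟨c, hc⟩ := IsAlgClosed.exists_pow_nat_eq (b : E) hp.pos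
  have hmin : minpoly K c = X ^ p - C t := by
    symm
    refine minpoly.eq_of_irreducible_of_monic hirr ?_ (monic_X_pow_sub_C t hp.ne_zero)
    simp only [map_sub, map_pow, aeval_X, aeval_C, hc]
    exact sub_self _
  have := minpoly.natDegree_le (A := K) c
  rw [hmin, natDegree_X_pow_sub_C] at this
  omega

theorem exists_forall_sum_mul_pow_eq_zero {k N : Type w} [Field k] [Field N] [IsAlgClosed N]
    [Algebra k N] (hinf : ¬ FiniteDimensional k N) (E : Submodule k N) [FiniteDimensional k E]
    (d : ℕ) : ∃ c : N, ∀ e : ℕ → N, (∀ i, e i ∈ E) →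
      ∑ i ∈ Finset.range (d + 1), e i * c ^ i = 0 → ∀ i < d + 1, e i = 0 := by
  let Q := IntermediateField.adjoin k (E : Set N)
  have hQ : Algebra.EssFiniteType k Q := by
    rw [IntermediateField.essFiniteType_iff]
    obtain ⟨s, hs⟩ := (Module.Finite.iff_fg (R := k) (N := E)).1 inferInstance
    refine ⟨s, le_antisymm (IntermediateField.adjoin.mono k _ _ ?_)
      (IntermediateField.adjoin_le_iff.2 ?_)⟩
    · rw [← hs]
      exact Submodule.subset_span
    · rw [← hs]
      intro x hx
      exact Submodule.span_le (p := (Subalgebra.toSubmodule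
        (IntermediateField.adjoin k (s : Set N)).toSubalgebra)).2
        (IntermediateField.subset_adjoin k _) hx
  by_contra! hcon
  have hdeg : ∀ c : N, ∃ f : Q[X], f ≠ 0 ∧ f.natDegree ≤ d ∧ aeval c f = 0 := by
    intro c
    obtain ⟨e, he, hs, i, hi, hne⟩ := hcon c
    let e' : ℕ → Q := fun i => ⟨e i, IntermediateField.subset_adjoin k _ (he i)⟩
    let f : Q[X] := ∑ i ∈ Finset.range (d + 1), C (e' i) * X ^ i
    refine ⟨f, fun h0 => ?_, ?_, ?_⟩
    · have := congrArg (fun g : Q[X] => g.coeff i) h0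
      simp only [f, finsetSum_coeff, coeff_C_mul, coeff_X_pow, coeff_zero, mul_ite, mul_one,
        mul_zero, Finset.sum_ite_eq, Finset.mem_range, hi, if_true] at this
      exact hne (congrArg Subtype.val this)
    · refine natDegree_sum_le_of_forall_le _ _ fun j hj => ?_
      refine (natDegree_C_mul_X_pow_le _ _).trans ?_
      have := Finset.mem_range.1 hj
      omega
    · simp only [f, map_sum, map_mul, aeval_C, map_pow, aeval_X]
      exact hs
  have halg : Algebra.IsAlgebraic Q N := ⟨fun c => by
    obtain ⟨f, h0, -, h⟩ := hdeg c
    exact ⟨f, h0, h⟩⟩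
  have : FiniteDimensional Q N := by
    refine finiteDimensional_of_natDegree_le d fun c => ?_
    obtain ⟨f, h0, hd, h⟩ := hdeg c
    exact (natDegree_le_of_dvd (minpoly.dvd Q c h) h0).trans hd
  have : Algebra.EssFiniteType k N := Algebra.EssFiniteType.comp k Q N
  exact hinf finiteDimensional_of_essFiniteType

theorem exists_forall_sum_mul_prod_pow_eq_zero {k N : Type w} [Field k] [Field N] [IsAlgClosed N]
    [Algebra k N] (hinf : ¬ FiniteDimensional k N) (d n : ℕ) (E : Submodule k N)
    [FiniteDimensional k E] : ∃ c : Fin n → N, ∀ e : (Fin n → Fin (d + 1)) → N,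
      (∀ μ, e μ ∈ E) → ∑ μ, e μ * ∏ i, c i ^ (μ i : ℕ) = 0 → ∀ μ, e μ = 0 := by
  induction n generalizing E with
  | zero =>
    refine ⟨Fin.elim0, fun e _ h μ => ?_⟩
    rw [Fintype.sum_unique, Finset.univ_eq_empty, Finset.prod_empty, mul_one] at h
    exact (congrArg e (Subsingleton.elim _ _)).trans h
  | succ n ih =>
    obtain ⟨c₀, hc₀⟩ := exists_forall_sum_mul_pow_eq_zero hinf E d
    obtain ⟨c, hc⟩ := ih (⨆ i : Fin (d + 1), E.map (LinearMap.mulRight k (c₀ ^ (i : ℕ))))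
    refine ⟨Fin.cons c₀ c, fun e he h μ => ?_⟩
    rw [← (Fin.consEquiv fun _ => Fin (d + 1)).sum_comp, Fintype.sum_prod_type_right] at h
    have h₁ := hc (fun ν => ∑ i : Fin (d + 1), e (Fin.cons i ν) * c₀ ^ (i : ℕ)) (fun ν => by
      refine Submodule.sum_mem _ fun i _ => ?_
      exact Submodule.mem_iSup_of_mem i ⟨_, he _, rfl⟩) (by
      rw [← h]
      refine Finset.sum_congr rfl fun ν _ => ?_
      rw [Finset.sum_mul]
      refine Finset.sum_congr rfl fun i _ => ?_
      simp [Fin.consEquiv, Fin.prod_univ_succ, mul_assoc]) (Fin.tail μ)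
    let e' : ℕ → N := fun i => if h : i < d + 1 then e (Fin.cons ⟨i, h⟩ (Fin.tail μ)) else 0
    have h₂ := hc₀ e' (fun i => by
      simp only [e']
      split_ifs
      · exact he _
      · exact E.zero_mem) (by
      rw [Finset.sum_range, ← h₁]
      refine Finset.sum_congr rfl fun i _ => ?_
      simp only [e', dif_pos i.2]) (μ 0) (μ 0).2
    simp only [e', dif_pos (μ 0).2] at h₂
    rwa [Fin.eta, Fin.cons_self_tail] at h₂

end BoundedDegree

section Patterns

/-- A combinatorial shape of consistency and inconsistency requirements on a family of parameters
indexed by `Index`: the sets `cons ξ` index consistent families, `inc` the inconsistent pairs. -/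
structure Pattern where
  Index : Type
  Branch : Type
  countable : Countable Index
  cons : Branch → Set Index
  inc : Index → Index → Prop

variable {L : FirstOrder.Language.{u, v}}

/-- The family `a` witnesses the pattern for the formula `φ`. -/
def Pattern.Witness (pat : Pattern) {M : Type w} [L.Structure M] {α β : Type}
    (φ : L.Formula (α ⊕ β)) (a : pat.Index → β → M) : Prop :=
  (∀ (ξ : pat.Branch) (Y : Finset pat.Index), ↑Y ⊆ pat.cons ξ →
      ∃ b : α → M, ∀ i ∈ Y, φ.Realize (Sum.elim b (a i))) ∧
  (∀ i j, pat.inc i j →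
      ¬ ∃ b : α → M, φ.Realize (Sum.elim b (a i)) ∧ φ.Realize (Sum.elim b (a j)))

/-- Some formula has the pattern in some model of `T`. -/
def Pattern.Has (pat : Pattern) (T : L.Theory) : Prop :=
  ∃ (M : Theory.ModelType.{u, v, max u v} T) (n m : ℕ)
    (φ : L.Formula (Fin n ⊕ Fin m)) (a : pat.Index → Fin m → M), pat.Witness φ a

/-- Every countable colouring of the branches has a colour on which the pattern reappears. -/
def Pattern.Baire (pat : Pattern) : Prop :=
  ∀ (Γ : Type) [Countable Γ] (col : pat.Branch → Γ), ∃ (γ : Γ) (g : pat.Index → pat.Index),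
    (∀ i j, pat.inc i j → pat.inc (g i) (g j)) ∧
    ∀ (ξ : pat.Branch) (Y : Finset pat.Index), ↑Y ⊆ pat.cons ξ →
      ∃ ξ', col ξ' = γ ∧ ∀ i ∈ Y, g i ∈ pat.cons ξ'

/-- The tree property of the first kind as a pattern. -/
def patternTP1 : Pattern where
  Index := List ℕ
  Branch := ℕ → ℕ
  countable := inferInstance
  cons f := Set.range fun i => (List.range i).map f
  inc η ν := ¬ η <+: ν ∧ ¬ ν <+: η

/-- The tree property of the second kind as a pattern. -/
def patternTP2 : Pattern where
  Index := ℕ × ℕ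
  Branch := ℕ → ℕ
  countable := inferInstance
  cons f := Set.range fun i => (i, f i)
  inc p q := p.1 = q.1 ∧ p.2 ≠ q.2

/-- The antichain tree property as a pattern. -/
def patternATP : Pattern where
  Index := List Bool
  Branch := {X : Set (List Bool) // IsTreeAntichain X}
  countable := inferInstance
  cons X := X
  inc η ν := η ≠ ν ∧ TreeComparable η ν

theorem exists_finset_bound {f : ℕ → ι} (Y : Finset ι) (h : ↑Y ⊆ Set.range f) :
    ∃ k, ∀ x ∈ Y, ∃ i ≤ k, f i = x := by
  classical
  choose! r hr using fun x (hx : x ∈ Y) => h hx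
  exact ⟨Y.sup r, fun x hx => ⟨r x, Finset.le_sup hx, hr x hx⟩⟩

theorem has_patternTP1_iff (T : L.Theory) : patternTP1.Has T ↔ T.HasTP1 := by
  refine exists_congr fun M => exists_congr fun n => exists_congr fun m => exists_congr fun φ =>
    exists_congr fun a => and_congr ⟨fun h f k => ?_, fun h f Y hY => ?_⟩
      ⟨fun h η ν h₁ h₂ => h η ν ⟨h₁, h₂⟩, fun h η ν h₁ => h η ν h₁.1 h₁.2⟩
  · classical
    obtain ⟨b, hb⟩ := h f ((Finset.range (k + 1)).image fun i => (List.range i).map f) (by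
      intro x hx
      obtain ⟨i, -, rfl⟩ := Finset.mem_image.1 hx
      exact ⟨i, rfl⟩)
    refine ⟨b, fun i hi => hb _ (Finset.mem_image_of_mem _ (Finset.mem_range.2 ?_))⟩
    omega
  · obtain ⟨k, hk⟩ := exists_finset_bound Y hY
    obtain ⟨b, hb⟩ := h f k
    refine ⟨b, fun i hi => ?_⟩
    obtain ⟨j, hj, rfl⟩ := hk i hi
    exact hb j hj

theorem has_patternTP2_iff (T : L.Theory) : patternTP2.Has T ↔ T.HasTP2 := by
  refine exists_congr fun M => exists_congr fun n => exists_congr fun m => exists_congr fun φ =>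
    ⟨fun ⟨a, ha⟩ => ⟨fun i j => a (i, j), fun f k => ?_, fun i j j' hj => ?_⟩,
      fun ⟨a, ha⟩ => ⟨fun p => a p.1 p.2, fun f Y hY => ?_, fun p q h => ?_⟩⟩
  · classical
    obtain ⟨b, hb⟩ := ha.1 f ((Finset.range (k + 1)).image fun i => (i, f i)) (by
      intro x hx
      obtain ⟨i, -, rfl⟩ := Finset.mem_image.1 hx
      exact ⟨i, rfl⟩)
    refine ⟨b, fun i hi => hb _ (Finset.mem_image_of_mem _ (Finset.mem_range.2 ?_))⟩
    omega
  · exact ha.2 (i, j) (i, j') ⟨rfl, hj⟩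
  · obtain ⟨k, hk⟩ := exists_finset_bound Y hY
    obtain ⟨b, hb⟩ := ha.1 f k
    refine ⟨b, fun i hi => ?_⟩
    obtain ⟨j, hj, rfl⟩ := hk i hi
    exact hb j hj
  · obtain ⟨i, j⟩ := p
    obtain ⟨i', j'⟩ := q
    obtain ⟨h₁, h₂⟩ := h
    obtain rfl : i = i' := h₁
    exact ha.2 i j j' h₂

theorem has_patternATP_iff (T : L.Theory) : patternATP.Has T ↔ T.HasATP := by
  refine exists_congr fun M => exists_congr fun n => exists_congr fun m => exists_congr fun φ =>
    exists_congr fun a => and_congr ⟨fun h X hX => h ⟨X, hX⟩ X subset_rfl, fun h X Y hY => ?_⟩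
      ⟨fun h η ν h₁ h₂ => h η ν ⟨h₁, h₂⟩, fun h η ν h₁ => h η ν h₁.1 h₁.2⟩
  exact h Y fun η hη ν hν => X.2 η (hY hη) ν (hY hν)

theorem exists_color_dense {Γ : Type} [Countable Γ] (col : (ℕ → ℕ) → Γ) :
    ∃ (γ : Γ) (k : ℕ) (s : ℕ → ℕ), ∀ (f : ℕ → ℕ) (n : ℕ), ∃ f', col f' = γ ∧
      (∀ i < k, f' i = s i) ∧ ∀ i < n, f' (k + i) = f i := by
  obtain ⟨γ, s, hs⟩ := nonempty_interior_of_iUnion_of_closed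
    (f := fun γ => closure (col ⁻¹' {γ})) (fun _ => isClosed_closure)
    (Set.eq_univ_of_forall fun f => Set.mem_iUnion.2 ⟨col f, subset_closure rfl⟩)
  obtain ⟨A, U, hU, hA⟩ := isOpen_pi_iff.1 isOpen_interior s hs
  refine ⟨γ, A.sup id + 1, s, fun f n => ?_⟩
  set k := A.sup id + 1
  let f₁ : ℕ → ℕ := fun i => if i < k then s i else f (i - k)
  have hf₁ : f₁ ∈ closure (col ⁻¹' {γ}) := by
    refine interior_subset (hA fun i hi => ?_)
    have hik : i < k := Nat.lt_succ_of_le (Finset.le_sup (f := id) hi)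
    simp only [f₁, if_pos hik]
    exact (hU i hi).2
  have hopen : IsOpen (Set.pi (Finset.range (k + n) : Set ℕ) fun i => ({f₁ i} : Set ℕ)) :=
    isOpen_set_pi (Finset.finite_toSet _) fun _ _ => isOpen_discrete _
  obtain ⟨f', h₁, h₂⟩ := mem_closure_iff.1 hf₁ _ hopen (fun i _ => rfl)
  have h₃ : ∀ i < k + n, f' i = f₁ i := fun i hi => h₁ i (by simpa using hi)
  refine ⟨f', h₂, fun i hi => ?_, fun i hi => ?_⟩
  · rw [h₃ i (by omega)]
    simp [f₁, hi]
  · rw [h₃ (k + i) (by omega)]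
    simp [f₁]

theorem patternTP1_baire : patternTP1.Baire := by
  intro Γ _ col
  obtain ⟨γ, k, s, h⟩ := exists_color_dense col
  refine ⟨γ, fun η : List ℕ => (List.range k).map s ++ η, fun η ν hην => ?_, fun f Y hY => ?_⟩
  · exact ⟨fun h => hην.1 ((List.prefix_append_right_inj _).1 h),
      fun h => hην.2 ((List.prefix_append_right_inj _).1 h)⟩
  · obtain ⟨n, hn⟩ := exists_finset_bound Y hY
    obtain ⟨f', hf', h₁, h₂⟩ := h f n
    refine ⟨f', hf', fun i hi => ?_⟩
    obtain ⟨j, hj, rfl⟩ := hn i hi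
    refine ⟨k + j, ?_⟩
    change (List.range (k + j)).map f' = _
    rw [List.range_add, List.map_append, List.map_map]
    congr 1
    · exact List.map_congr_left fun i hi => h₁ i (List.mem_range.1 hi)
    · exact List.map_congr_left fun i hi => h₂ i ((List.mem_range.1 hi).trans_le hj)

theorem patternTP2_baire : patternTP2.Baire := by
  intro Γ _ col
  obtain ⟨γ, k, s, h⟩ := exists_color_dense col
  refine ⟨γ, fun p => (k + p.1, p.2), fun p q hpq => ?_, fun f Y hY => ?_⟩
  · exact ⟨congrArg (k + ·) hpq.1, hpq.2⟩
  · obtain ⟨n, hn⟩ := exists_finset_bound Y hY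
    obtain ⟨f', hf', h₁, h₂⟩ := h f (n + 1)
    refine ⟨f', hf', fun i hi => ?_⟩
    obtain ⟨j, hj, rfl⟩ := hn i hi
    exact ⟨k + j, Prod.ext rfl (h₂ j (Nat.lt_succ_of_le hj))⟩

theorem not_prefix_of_replicate_lt {m n : ℕ} (h : m < n) (x y : List Bool) :
    ¬ TreeComparable (List.replicate m true ++ false :: x) (List.replicate n true ++ false :: y) := by
  obtain ⟨k, rfl⟩ := Nat.exists_eq_add_of_lt h
  have : List.replicate (m + k + 1) true = List.replicate m true ++ true :: List.replicate k true := by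
    rw [add_assoc, List.replicate_add, List.replicate_succ]
  rw [this, List.append_assoc]
  rintro (h | h) <;> rw [List.prefix_append_right_inj] at h <;> simp [List.cons_prefix_cons] at h

theorem patternATP_baire : patternATP.Baire := by
  intro Γ _ col
  by_contra! hcon
  obtain ⟨e, he⟩ := exists_injective_nat Γ
  let g : Γ → List Bool → List Bool := fun γ η => List.replicate (e γ) true ++ false :: η
  have hpre : ∀ γ η ν, g γ η <+: g γ ν ↔ η <+: ν := fun γ η ν => by
    simp only [g]
    rw [List.prefix_append_right_inj, List.cons_prefix_cons]
    simp
  have hinj : ∀ γ η ν, g γ η = g γ ν → η = ν := fun γ η ν h => by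
    simpa [g] using h
  choose ξ Y hY hbad using fun γ => hcon γ (g γ) fun η ν h =>
    ⟨fun h' => h.1 (hinj _ _ _ h'), h.2.imp (hpre _ _ _).2 (hpre _ _ _).2⟩
  let X : Set (List Bool) := {η | ∃ γ, ∃ ν ∈ Y γ, g γ ν = η}
  have hX : IsTreeAntichain X := by
    rintro _ ⟨γ, η, hη, rfl⟩ _ ⟨γ', ν, hν, rfl⟩ hne hcomp
    rcases lt_trichotomy (e γ) (e γ') with h | h | h
    · exact not_prefix_of_replicate_lt h _ _ hcomp
    · obtain rfl := he h
      exact (ξ γ).2 η (hY γ hη) ν (hY γ hν) (fun h => hne (congrArg _ h))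
        (hcomp.imp (hpre _ _ _).1 (hpre _ _ _).1)
    · exact not_prefix_of_replicate_lt h _ _ hcomp.symm
  obtain ⟨i, hi, hiX⟩ := hbad _ ⟨X, hX⟩ rfl
  exact hiX ⟨_, i, hi, rfl⟩

end Patterns

section ElementaryExtensions

variable {L : FirstOrder.Language.{u, v}}

/-- Compactness: a set of formulas finitely satisfiable in `M` is realized in an elementary
extension. -/
theorem exists_elementary_realization {M β : Type (max u v)} [L.Structure M] [Nonempty M]
    (Φ : Set (L.Formula (M ⊕ β)))
    (h : ∀ s : Finset (L.Formula (M ⊕ β)), ↑s ⊆ Φ →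
      ∃ w : β → M, ∀ φ ∈ s, φ.Realize (Sum.elim id w)) :
    ∃ (N : Type (max u v)) (_ : L.Structure N) (i : M ↪ₑ[L] N) (w : β → N),
      ∀ φ ∈ Φ, φ.Realize (Sum.elim i w) := by
  classical
  let D : Set (L.Formula (M ⊕ β)) :=
    Φ ∪ {φ | ∃ ψ : L.Formula M, ψ.Realize id ∧ φ = ψ.relabel Sum.inl}
  have hsat : Theory.IsSatisfiable (Formula.equivSentence '' D : L[[M ⊕ β]].Theory) := by
    rw [Theory.isSatisfiable_iff_isFinitelySatisfiable]
    intro T₀ hT₀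
    obtain ⟨s, hs, rfl⟩ := Finset.subset_set_image_iff.1 hT₀
    obtain ⟨w, hw⟩ := h (s.filter (· ∈ Φ)) (by intro x; simp)
    let : (constantsOn (M ⊕ β)).Structure M := constantsOn.structure (Sum.elim id w)
    have : M ⊨ (((s.image Formula.equivSentence : Finset _) : Set _) : L[[M ⊕ β]].Theory) := by
      refine (Theory.model_iff _).2 fun φ hφ => ?_
      obtain ⟨ψ, hψ, rfl⟩ := Finset.mem_image.1 hφ
      refine (Formula.realize_equivSentence _ _).2 ?_
      change ψ.Realize (Sum.elim id w)
      rcases hs hψ with h₁ | ⟨χ, hχ, rfl⟩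
      · exact hw _ (Finset.mem_filter.2 ⟨hψ, h₁⟩)
      · rw [Formula.realize_relabel]
        exact hχ
    exact Theory.Model.isSatisfiable M
  obtain ⟨N⟩ := hsat
  let : L.Structure N := (L.lhomWithConstants (M ⊕ β)).reduct N
  have hN : ∀ φ ∈ D, φ.Realize fun a => (L.con a : N) := fun φ hφ =>
    (Formula.realize_equivSentence _ _).1
      ((Theory.model_iff _).1 N.is_model _ (Set.mem_image_of_mem _ hφ))
  have key : ∀ ψ : L.Formula M, ψ.Realize id →
      ψ.Realize fun a => (L.con (Sum.inl a : M ⊕ β) : N) := fun ψ hψ => by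
    have := hN (ψ.relabel Sum.inl) (Or.inr ⟨ψ, hψ, rfl⟩)
    rwa [Formula.realize_relabel] at this
  refine ⟨N, this, ⟨fun a => (L.con (Sum.inl a : M ⊕ β) : N), fun n φ x => ?_⟩,
    fun b => (L.con (Sum.inr b : M ⊕ β) : N), fun φ hφ => ?_⟩
  · by_cases hx : φ.Realize x
    · refine iff_of_true ?_ hx
      have := key (φ.relabel x) (by rwa [Formula.realize_relabel])
      rwa [Formula.realize_relabel] at this
    · refine iff_of_false ?_ hx
      have := key (φ.not.relabel x) (by rwa [Formula.realize_relabel])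
      rwa [Formula.realize_relabel] at this
  · convert hN φ (Or.inl hφ) using 1
    ext (a | b) <;> rfl

/-- The projection of a formula to a finite tuple of its variables is definable. -/
theorem exists_formula_projection {V κ : Type w} [Finite κ] (θ : L.Formula V) (f : κ → V) :
    ∃ χ : L.Formula κ, ∀ (M : Type (max u v)) [L.Structure M] [Nonempty M] (w : κ → M),
      χ.Realize w ↔ ∃ z : V → M, θ.Realize z ∧ ∀ k, z (f k) = w k := by
  classical
  let _ := Fintype.ofFinite κ
  let F : Finset V := θ.freeVarFinset ∪ Finset.univ.image f
  let θ' : L.Formula F := θ.restrictFreeVar fun x => ⟨x, Finset.mem_union_left _ x.2⟩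
  have hθ : ∀ (M : Type (max u v)) [L.Structure M] (z : V → M),
      θ'.Realize (fun x => z x) ↔ θ.Realize z := fun M _ z =>
    BoundedFormula.realize_restrictFreeVar (v' := z) (fun a => rfl)
  let g : κ → F := fun k =>
    ⟨f k, Finset.mem_union_right _ (Finset.mem_image_of_mem _ (Finset.mem_univ k))⟩
  let eqs : L.Formula (κ ⊕ F) := Formula.iInf fun k =>
    Term.equal (Term.var (Sum.inr (g k))) (Term.var (Sum.inl k))
  have heqs : ∀ (M : Type (max u v)) [L.Structure M] (w : κ → M) (z : F → M),
      eqs.Realize (Sum.elim w z) ↔ ∀ k, z (g k) = w k := fun M _ w z => by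
    simp [eqs, Formula.realize_iInf, Formula.realize_equal]
  refine ⟨Formula.iExs F (θ'.relabel Sum.inr ⊓ eqs), fun M _ _ w => ?_⟩
  simp only [Formula.realize_iExs, Formula.realize_inf, Formula.realize_relabel, heqs,
    Sum.elim_comp_inr]
  constructor
  · rintro ⟨z, hz, hzw⟩
    refine ⟨fun x => if hx : x ∈ F then z ⟨x, hx⟩ else Classical.arbitrary M, ?_, fun k => ?_⟩
    · rw [← hθ]
      convert hz using 1
      ext x
      simp
    · rw [← hzw k]
      exact dif_pos (g k).2
  · rintro ⟨z, hz, hzw⟩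
    exact ⟨fun x => z x, (hθ M z).2 hz, hzw⟩

theorem exists_elementary_natLERec {G : ℕ → Type w} [∀ n, L.Structure (G n)]
    (f : ∀ n, G n ↪ₑ[L] G (n + 1)) {m n : ℕ} (h : m ≤ n) :
    ∃ e : G m ↪ₑ[L] G n,
      ∀ x, e x = DirectedSystem.natLERec (fun n => (f n).toEmbedding) m n h x := by
  induction n, h using Nat.le_induction with
  | base => exact ⟨ElementaryEmbedding.refl L _, fun x => by
      rw [DirectedSystem.coe_natLERec]; exact (Nat.leRecOn_self x).symm⟩
  | succ n hn ih =>
    obtain ⟨e, he⟩ := ih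
    refine ⟨(f n).comp e, fun x => ?_⟩
    rw [DirectedSystem.coe_natLERec, ElementaryEmbedding.comp_apply, he,
      DirectedSystem.coe_natLERec]
    exact (Nat.leRecOn_succ hn x).symm

/-- Every chain of elementary embeddings has an elementary colimit. -/
theorem exists_elementary_chain_colimit {G : ℕ → Type w} [∀ n, L.Structure (G n)]
    (f : ∀ n, G n ↪ₑ[L] G (n + 1)) :
    ∃ (N : Type w) (_ : L.Structure N) (j : ∀ n, G n ↪ₑ[L] N),
      (∀ n x, j (n + 1) (f n x) = j n x) ∧ ∀ z : N, ∃ n x, j n x = z := by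
  let F := DirectedSystem.natLERec fun n => (f n).toEmbedding
  let N : Type w := Language.DirectLimit G F
  let j : ∀ n, G n ↪[L] N := Language.DirectLimit.of L ℕ G F
  have hj : ∀ {k : ℕ} {α : Type} (φ : L.BoundedFormula α k) (n : ℕ) (v : α → G n)
      (xs : Fin k → G n), φ.Realize (j n ∘ v) (j n ∘ xs) ↔ φ.Realize v xs := by
    intro k α φ
    induction φ with
    | falsum => intros; rfl
    | equal t₁ t₂ =>
      intro n v xs
      simp only [BoundedFormula.Realize, ← Sum.comp_elim, HomClass.realize_term, (j n).injective.eq_iff]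
    | rel R ts =>
      intro n v xs
      simp only [BoundedFormula.Realize, ← Sum.comp_elim, HomClass.realize_term]
      exact (j n).map_rel R _
    | imp _ _ ih₁ ih₂ =>
      intro n v xs
      simp only [BoundedFormula.realize_imp, ih₁, ih₂]
    | all φ ih =>
      intro n v xs
      simp only [BoundedFormula.realize_all]
      constructor
      · intro h a
        rw [← ih, Fin.comp_snoc]
        exact h _
      · intro h z
        obtain ⟨m, y, rfl⟩ := Language.DirectLimit.exists_of z
        let l := max n m
        obtain ⟨e, he⟩ := exists_elementary_natLERec f (le_max_left n m)
        have hn : ∀ x, j n x = j l (e x) := fun x => by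
          rw [he]
          exact (Language.DirectLimit.of_f (f := F) (hij := le_max_left n m)).symm
        have hm : Language.DirectLimit.of L ℕ G F m y = j l (F m l (le_max_right n m) y) :=
          (Language.DirectLimit.of_f (f := F) (hij := le_max_right n m)).symm
        have h' : φ.all.Realize v xs := BoundedFormula.realize_all.2 h
        rw [← e.map_boundedFormula, BoundedFormula.realize_all] at h'
        have := (ih l _ _).2 (h' (F m l (le_max_right n m) y))
        rw [Fin.comp_snoc] at this
        rw [hm]
        rw [← Function.comp_assoc, ← Function.comp_assoc] at this
        rwa [show ⇑(j n) = j l ∘ e from funext hn]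
  refine ⟨N, inferInstance, fun n => ⟨j n, fun k φ x => ?_⟩, fun n x => ?_, fun z => ?_⟩
  · rw [Formula.Realize, Formula.Realize, ← hj φ n x default]
    exact iff_of_eq (congrArg _ (Subsingleton.elim _ _))
  · have := Language.DirectLimit.of_f (L := L) (f := F) (hij := n.le_succ) (x := x)
    refine Eq.trans (congrArg (j (n + 1)) ?_) this
    rw [DirectedSystem.coe_natLERec]
    exact (Nat.leRecOn_succ' (C := G) (next := fun {k} => ⇑(f k).toEmbedding) x).symm
  · exact Language.DirectLimit.exists_of z

end ElementaryExtensions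

section PrePairs

variable (L' : FirstOrder.Language.{u, v})

/-- A function symbol of rings, as a symbol of the language of pairs. -/
abbrev ringSym {n : ℕ} (f : Language.ring.Functions n) : (LP L').Functions n := Sum.inl (Sum.inl f)

/-- A field with a structure for the language of pairs, in which the ring symbols are interpreted
by the field operations and the predicate defines a substructure. -/
structure PrePair where
  carrier : Type (max u v)
  [str : (LP L').Structure carrier]
  [field : Field carrier]
  funMap_add : ∀ x : Fin 2 → carrier, Structure.funMap (ringSym L' ringFunc.add) x = x 0 + x 1
  funMap_mul : ∀ x : Fin 2 → carrier, Structure.funMap (ringSym L' ringFunc.mul) x = x 0 * x 1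
  funMap_neg : ∀ x : Fin 1 → carrier, Structure.funMap (ringSym L' ringFunc.neg) x = -x 0
  funMap_zero : ∀ x : Fin 0 → carrier, Structure.funMap (ringSym L' ringFunc.zero) x = 0
  funMap_one : ∀ x : Fin 0 → carrier, Structure.funMap (ringSym L' ringFunc.one) x = 1
  pcl : ∀ (n : ℕ) (f : (ringLang' L').Functions n) (w : Fin n → carrier),
    (∀ i, w i ∈ PSet L' carrier) → @Structure.funMap _ carrier (lOfLP L' carrier) n f w ∈
      PSet L' carrier

variable {L'}

instance : CoeSort (PrePair L') (Type (max u v)) := ⟨PrePair.carrier⟩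

attribute [instance] PrePair.str PrePair.field

/-- The elements of the predicate of a pair. -/
abbrev PrePair.Base (N : PrePair L') : Type (max u v) := PSet L' N

instance (N : PrePair L') : (ringLang' L').Structure N.Base := pStructOn L' N N.pcl

/-! ### Definability in the class of pairs -/

/-- A family of relations on pairs given by a formula. -/
def IsFO {α : Type} (Q : ∀ N : PrePair L', (α → N) → Prop) : Prop :=
  ∃ φ : (LP L').Formula α, ∀ (N : PrePair L') v, φ.Realize v ↔ Q N v

/-- A family of functions on pairs given by a term. -/
def IsTm {α : Type} (t : ∀ N : PrePair L', (α → N) → N) : Prop :=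
  ∃ τ : (LP L').Term α, ∀ (N : PrePair L') v, τ.realize v = t N v

variable {α β : Type}

namespace IsTm

variable {s t : ∀ N : PrePair L', (α → N) → N}

theorem var (a : α) : IsTm fun (_ : PrePair L') v => v a := ⟨Term.var a, fun _ _ => rfl⟩

theorem add (hs : IsTm s) (ht : IsTm t) : IsTm fun N v => s N v + t N v := by
  obtain ⟨σ, hσ⟩ := hs
  obtain ⟨τ, hτ⟩ := ht
  exact ⟨Term.func (ringSym L' ringFunc.add) ![σ, τ], fun N v => by
    simp [Term.realize, N.funMap_add, hσ, hτ]⟩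

theorem mul (hs : IsTm s) (ht : IsTm t) : IsTm fun N v => s N v * t N v := by
  obtain ⟨σ, hσ⟩ := hs
  obtain ⟨τ, hτ⟩ := ht
  exact ⟨Term.func (ringSym L' ringFunc.mul) ![σ, τ], fun N v => by
    simp [Term.realize, N.funMap_mul, hσ, hτ]⟩

theorem zero : IsTm fun (N : PrePair L') (_ : α → N) => (0 : N) :=
  ⟨Term.func (ringSym L' ringFunc.zero) ![], fun N v => by simp [Term.realize, N.funMap_zero]⟩

theorem one : IsTm fun (N : PrePair L') (_ : α → N) => (1 : N) :=
  ⟨Term.func (ringSym L' ringFunc.one) ![], fun N v => by simp [Term.realize, N.funMap_one]⟩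

theorem pow (hs : IsTm s) (n : ℕ) : IsTm fun N v => s N v ^ n := by
  induction n with
  | zero => simpa using one
  | succ n ih => simpa [pow_succ] using ih.mul hs

theorem sum {ι : Type*} {f : ι → ∀ N : PrePair L', (α → N) → N} (F : Finset ι)
    (h : ∀ i, IsTm (f i)) : IsTm fun N v => ∑ i ∈ F, f i N v := by
  classical
  induction F using Finset.induction_on with
  | empty => simpa using zero
  | insert i F hi ih => simpa [Finset.sum_insert hi] using (h i).add ih

theorem prod {ι : Type*} {f : ι → ∀ N : PrePair L', (α → N) → N} (F : Finset ι)
    (h : ∀ i, IsTm (f i)) : IsTm fun N v => ∏ i ∈ F, f i N v := by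
  classical
  induction F using Finset.induction_on with
  | empty => simpa using one
  | insert i F hi ih => simpa [Finset.prod_insert hi] using (h i).mul ih

theorem func {n : ℕ} (f : (LP L').Functions n) {s : Fin n → ∀ N : PrePair L', (α → N) → N}
    (h : ∀ i, IsTm (s i)) : IsTm fun N v => Structure.funMap f fun i => s i N v := by
  choose τ hτ using h
  exact ⟨Term.func f τ, fun N v => by simp [Term.realize, hτ]⟩

end IsTm

namespace IsFO

variable {Q R : ∀ N : PrePair L', (α → N) → Prop}

theorem congr (h : IsFO Q) (e : ∀ N v, Q N v ↔ R N v) : IsFO R := by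
  obtain ⟨φ, hφ⟩ := h
  exact ⟨φ, fun N v => (hφ N v).trans (e N v)⟩

theorem eq {s t : ∀ N : PrePair L', (α → N) → N} (hs : IsTm s) (ht : IsTm t) :
    IsFO fun N v => s N v = t N v := by
  obtain ⟨σ, hσ⟩ := hs
  obtain ⟨τ, hτ⟩ := ht
  exact ⟨σ.equal τ, fun N v => by rw [Formula.realize_equal, hσ, hτ]⟩

theorem mem {t : ∀ N : PrePair L', (α → N) → N} (ht : IsTm t) :
    IsFO fun N v => t N v ∈ PSet L' N := by
  obtain ⟨τ, hτ⟩ := ht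
  refine ⟨(pSym L').formula ![τ], fun N v => ?_⟩
  rw [Formula.realize_rel]
  refine iff_of_eq (congrArg (Structure.RelMap (pSym L')) ?_)
  ext i
  fin_cases i
  exact hτ N v

theorem rel {n : ℕ} (r : (LP L').Relations n) {s : Fin n → ∀ N : PrePair L', (α → N) → N}
    (h : ∀ i, IsTm (s i)) : IsFO fun N v => Structure.RelMap r fun i => s i N v := by
  choose τ hτ using h
  exact ⟨r.formula τ, fun N v => by simp [hτ]⟩

theorem not (h : IsFO Q) : IsFO fun N v => ¬ Q N v := by
  obtain ⟨φ, hφ⟩ := h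
  exact ⟨φ.not, fun N v => by rw [Formula.realize_not, hφ]⟩

theorem and (h : IsFO Q) (h' : IsFO R) : IsFO fun N v => Q N v ∧ R N v := by
  obtain ⟨φ, hφ⟩ := h
  obtain ⟨ψ, hψ⟩ := h'
  exact ⟨φ ⊓ ψ, fun N v => by rw [Formula.realize_inf, hφ, hψ]⟩

theorem imp (h : IsFO Q) (h' : IsFO R) : IsFO fun N v => Q N v → R N v := by
  obtain ⟨φ, hφ⟩ := h
  obtain ⟨ψ, hψ⟩ := h'
  exact ⟨φ.imp ψ, fun N v => by rw [Formula.realize_imp, hφ, hψ]⟩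

theorem iff (h : IsFO Q) (h' : IsFO R) : IsFO fun N v => (Q N v ↔ R N v) :=
  ((h.imp h').and (h'.imp h)).congr fun _ _ => iff_def.symm

theorem forall_index {ι : Type*} [Finite ι] {Q : ι → ∀ N : PrePair L', (α → N) → Prop}
    (h : ∀ i, IsFO (Q i)) : IsFO fun N v => ∀ i, Q i N v := by
  choose φ hφ using h
  exact ⟨Formula.iInf φ, fun N v => by simp [Formula.realize_iInf, hφ]⟩

theorem all [Finite β] {R : ∀ N : PrePair L', (α → N) → (β → N) → Prop}
    (h : IsFO fun (N : PrePair L') (u : α ⊕ β → N) => R N (u ∘ Sum.inl) (u ∘ Sum.inr)) :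
    IsFO fun N v => ∀ w, R N v w := by
  obtain ⟨φ, hφ⟩ := h
  exact ⟨φ.iAlls β, fun N v => by simp [Formula.realize_iAlls, hφ]⟩

theorem ex [Finite β] {R : ∀ N : PrePair L', (α → N) → (β → N) → Prop}
    (h : IsFO fun (N : PrePair L') (u : α ⊕ β → N) => R N (u ∘ Sum.inl) (u ∘ Sum.inr)) :
    IsFO fun N v => ∃ w, R N v w := by
  obtain ⟨φ, hφ⟩ := h
  exact ⟨φ.iExs β, fun N v => by simp [Formula.realize_iExs, hφ]⟩

theorem all₁ {R : ∀ N : PrePair L', (α → N) → N → Prop}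
    (h : IsFO fun (N : PrePair L') (u : α ⊕ Unit → N) => R N (u ∘ Sum.inl) (u (Sum.inr ()))) :
    IsFO fun N v => ∀ w, R N v w :=
  (all (β := Unit) (R := fun N v w => R N v (w ())) h).congr fun _ _ =>
    ⟨fun h w => h fun _ => w, fun h _ => h _⟩

theorem ex₁ {R : ∀ N : PrePair L', (α → N) → N → Prop}
    (h : IsFO fun (N : PrePair L') (u : α ⊕ Unit → N) => R N (u ∘ Sum.inl) (u (Sum.inr ()))) :
    IsFO fun N v => ∃ w, R N v w :=
  (ex (β := Unit) (R := fun N v w => R N v (w ())) h).congr fun _ _ =>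
    ⟨fun ⟨w, h⟩ => ⟨w (), h⟩, fun ⟨w, h⟩ => ⟨fun _ => w, h⟩⟩

theorem relabel (f : α → β) (h : IsFO Q) : IsFO fun (N : PrePair L') (v : β → N) => Q N (v ∘ f) := by
  obtain ⟨φ, hφ⟩ := h
  exact ⟨φ.relabel f, fun N v => by rw [Formula.realize_relabel, hφ]⟩

theorem formula (φ : (LP L').Formula α) :
    IsFO fun (N : PrePair L') (v : α → N) => φ.Realize v := ⟨φ, fun _ _ => Iff.rfl⟩

theorem map (h : IsFO Q) {N N' : PrePair L'} (i : N ↪ₑ[LP L'] N') (v : α → N) :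
    Q N' (i ∘ v) ↔ Q N v := by
  obtain ⟨φ, hφ⟩ := h
  rw [← hφ, ← hφ, i.map_formula]

theorem iff_of_equiv {Q : PrePair L' → Prop} (h : IsFO fun N (_ : Empty → N) => Q N)
    {N N' : PrePair L'} (e : N ≅[LP L'] N') : Q N ↔ Q N' := by
  obtain ⟨φ, hφ⟩ := h
  exact (hφ N default).symm.trans ((e.realize_sentence φ).trans (hφ N' default))

end IsFO

end PrePairs

section Transfer

variable {L' : FirstOrder.Language.{u, v}}

/-- The inclusion of the language of rings in the language of pairs. -/
abbrev ringToLP : Language.ring →ᴸ LP L' :=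
  (LHom.sumInl : ringLang' L' →ᴸ LP L').comp (LHom.sumInl : Language.ring →ᴸ ringLang' L')

/-- The compatibility of the ring structure of a pair with its field structure. -/
@[reducible]
def PrePair.compatibleRing (N : PrePair L') : CompatibleRing N where
  toStructure := rOfLP L' N
  funMap_add := N.funMap_add
  funMap_mul := N.funMap_mul
  funMap_neg := N.funMap_neg
  funMap_zero := N.funMap_zero
  funMap_one := N.funMap_one

variable (M : PrePair L') (N : Type (max u v)) [(LP L').Structure N]

theorem PrePair.model_field_of_equiv (h : M ≅[LP L'] N) :
    @Theory.Model Language.ring N (rOfLP L' N) Theory.field := by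
  let _ := M.compatibleRing
  let _ := rOfLP L' N
  have h₁ : (ringToLP : Language.ring →ᴸ LP L').IsExpansionOn M :=
    LHom.isExpansionOn_reduct _ _
  have h₂ : (ringToLP : Language.ring →ᴸ LP L').IsExpansionOn N :=
    LHom.isExpansionOn_reduct _ _
  refine (Theory.model_iff _).2 fun φ hφ => ?_
  have hM : (M : Type _) ⊨ φ := Theory.realize_sentence_of_mem Theory.field hφ
  rw [← LHom.realize_onSentence (M : Type _) (ringToLP : Language.ring →ᴸ LP L') φ,
    h.realize_sentence] at hM
  exact (LHom.realize_onSentence N (ringToLP : Language.ring →ᴸ LP L') φ).1 hM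

theorem PrePair.pcl_of_equiv (h : M ≅[LP L'] N) (n : ℕ) (f : (ringLang' L').Functions n)
    (w : Fin n → N) (hw : ∀ i, w i ∈ PSet L' N) :
    @Structure.funMap _ N (lOfLP L' N) n f w ∈ PSet L' N := by
  let p : ∀ {α : Type}, (LP L').Term α → (LP L').Formula α := fun t => (pSym L').formula ![t]
  have hp : ∀ {α : Type} (K : Type (max u v)) [(LP L').Structure K] (t : (LP L').Term α)
      (v : α → K), (p t).Realize v ↔ t.realize v ∈ PSet L' K := fun K _ t v => by
    rw [Formula.realize_rel]
    refine iff_of_eq (congrArg (Structure.RelMap (pSym L')) ?_)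
    ext i
    fin_cases i
    rfl
  let φ : (LP L').Sentence := Formula.iAlls (Fin n)
    (((Formula.iInf fun i : Fin n => p (Term.var (Sum.inr i))).imp
      (p (Term.func (Sum.inl f) fun i => Term.var (Sum.inr i)))) : (LP L').Formula (Empty ⊕ Fin n))
  have hφ : ∀ (K : Type (max u v)) [(LP L').Structure K], K ⊨ φ ↔ ∀ w : Fin n → K,
      (∀ i, w i ∈ PSet L' K) → @Structure.funMap _ K (lOfLP L' K) n f w ∈ PSet L' K :=
    fun K _ => by
      simp only [φ, Sentence.Realize, Formula.realize_iAlls, Formula.realize_imp,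
        Formula.realize_iInf, hp, Term.realize]
      rfl
  exact (hφ N).1 ((h.realize_sentence φ).1 ((hφ M).2 (M.pcl n f))) w hw

/-- A structure elementarily equivalent to a pair is a pair. -/
noncomputable def PrePair.ofEquiv (h : M ≅[LP L'] N) : PrePair L' :=
  let _ := rOfLP L' N
  let _ := M.model_field_of_equiv N h
  let _ : Field N := FirstOrder.Field.fieldOfModelField N
  let c := FirstOrder.Field.compatibleRingOfModelField N
  { carrier := N
    funMap_add := c.funMap_add
    funMap_mul := c.funMap_mul
    funMap_neg := c.funMap_neg
    funMap_zero := c.funMap_zero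
    funMap_one := c.funMap_one
    pcl := M.pcl_of_equiv N h }

end Transfer

section Pairs

variable {L' : FirstOrder.Language.{u, v}}

/-- The properties of models of `ACF_T` that do not refer to `T`, apart from the inclusion of the
field axioms in `T`. -/
structure PrePair.IsPair (N : PrePair L') : Prop where
  exists_root : ∀ (n : ℕ) (c : Fin (n + 1) → N), ∃ x : N, x ^ (n + 1) + ∑ i, c i * x ^ (i : ℕ) = 0
  inv_mem : ∀ x ∈ PSet L' N, x⁻¹ ∈ PSet L' N
  extra_fun_zero : ∀ (n : ℕ) (f : L'.Functions n) (w : Fin n → N),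
    ¬ (∀ i, w i ∈ PSet L' N) → Structure.funMap (L := LP L') (Sum.inl (Sum.inr f)) w = 0
  extra_rel_sub : ∀ (n : ℕ) (r : L'.Relations n) (w : Fin n → N),
    Structure.RelMap (L := LP L') (Sum.inl (Sum.inr r)) w → ∀ i, w i ∈ PSet L' N
  exists_independent : ∀ n : ℕ, ∃ a : Fin n → N, ∀ c : Fin n → N, (∀ i, c i ∈ PSet L' N) →
    ∑ i, c i * a i = 0 → ∀ i, c i = 0

theorem PrePair.IsPair.of_equiv {M N : PrePair L'} (hM : M.IsPair) (h : M ≅[LP L'] N) :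
    N.IsPair where
  exists_root n := by
    refine (IsFO.iff_of_equiv (Q := fun N : PrePair L' =>
      ∀ c : Fin (n + 1) → N, ∃ x : N, x ^ (n + 1) + ∑ i, c i * x ^ (i : ℕ) = 0) ?_ h).1
        (hM.exists_root n)
    exact IsFO.all <| IsFO.ex₁ <| IsFO.eq (((IsTm.var _).pow _).add
      (IsTm.sum _ fun i => (IsTm.var _).mul ((IsTm.var _).pow _))) IsTm.zero
  inv_mem := by
    suffices ∀ x y : N, x ∈ PSet L' N → x * y = 1 → y ∈ PSet L' N by
      intro x hx
      rcases eq_or_ne x 0 with rfl | h₀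
      · simpa using hx
      · exact this x _ hx (mul_inv_cancel₀ h₀)
    refine (IsFO.iff_of_equiv (Q := fun N : PrePair L' =>
      ∀ x y : N, x ∈ PSet L' N → x * y = 1 → y ∈ PSet L' N) ?_ h).1 fun x y hx hxy => ?_
    · exact IsFO.all₁ <| IsFO.all₁ <| (IsFO.mem (IsTm.var _)).imp <|
        (IsFO.eq ((IsTm.var _).mul (IsTm.var _)) IsTm.one).imp (IsFO.mem (IsTm.var _))
    · rw [eq_inv_of_mul_eq_one_right hxy]
      exact hM.inv_mem x hx
  extra_fun_zero n f := by
    refine (IsFO.iff_of_equiv (Q := fun N : PrePair L' =>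
      ∀ w : Fin n → N, ¬ (∀ i, w i ∈ PSet L' N) →
        Structure.funMap (L := LP L') (Sum.inl (Sum.inr f)) w = 0) ?_ h).1
          (hM.extra_fun_zero n f)
    exact IsFO.all <| (IsFO.not <| IsFO.forall_index fun i => IsFO.mem (IsTm.var _)).imp <|
      IsFO.eq (IsTm.func _ fun i => IsTm.var _) IsTm.zero
  extra_rel_sub n r := by
    refine (IsFO.iff_of_equiv (Q := fun N : PrePair L' =>
      ∀ w : Fin n → N, Structure.RelMap (L := LP L') (Sum.inl (Sum.inr r)) w →
        ∀ i, w i ∈ PSet L' N) ?_ h).1 (hM.extra_rel_sub n r)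
    exact IsFO.all <| (IsFO.rel _ fun i => IsTm.var _).imp <|
      IsFO.forall_index fun i => IsFO.mem (IsTm.var _)
  exists_independent n := by
    refine (IsFO.iff_of_equiv (Q := fun N : PrePair L' => ∃ a : Fin n → N, ∀ c : Fin n → N,
      (∀ i, c i ∈ PSet L' N) → ∑ i, c i * a i = 0 → ∀ i, c i = 0) ?_ h).1
        (hM.exists_independent n)
    exact IsFO.ex <| IsFO.all <| (IsFO.forall_index fun i => IsFO.mem (IsTm.var _)).imp <|
      (IsFO.eq (IsTm.sum _ fun i => (IsTm.var _).mul (IsTm.var _)) IsTm.zero).imp <|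
        IsFO.forall_index fun i => IsFO.eq (IsTm.var _) IsTm.zero

variable {N : PrePair L'}

theorem PrePair.IsPair.isAlgClosed (hN : N.IsPair) : IsAlgClosed N := by
  refine IsAlgClosed.of_exists_root _ fun p hp hirr => ?_
  obtain ⟨n, hn⟩ := Nat.exists_eq_succ_of_ne_zero hirr.natDegree_pos.ne'
  obtain ⟨x, hx⟩ := hN.exists_root n fun i => p.coeff i
  refine ⟨x, ?_⟩
  rw [Polynomial.eval_eq_sum_range, hn, Finset.sum_range_succ, ← hx, ← Nat.succ_eq_add_one, ← hn,
    hp.coeff_natDegree, Finset.sum_range]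
  simp [add_comm, hn]

/-- The predicate of a pair, as a subfield. -/
def PrePair.IsPair.subfield (hN : N.IsPair) : Subfield N where
  carrier := PSet L' N
  mul_mem' {a b} ha hb := by
    have := N.pcl 2 (Sum.inl ringFunc.mul) ![a, b] (by intro i; fin_cases i <;> assumption)
    have e : @Structure.funMap _ N (lOfLP L' N) 2 (Sum.inl ringFunc.mul) ![a, b] = a * b :=
      N.funMap_mul ![a, b]
    rwa [e] at this
  add_mem' {a b} ha hb := by
    have := N.pcl 2 (Sum.inl ringFunc.add) ![a, b] (by intro i; fin_cases i <;> assumption)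
    have e : @Structure.funMap _ N (lOfLP L' N) 2 (Sum.inl ringFunc.add) ![a, b] = a + b :=
      N.funMap_add ![a, b]
    rwa [e] at this
  neg_mem' {a} ha := by
    have := N.pcl 1 (Sum.inl ringFunc.neg) ![a] (by intro i; fin_cases i; assumption)
    have e : @Structure.funMap _ N (lOfLP L' N) 1 (Sum.inl ringFunc.neg) ![a] = -a :=
      N.funMap_neg ![a]
    rwa [e] at this
  one_mem' := by
    have := N.pcl 0 (Sum.inl ringFunc.one) ![] (by intro i; exact i.elim0)
    have e : @Structure.funMap _ N (lOfLP L' N) 0 (Sum.inl ringFunc.one) ![] = 1 :=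
      N.funMap_one ![]
    rwa [e] at this
  zero_mem' := by
    have := N.pcl 0 (Sum.inl ringFunc.zero) ![] (by intro i; exact i.elim0)
    have e : @Structure.funMap _ N (lOfLP L' N) 0 (Sum.inl ringFunc.zero) ![] = 0 :=
      N.funMap_zero ![]
    rwa [e] at this
  inv_mem' := hN.inv_mem

theorem PrePair.IsPair.not_finiteDimensional (hN : N.IsPair) :
    ¬ FiniteDimensional hN.subfield N := by
  intro h
  obtain ⟨a, ha⟩ := hN.exists_independent (Module.finrank hN.subfield N + 1)
  have : LinearIndependent hN.subfield a := Fintype.linearIndependent_iff.2 fun c hc i =>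
    Subtype.ext (ha (fun i => c i) (fun i => (c i).2) (by simpa [Subfield.smul_def] using hc) i)
  have := this.fintype_card_le_finrank
  simp at this

end Pairs

section Relativization

variable {L' : FirstOrder.Language.{u, v}}

/-- The relativization of a formula to the predicate. -/
def relativize {α : Type w} : ∀ {n : ℕ}, (ringLang' L').BoundedFormula α n →
    (LP L').BoundedFormula α n
  | _, .falsum => .falsum
  | _, .equal s t => .equal (LHom.sumInl.onTerm s) (LHom.sumInl.onTerm t)
  | _, .rel R ts => .rel (Sum.inl R) fun i => LHom.sumInl.onTerm (ts i)
  | _, .imp φ ψ => (relativize φ).imp (relativize ψ)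
  | n, .all φ => (((pSym L').boundedFormula ![Term.var (Sum.inr (Fin.last n))]).imp
      (relativize φ)).all

theorem realize_onTerm_base {α : Type w} (N : PrePair L') (t : (ringLang' L').Term α)
    (v : α → N.Base) :
    ((LHom.sumInl : ringLang' L' →ᴸ LP L').onTerm t).realize (fun a => (v a : N)) =
      ((t.realize v : N.Base) : N) := by
  induction t with
  | var _ => rfl
  | func f ts ih =>
    simp only [LHom.onTerm, Term.realize, ih]
    rfl

theorem realize_relativize {α : Type w} (N : PrePair L') {n : ℕ}
    (φ : (ringLang' L').BoundedFormula α n) (v : α → N.Base) (xs : Fin n → N.Base) :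
    (relativize φ).Realize (fun a => (v a : N)) (fun i => (xs i : N)) ↔ φ.Realize v xs := by
  have hel : ∀ {n : ℕ} (xs : Fin n → N.Base),
      (Sum.elim (fun a => (v a : N)) fun i => (xs i : N)) =
        fun a => ((Sum.elim v xs a : N.Base) : N) := fun xs => by
    ext (a | a) <;> rfl
  induction φ with
  | falsum => rfl
  | equal s t =>
    simp only [relativize, BoundedFormula.Realize, hel, realize_onTerm_base, Subtype.ext_iff]
  | rel R ts =>
    simp only [relativize, BoundedFormula.Realize, hel, realize_onTerm_base]
    rfl
  | imp _ _ ih₁ ih₂ => simp only [relativize, BoundedFormula.realize_imp, ih₁, ih₂]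
  | @all n φ ih =>
    have hP : ∀ y : N, ((pSym L').boundedFormula ![Term.var (Sum.inr (Fin.last n))]).Realize
        (fun a => (v a : N)) (Fin.snoc (fun i => (xs i : N)) y : Fin (n + 1) → N) ↔
          y ∈ PSet L' N := fun y => by
      rw [BoundedFormula.realize_rel]
      refine iff_of_eq (congrArg (Structure.RelMap (pSym L')) ?_)
      ext i
      fin_cases i
      simp
    have hs : ∀ y : N.Base, (Fin.snoc (fun i => (xs i : N)) (y : N) : Fin (n + 1) → N) =
        fun i => ((Fin.snoc xs y : Fin (n + 1) → N.Base) i : N) := fun y =>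
      (Fin.comp_snoc (fun z : N.Base => (z : N)) xs y).symm
    simp only [relativize, BoundedFormula.realize_all, BoundedFormula.realize_imp, hP]
    constructor
    · intro h y
      refine (ih _).1 ?_
      rw [← hs]
      exact h y y.2
    · intro h y hy
      have := (ih (Fin.snoc xs ⟨y, hy⟩)).2 (h ⟨y, hy⟩)
      rwa [← hs] at this

/-- The relativization of a formula to the predicate. -/
def relativizeFormula {α : Type w} (θ : (ringLang' L').Formula α) : (LP L').Formula α :=
  relativize θ

theorem realize_relativizeFormula {α : Type w} (N : PrePair L') (θ : (ringLang' L').Formula α)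
    (v : α → N.Base) : (relativizeFormula θ).Realize (fun a => (v a : N)) ↔ θ.Realize v := by
  have := realize_relativize N θ v default
  rw [Formula.Realize, Formula.Realize, ← this]
  exact iff_of_eq (congrArg _ (Subsingleton.elim _ _))

section Maps

variable {M N : PrePair L'} (i : M ↪ₑ[LP L'] N)

theorem mem_base_iff (x : M) : i x ∈ PSet L' N ↔ x ∈ PSet L' M :=
  IsFO.map (α := Unit) (Q := fun N v => v () ∈ PSet L' N) (IsFO.mem (IsTm.var _)) i fun _ => x

/-- The map induced by an elementary embedding on the predicates. -/
def baseMap (x : M.Base) : N.Base := ⟨i x, (mem_base_iff i x).2 x.2⟩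

theorem realize_baseMap {α : Type w} (θ : (ringLang' L').Formula α) (v : α → M.Base) :
    θ.Realize (fun a => baseMap i (v a)) ↔ θ.Realize v := by
  rw [← realize_relativizeFormula, ← realize_relativizeFormula]
  exact i.map_formula (relativizeFormula θ) fun a => (v a : M)

end Maps

theorem model_base_of_equiv {M N : PrePair L'} (h : M ≅[LP L'] N) (T : (ringLang' L').Theory)
    (hM : M.Base ⊨ T) : N.Base ⊨ T := by
  refine (Theory.model_iff _).2 fun φ hφ => ?_
  have h₀ := (Theory.model_iff _).1 hM φ hφ
  have hiff : ∀ K : PrePair L', K.Base ⊨ φ ↔ (K : Type _) ⊨ (relativizeFormula φ) := fun K => by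
    rw [Sentence.Realize, Sentence.Realize, ← realize_relativizeFormula]
    exact iff_of_eq (congrArg _ (Subsingleton.elim _ _))
  exact (hiff N).2 ((h.realize_sentence _).1 ((hiff M).1 h₀))

/-- A pair obtained from a model of `ACF_T`. -/
def IsACFTModel.toPrePair {M : Type (max u v)} [(LP L').Structure M] [Field M]
    [IsAlgClosed M] {T : (ringLang' L').Theory} (h : IsACFTModel L' M T) : PrePair L' where
  carrier := M
  funMap_add x := (congrArg (Structure.funMap (ringSym L' ringFunc.add))
    (by ext i; fin_cases i <;> rfl : x = ![x 0, x 1])).trans (h.compat_add _ _)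
  funMap_mul x := (congrArg (Structure.funMap (ringSym L' ringFunc.mul))
    (by ext i; fin_cases i <;> rfl : x = ![x 0, x 1])).trans (h.compat_mul _ _)
  funMap_neg x := (congrArg (Structure.funMap (ringSym L' ringFunc.neg))
    (by ext i; fin_cases i; rfl : x = ![x 0])).trans (h.compat_neg _)
  funMap_zero x := (congrArg (Structure.funMap (ringSym L' ringFunc.zero))
    (Subsingleton.elim x _)).trans h.compat_zero
  funMap_one x := (congrArg (Structure.funMap (ringSym L' ringFunc.one))
    (Subsingleton.elim x _)).trans h.compat_one
  pcl := h.pcl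

theorem exists_pow_add_sum_eq_zero {K : Type w} [Field K] [IsAlgClosed K] (n : ℕ)
    (c : Fin (n + 1) → K) : ∃ x : K, x ^ (n + 1) + ∑ i, c i * x ^ (i : ℕ) = 0 := by
  let p : Polynomial K := .X ^ (n + 1) + ∑ i : Fin (n + 1), .C (c i) * .X ^ (i : ℕ)
  have hd : p.degree = (n + 1 : ℕ) := by
    dsimp only [p]
    rw [Polynomial.degree_add_eq_left_of_degree_lt, Polynomial.degree_X_pow]
    rw [Polynomial.degree_X_pow]
    exact Polynomial.degree_sum_fin_lt c
  obtain ⟨x, hx⟩ := IsAlgClosed.exists_root p (by rw [hd]; exact_mod_cast n.succ_ne_zero)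
  exact ⟨x, by simpa [p, Polynomial.eval_finsetSum] using hx⟩

theorem IsACFTModel.isPair {M : Type (max u v)} [(LP L').Structure M] [Field M]
    [IsAlgClosed M] {T : (ringLang' L').Theory}
    (hfield : (LHom.sumInl : Language.ring →ᴸ ringLang' L').onTheory Theory.field ⊆ T)
    (h : IsACFTModel L' M T) : h.toPrePair.IsPair where
  exists_root n c := exists_pow_add_sum_eq_zero (K := M) n c
  inv_mem x hx := by
    let N := h.toPrePair
    let x' : N.Base := ⟨x, hx⟩
    let r : Language.ring.Structure N.Base :=
      (LHom.sumInl : Language.ring →ᴸ ringLang' L').reduct N.Base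
    have : (LHom.sumInl : Language.ring →ᴸ ringLang' L').IsExpansionOn N.Base :=
      LHom.isExpansionOn_reduct _ _
    have hT : N.Base ⊨ T := h.p_models_T
    have hF : N.Base ⊨ Theory.field :=
      (LHom.onTheory_model (M := N.Base) (LHom.sumInl : Language.ring →ᴸ ringLang' L') _).1
        (hT.mono hfield)
    let _ : Field N.Base := FirstOrder.Field.fieldOfModelField N.Base
    let c := FirstOrder.Field.compatibleRingOfModelField N.Base
    rcases eq_or_ne x 0 with rfl | h₀
    · simpa using hx
    have e₀ : ((0 : N.Base) : N) = 0 := N.funMap_zero _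
    have e₁ : ((1 : N.Base) : N) = 1 := N.funMap_one _
    have e₂ : ∀ a b : N.Base, ((a * b : N.Base) : N) = a * b := fun a b => N.funMap_mul _
    have hx₀ : x' ≠ 0 := fun h => h₀ ((congrArg Subtype.val h).trans e₀)
    have := congrArg (Subtype.val : N.Base → N) (mul_inv_cancel₀ hx₀)
    rw [e₁, e₂] at this
    exact eq_inv_of_mul_eq_one_right this ▸ (x'⁻¹).2
  extra_fun_zero := h.extra_fun_zero
  extra_rel_sub := h.extra_rel_sub
  exists_independent n := by
    obtain ⟨a, ha⟩ := h.inf_degree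
    exact ⟨fun i => a i, fun c hc => ha n c hc⟩

end Relativization

section Homogeneity

variable {L' : FirstOrder.Language.{u, v}}

theorem exists_pair_realization {M : PrePair L'} (hM : M.IsPair) {β : Type (max u v)}
    (Φ : Set ((LP L').Formula (M ⊕ β)))
    (h : ∀ s : Finset ((LP L').Formula (M ⊕ β)), ↑s ⊆ Φ →
      ∃ w : β → M, ∀ φ ∈ s, φ.Realize (Sum.elim id w)) :
    ∃ N : PrePair L', N.IsPair ∧ ∃ (i : M ↪ₑ[LP L'] N) (w : β → N),
      ∀ φ ∈ Φ, φ.Realize (Sum.elim i w) := by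
  obtain ⟨N, _, i, w, hw⟩ := exists_elementary_realization Φ h
  have e : M ≅[LP L'] N := i.elementarilyEquivalent
  exact ⟨M.ofEquiv N e, hM.of_equiv (N := M.ofEquiv N e) e, i, w, hw⟩

theorem exists_pair_chain_colimit {G : ℕ → PrePair L'} (h₀ : (G 0).IsPair)
    (f : ∀ n, G n ↪ₑ[LP L'] G (n + 1)) :
    ∃ N : PrePair L', N.IsPair ∧ ∃ j : ∀ n, G n ↪ₑ[LP L'] N,
      (∀ n x, j (n + 1) (f n x) = j n x) ∧ ∀ z : N, ∃ n x, j n x = z := by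
  obtain ⟨N, _, j, hj, hN⟩ := exists_elementary_chain_colimit f
  have e : G 0 ≅[LP L'] N := (j 0).elementarilyEquivalent
  exact ⟨(G 0).ofEquiv N e, h₀.of_equiv (N := (G 0).ofEquiv N e) e, j, hj, hN⟩

variable {N : PrePair L'}

/-- A field automorphism that restricts to an automorphism of the structure on the predicate is an
automorphism of the pair. -/
theorem realize_comp_ringEquiv (hN : N.IsPair) (σ : N.Base ≃[ringLang' L'] N.Base) (τ : N ≃+* N)
    (h : ∀ a : N.Base, τ a = σ a) {α : Type w} (φ : (LP L').Formula α) (v : α → N) :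
    φ.Realize (τ ∘ v) ↔ φ.Realize v := by
  have hP : ∀ x, τ x ∈ PSet L' N ↔ x ∈ PSet L' N := fun x => by
    constructor
    · intro hx
      have : τ (σ.symm ⟨τ x, hx⟩ : N.Base) = τ x := by
        rw [h, FirstOrder.Language.Equiv.apply_symm_apply]
      rw [← τ.injective this]
      exact Subtype.coe_prop _
    · intro hx
      rw [h ⟨x, hx⟩]
      exact Subtype.coe_prop _
  have hlift : ∀ {n : ℕ} (w : Fin n → N), (∀ i, w i ∈ PSet L' N) →
      ∃ w' : Fin n → N.Base, w = (fun i => (w' i : N)) ∧ τ ∘ w = fun i => ((σ ∘ w') i : N) :=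
    fun w hw => ⟨fun i => ⟨w i, hw i⟩, rfl, funext fun i => h ⟨w i, hw i⟩⟩
  let e : N ≃[LP L'] N :=
    { τ.toEquiv with
      map_fun' := by
        rintro n ((f | f) | f) x
        · cases f
          · exact (congrArg τ (N.funMap_add x)).trans
              ((map_add τ _ _).trans (N.funMap_add (τ ∘ x)).symm)
          · exact (congrArg τ (N.funMap_mul x)).trans
              ((map_mul τ _ _).trans (N.funMap_mul (τ ∘ x)).symm)
          · exact (congrArg τ (N.funMap_neg x)).trans
              ((map_neg τ _).trans (N.funMap_neg (τ ∘ x)).symm)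
          · exact (congrArg τ (N.funMap_zero x)).trans ((map_zero τ).trans (N.funMap_zero (τ ∘ x)).symm)
          · exact (congrArg τ (N.funMap_one x)).trans ((map_one τ).trans (N.funMap_one (τ ∘ x)).symm)
        · by_cases hx : ∀ i, x i ∈ PSet L' N
          · obtain ⟨w, rfl, hw⟩ := hlift x hx
            refine (h (Structure.funMap (L := ringLang' L') (Sum.inr f) w)).trans ?_
            refine (congrArg Subtype.val (σ.map_fun (Sum.inr f : (ringLang' L').Functions n) w)).trans ?_
            exact congrArg (Structure.funMap (L := LP L') (Sum.inl (Sum.inr f))) hw.symm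
          · refine (congrArg τ (hN.extra_fun_zero n f x hx)).trans ((map_zero τ).trans ?_)
            exact (hN.extra_fun_zero n f (τ ∘ x) fun h => hx fun i => (hP _).1 (h i)).symm
        · exact f.elim
      map_rel' := by
        rintro n ((r | r) | r) x
        · exact r.elim
        · by_cases hx : ∀ i, x i ∈ PSet L' N
          · obtain ⟨w, rfl, hw⟩ := hlift x hx
            refine Iff.trans ?_ (σ.map_rel (Sum.inr r) w)
            exact iff_of_eq (congrArg (Structure.RelMap (L := LP L') (Sum.inl (Sum.inr r))) hw)
          · refine iff_of_false (fun h => hx fun i => (hP _).1 ?_)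
              fun h => hx (hN.extra_rel_sub n r x h)
            exact hN.extra_rel_sub n r _ h i
        · obtain ⟨⟨rfl⟩⟩ := r
          have key : ∀ y : Fin 1 → N, Structure.RelMap (pSym L') y ↔ y 0 ∈ PSet L' N := fun y =>
            iff_of_eq (congrArg (Structure.RelMap (pSym L')) (by ext i; fin_cases i; rfl))
          exact (key _).trans ((hP _).trans (key _).symm) }
  exact StrongHomClass.realize_formula e φ

/-- A total and surjective relation on the predicate that preserves types is the graph of an
automorphism, which extends to the pair. -/
theorem realize_iff_of_relation (hN : N.IsPair) (R : N.Base → N.Base → Prop)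
    (hR : ∀ (r : ℕ) (a b : Fin r → N.Base), (∀ i, R (a i) (b i)) →
      ∀ θ : (ringLang' L').Formula (Fin r), θ.Realize a → θ.Realize b)
    (htot : ∀ a, ∃ b, R a b) (hsurj : ∀ b, ∃ a, R a b) {α : Type w} (φ : (LP L').Formula α)
    (a b : α → N.Base) (hab : ∀ i, R (a i) (b i)) :
    φ.Realize (fun i => (a i : N)) ↔ φ.Realize (fun i => (b i : N)) := by
  have hR' : ∀ (r : ℕ) (a b : Fin r → N.Base), (∀ i, R (a i) (b i)) →
      ∀ θ : (ringLang' L').Formula (Fin r), θ.Realize a ↔ θ.Realize b := fun r a b h θ =>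
    ⟨hR r a b h θ, fun hb => by
      by_contra ha
      exact hR r a b h θ.not ha hb⟩
  have heq : ∀ {x x' y y'}, R x y → R x' y' → (x = x' ↔ y = y') := fun {x x' y y'} h h' => by
    have := hR' 2 ![x, x'] ![y, y'] (by intro i; fin_cases i <;> assumption)
      ((Term.var 0).equal (Term.var 1))
    simpa [Formula.realize_equal] using this
  choose s hs using htot
  have hbij : Function.Bijective s :=
    ⟨fun x y h => (heq (hs x) (hs y)).2 h, fun y => by
      obtain ⟨x, hx⟩ := hsurj y
      exact ⟨x, (heq (hs x) hx).1 rfl⟩⟩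
  let σ : N.Base ≃[ringLang' L'] N.Base :=
    { Equiv.ofBijective s hbij with
      map_fun' := fun {n} f x => by
        have := hR (n + 1) (Fin.snoc x (Structure.funMap f x))
          (s ∘ Fin.snoc x (Structure.funMap f x)) (fun i => hs _)
          ((Term.func f fun i => Term.var i.castSucc).equal (Term.var (Fin.last n)))
        simp only [Formula.realize_equal, Term.realize, Fin.snoc_castSucc, Fin.snoc_last,
          Function.comp_apply, forall_const] at this
        exact this.symm
      map_rel' := fun {n} r x => by
        have := hR' n x (s ∘ x) (fun i => hs _) (r.formula fun i => Term.var i)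
        simp only [Formula.realize_rel, Term.realize] at this
        exact this.symm }
  have hσ : ∀ x, R x (σ x) := hs
  let σ' : hN.subfield ≃+* hN.subfield :=
    { σ.toEquiv with
      map_mul' := fun x y => by
        have h₁ : ∀ a b : hN.subfield, Structure.funMap (L := ringLang' L') (M := N.Base)
            (Sum.inl ringFunc.mul) ![a, b] = a * b := fun a b =>
          Subtype.ext (N.funMap_mul fun i => (![a, b] i : N))
        have h₂ := σ.map_fun (Sum.inl ringFunc.mul : (ringLang' L').Functions 2) ![x, y]
        rw [h₁] at h₂
        refine h₂.trans (Eq.trans (congrArg _ ?_) (h₁ _ _))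
        ext i
        fin_cases i <;> rfl
      map_add' := fun x y => by
        have h₁ : ∀ a b : hN.subfield, Structure.funMap (L := ringLang' L') (M := N.Base)
            (Sum.inl ringFunc.add) ![a, b] = a + b := fun a b =>
          Subtype.ext (N.funMap_add fun i => (![a, b] i : N))
        have h₂ := σ.map_fun (Sum.inl ringFunc.add : (ringLang' L').Functions 2) ![x, y]
        rw [h₁] at h₂
        refine h₂.trans (Eq.trans (congrArg _ ?_) (h₁ _ _))
        ext i
        fin_cases i <;> rfl }
  have := hN.isAlgClosed
  obtain ⟨τ, hτ⟩ := exists_ringEquiv_extending hN.subfield σ'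
  rw [← realize_comp_ringEquiv hN σ τ hτ]
  refine iff_of_eq (congrArg φ.Realize (funext fun i => (hτ (a i)).trans ?_))
  exact congrArg Subtype.val ((heq (hσ (a i)) (hab i)).1 rfl)

end Homogeneity

section BackAndForth

variable {L' : FirstOrder.Language.{u, v}}

/-- Two tuples of elements of the predicates have the same type. -/
def SameType {ι : Type w} {M N : PrePair L'} (x : ι → M.Base) (y : ι → N.Base) : Prop :=
  ∀ θ : (ringLang' L').Formula ι, θ.Realize x ↔ θ.Realize y

theorem SameType.symm {ι : Type w} {M N : PrePair L'} {x : ι → M.Base} {y : ι → N.Base}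
    (h : SameType x y) : SameType y x := fun θ => (h θ).symm

theorem SameType.comp {ι κ : Type w} {M N : PrePair L'} {x : ι → M.Base} {y : ι → N.Base}
    (h : SameType x y) (f : κ → ι) : SameType (x ∘ f) (y ∘ f) := fun θ => by
  rw [← Formula.realize_relabel, ← Formula.realize_relabel]
  exact h _

theorem sameType_of_imp {ι : Type w} {M N : PrePair L'} {x : ι → M.Base} {y : ι → N.Base}
    (h : ∀ θ : (ringLang' L').Formula ι, θ.Realize x → θ.Realize y) : SameType x y := fun θ =>
  ⟨h θ, fun hy => by
    by_contra hx
    exact h θ.not hx hy⟩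

instance (N : PrePair L') : Nonempty N.Base :=
  ⟨Structure.funMap (L := ringLang' L') (Sum.inl ringFunc.zero) ![]⟩

theorem realize_pSym {α : Type w} (N : PrePair L') (a : α) (v : α → N) :
    ((pSym L').formula ![Term.var a]).Realize v ↔ v a ∈ PSet L' N := by
  rw [Formula.realize_rel]
  refine iff_of_eq (congrArg (Structure.RelMap (pSym L')) ?_)
  ext i
  fin_cases i
  rfl

/-- In an elementary extension, a map preserving types extends to the whole predicate. -/
theorem exists_sameType_extension {N : PrePair L'} (hN : N.IsPair) {ι : Type (max u v)}
    {x y : ι → N.Base} (h : SameType x y) :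
    ∃ N' : PrePair L', N'.IsPair ∧ ∃ (i : N ↪ₑ[LP L'] N') (d : N.Base → N'.Base),
      SameType (fun q => baseMap i q) d ∧ ∀ k, d (x k) = baseMap i (y k) := by
  classical
  let Ψ : {θ : (ringLang' L').Formula N.Base // θ.Realize id} ⊕ (N.Base ⊕ ι) →
      (LP L').Formula (N ⊕ N.Base) :=
    Sum.elim (fun θ => (relativizeFormula θ.1).relabel Sum.inr)
      (Sum.elim (fun q => (pSym L').formula ![Term.var (Sum.inr q)])
        fun k => (Term.var (Sum.inr (x k))).equal (Term.var (Sum.inl (y k : N))))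
  obtain ⟨N', hN', i, w, hw⟩ := exists_pair_realization hN (Set.range Ψ) (by
    intro s hs
    rw [← Set.image_univ] at hs
    obtain ⟨t, -, rfl⟩ := Finset.subset_set_image_iff.1 hs
    let θ : (ringLang' L').Formula N.Base := Formula.iInf fun j : t.toLeft => j.1.1
    let K := t.toRight.toRight
    obtain ⟨χ, hχ⟩ := exists_formula_projection θ fun k : K => x k
    have h₁ : χ.Realize fun k : K => x k :=
      (hχ _ _).2 ⟨id, by
        rw [Formula.realize_iInf]
        exact fun j => j.1.2, fun _ => rfl⟩
    obtain ⟨z, hz, hzy⟩ := (hχ N.Base _).1 ((h.comp (fun k : K => (k : ι)) χ).1 h₁)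
    refine ⟨fun q => z q, ?_⟩
    simp only [Finset.mem_image, forall_exists_index, and_imp, forall_apply_eq_imp_iff₂]
    rintro (θ' | q | k) hj
    · refine Formula.realize_relabel.2 ((realize_relativizeFormula N θ'.1 z).2 ?_)
      rw [Formula.realize_iInf] at hz
      exact hz ⟨θ', Finset.mem_toLeft.2 hj⟩
    · exact (realize_pSym N _ _).2 (z q).2
    · refine Formula.realize_equal.2 ?_
      exact congrArg Subtype.val (hzy ⟨k, Finset.mem_toRight.2 (Finset.mem_toRight.2 hj)⟩))
  have hP : ∀ q, w q ∈ PSet L' N' := fun q =>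
    (realize_pSym N' (Sum.inr q) _).1 (hw _ ⟨Sum.inr (Sum.inl q), rfl⟩)
  refine ⟨N', hN', i, fun q => ⟨w q, hP q⟩, sameType_of_imp fun θ hθ => ?_, fun k => ?_⟩
  · have := Formula.realize_relabel.1 (hw _ ⟨Sum.inl ⟨θ, (realize_baseMap i θ id).1 hθ⟩, rfl⟩)
    exact (realize_relativizeFormula N' θ _).1 this
  · exact Subtype.ext (Formula.realize_equal.1 (hw _ ⟨Sum.inr (Sum.inr k), rfl⟩))

/-- Two tuples of the same type in the predicate of a pair. -/
structure PartialMap (L' : FirstOrder.Language.{u, v}) where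
  pair : PrePair L'
  isPair : pair.IsPair
  index : Type (max u v)
  source : index → pair.Base
  target : index → pair.Base
  sameType : SameType source target

/-- An elementary embedding of the pairs that maps the first partial map into the second. -/
def PartialMap.Extends (S S' : PartialMap L') (i : S.pair ↪ₑ[LP L'] S'.pair) : Prop :=
  ∀ k, ∃ k', S'.source k' = baseMap i (S.source k) ∧ S'.target k' = baseMap i (S.target k)

def PartialMap.swap (S : PartialMap L') : PartialMap L' where
  pair := S.pair
  isPair := S.isPair
  index := S.index
  source := S.target
  target := S.source
  sameType := S.sameType.symm

theorem PartialMap.exists_total (S : PartialMap L') :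
    ∃ (S' : PartialMap L') (i : S.pair ↪ₑ[LP L'] S'.pair), S.Extends S' i ∧
      ∀ q, ∃ k, S'.source k = baseMap i q := by
  obtain ⟨N', hN', i, d, hd, hxy⟩ := exists_sameType_extension S.isPair S.sameType
  exact ⟨⟨N', hN', S.pair.Base, _, d, hd⟩, i, fun k => ⟨S.source k, rfl, hxy k⟩, fun q => ⟨q, rfl⟩⟩

theorem PartialMap.exists_total_surjective (S : PartialMap L') :
    ∃ (S' : PartialMap L') (i : S.pair ↪ₑ[LP L'] S'.pair), S.Extends S' i ∧
      (∀ q, ∃ k, S'.source k = baseMap i q) ∧ ∀ q, ∃ k, S'.target k = baseMap i q := by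
  obtain ⟨S₁, i, hi, h₁⟩ := S.exists_total
  obtain ⟨S₂, j, hj, h₂⟩ := S₁.swap.exists_total
  refine ⟨S₂.swap, j.comp i, fun k => ?_, fun q => ?_, fun q => ?_⟩
  · obtain ⟨k', hs, ht⟩ := hi k
    obtain ⟨l, hs', ht'⟩ := hj k'
    exact ⟨l, ht'.trans (congrArg (baseMap j) hs), hs'.trans (congrArg (baseMap j) ht)⟩
  · obtain ⟨k', hs⟩ := h₁ q
    obtain ⟨l, hs', ht'⟩ := hj k'
    exact ⟨l, ht'.trans (congrArg (baseMap j) hs)⟩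
  · exact h₂ (baseMap i q)

/-- The type of a tuple in the predicate determines its type in the pair. -/
theorem realize_iff_of_sameType {N : PrePair L'} (hN : N.IsPair) {n : ℕ} {p p' : Fin n → N.Base}
    (h : SameType p p') (φ : (LP L').Formula (Fin n)) :
    φ.Realize (fun i => (p i : N)) ↔ φ.Realize fun i => (p' i : N) := by
  choose next emb hext hsource htarget using PartialMap.exists_total_surjective (L' := L')
  let S₀ : PartialMap L' := ⟨N, hN, ULift (Fin n), fun k => p k.down, fun k => p' k.down,
    fun θ => by
      have := h (θ.relabel ULift.down)
      rwa [Formula.realize_relabel, Formula.realize_relabel] at this⟩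
  let S : ℕ → PartialMap L' := fun n => next^[n] S₀
  have hS : ∀ n, S (n + 1) = next (S n) := fun n => Function.iterate_succ_apply' next n S₀
  have hstep : ∀ n, ∃ i : (S n).pair ↪ₑ[LP L'] (S (n + 1)).pair, (S n).Extends (S (n + 1)) i ∧
      (∀ q, ∃ k, (S (n + 1)).source k = baseMap i q) ∧
        ∀ q, ∃ k, (S (n + 1)).target k = baseMap i q := fun n => by
    rw [hS]
    exact ⟨emb _, hext _, hsource _, htarget _⟩
  choose f hf hfs hft using hstep
  obtain ⟨N', hN', j, hj, hcov⟩ := exists_pair_chain_colimit (G := fun n => (S n).pair) hN f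
  have hjb : ∀ n q, baseMap (j (n + 1)) (baseMap (f n) q) = baseMap (j n) q := fun n q =>
    Subtype.ext (hj n q)
  have hmono : ∀ {m n : ℕ}, m ≤ n → ∀ k, ∃ k',
      baseMap (j n) ((S n).source k') = baseMap (j m) ((S m).source k) ∧
        baseMap (j n) ((S n).target k') = baseMap (j m) ((S m).target k) := by
    intro m n hmn
    induction n, hmn using Nat.le_induction with
    | base => exact fun k => ⟨k, rfl, rfl⟩
    | succ n hmn ih =>
      intro k
      obtain ⟨k', h₁, h₂⟩ := ih k
      obtain ⟨l, h₃, h₄⟩ := hf n k'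
      exact ⟨l, by rw [h₃, hjb, h₁], by rw [h₄, hjb, h₂]⟩
  have hcov' : ∀ z : N'.Base, ∃ n q, baseMap (j n) q = z := fun z => by
    obtain ⟨n, q, hq⟩ := hcov z
    exact ⟨n, ⟨q, (mem_base_iff (j n) q).1 (by rw [hq]; exact z.2)⟩, Subtype.ext hq⟩
  let R : N'.Base → N'.Base → Prop := fun a b => ∃ n k,
    baseMap (j n) ((S n).source k) = a ∧ baseMap (j n) ((S n).target k) = b
  have key := realize_iff_of_relation hN' R ?_ ?_ ?_ φ (fun i => baseMap (j 0) (p i))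
    (fun i => baseMap (j 0) (p' i)) fun i => ⟨0, ⟨i⟩, rfl, rfl⟩
  · exact ((j 0).map_formula φ fun i => (p i : N)).symm.trans
      (key.trans ((j 0).map_formula φ fun i => (p' i : N)))
  · intro r a b hab θ hθ
    choose m k hm hk using hab
    have hle : ∀ i, m i ≤ Finset.univ.sup m := fun i => Finset.le_sup (Finset.mem_univ i)
    choose k' hs ht using fun i => hmono (hle i) (k i)
    generalize Finset.univ.sup m = M at *
    have ha : a = fun i => baseMap (j M) ((S M).source (k' i)) :=
      funext fun i => ((hs i).trans (hm i)).symm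
    have hb : b = fun i => baseMap (j M) ((S M).target (k' i)) :=
      funext fun i => ((ht i).trans (hk i)).symm
    rw [ha, realize_baseMap] at hθ
    rw [hb, realize_baseMap]
    have := (S M).sameType (θ.relabel k')
    rw [Formula.realize_relabel, Formula.realize_relabel] at this
    exact this.1 hθ
  · intro a
    obtain ⟨n, q, rfl⟩ := hcov' a
    obtain ⟨k, hk⟩ := hfs n q
    exact ⟨_, n + 1, k, by rw [hk, hjb], rfl⟩
  · intro a
    obtain ⟨n, q, rfl⟩ := hcov' a
    obtain ⟨k, hk⟩ := hft n q
    exact ⟨_, n + 1, k, rfl, by rw [hk, hjb]⟩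

end BackAndForth

section BoxPolynomials

variable {R : Type*} [CommRing R] {ι κ : Type} [Fintype ι] [Fintype κ]

open scoped Classical in
/-- The value at `x` of the polynomial with coefficients `q`, of degree at most `D` in each
variable. -/
noncomputable def boxEval (D : ℕ) (q : (ι → Fin (D + 1)) → R) (x : ι → R) : R :=
  ∑ e, q e * ∏ i, x i ^ (e i : ℕ)

open scoped Classical in
/-- The polynomial with coefficients `q`, of degree at most `D` in each variable. -/
noncomputable def boxPoly (D : ℕ) (q : (ι → Fin (D + 1)) → R) : MvPolynomial ι R :=
  ∑ e, MvPolynomial.C (q e) * ∏ i, MvPolynomial.X i ^ (e i : ℕ)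

theorem aeval_boxPoly {S : Type*} [CommRing S] [Algebra R S] (D : ℕ) (q : (ι → Fin (D + 1)) → R)
    (x : ι → S) :
    MvPolynomial.aeval x (boxPoly D q) = boxEval D (fun e => algebraMap R S (q e)) x := by
  simp [boxPoly, boxEval]

theorem eval_boxPoly (D : ℕ) (q : (ι → Fin (D + 1)) → R) (x : ι → R) :
    MvPolynomial.eval x (boxPoly D q) = boxEval D q x := by
  simp [boxPoly, boxEval]

theorem exists_boxPoly_eq {D : ℕ} {f : MvPolynomial ι R} (h : ∀ i, f.degreeOf i ≤ D) :
    ∃ q, boxPoly D q = f := by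
  classical
  refine ⟨fun e => f.coeff (Finsupp.equivFunOnFinite.symm fun i => (e i : ℕ)), ?_⟩
  have hm : ∀ e : ι → Fin (D + 1), (∏ i, (MvPolynomial.X i : MvPolynomial ι R) ^ (e i : ℕ)) =
      MvPolynomial.monomial (Finsupp.equivFunOnFinite.symm fun i => (e i : ℕ)) 1 := fun e => by
    rw [MvPolynomial.monomial_eq, MvPolynomial.C_1, one_mul, Finsupp.prod_fintype]
    · rfl
    · simp
  simp only [boxPoly, hm, MvPolynomial.C_mul_monomial, mul_one]
  ext d
  rw [MvPolynomial.coeff_sum]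
  simp only [MvPolynomial.coeff_monomial]
  by_cases hd : ∀ i, d i < D + 1
  · have hd' : (Finsupp.equivFunOnFinite.symm fun i => ((⟨d i, hd i⟩ : Fin (D + 1)) : ℕ)) = d := by
      ext i
      rfl
    rw [Finset.sum_eq_single_of_mem (fun i => ⟨d i, hd i⟩) (Finset.mem_univ _), if_pos hd', hd']
    intro e _ he
    refine if_neg fun h => he (funext fun i => Fin.ext ?_)
    exact DFunLike.congr_fun h i
  · have h₀ : f.coeff d = 0 := by
      by_contra h'
      push Not at hd
      obtain ⟨i, hi⟩ := hd
      have := (MvPolynomial.monomial_le_degreeOf i (MvPolynomial.mem_support_iff.2 h')).trans (h i)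
      omega
    rw [h₀]
    refine Finset.sum_eq_zero fun e _ => ?_
    split_ifs with h
    · rw [h, h₀]
    · rfl

theorem degreeOf_boxPoly_le [Nontrivial R] (D : ℕ) (q : (ι → Fin (D + 1)) → R) (i : ι) :
    (boxPoly D q).degreeOf i ≤ D := by
  classical
  refine (MvPolynomial.degreeOf_sum_le _ _ _).trans (Finset.sup_le fun e _ => ?_)
  refine (MvPolynomial.degreeOf_C_mul_le _ _ _).trans ?_
  refine (MvPolynomial.degreeOf_prod_le _ _ _).trans ?_
  refine (Finset.sum_le_sum fun j _ => (MvPolynomial.degreeOf_pow_le i _ _).trans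
    (Nat.mul_le_mul_left _ (MvPolynomial.degreeOf_X i j).le)).trans ?_
  simpa using Nat.lt_succ_iff.1 (e i).2

open scoped Classical in
theorem boxEval_sum (D : ℕ) (q : (ι ⊕ κ → Fin (D + 1)) → R) (x : ι → R) (y : κ → R) :
    boxEval D q (Sum.elim x y) =
      boxEval D (fun e => boxEval D (fun d => q (Sum.elim d e)) x) y := by
  simp only [boxEval, Fintype.prod_sum_type, Sum.elim_inl, Sum.elim_inr, Finset.sum_mul]
  rw [Finset.sum_comm, ← Fintype.sum_prod_type' (α₁ := ι → Fin (D + 1)) (γ := R)]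
  refine Finset.sum_equiv (Equiv.sumArrowEquivProdArrow ι κ (Fin (D + 1))) (by simp) fun e _ => ?_
  rw [← mul_assoc]
  refine congrArg₂ (· * ·) (congrArg₂ (· * ·) (congrArg q ?_) rfl) rfl
  exact (Sum.elim_comp_inl_inr e).symm

end BoxPolynomials

section Determinacy

variable {L' : FirstOrder.Language.{u, v}}

theorem IsTm.boxEval {α ι : Type} [Fintype ι] {D : ℕ}
    {q : (ι → Fin (D + 1)) → ∀ N : PrePair L', (α → N) → N} {x : ι → ∀ N : PrePair L', (α → N) → N}
    (hq : ∀ e, IsTm (q e)) (hx : ∀ i, IsTm (x i)) :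
    IsTm fun N v => boxEval D (fun e => q e N v) (fun i => x i N v) :=
  IsTm.sum _ fun e => (hq e).mul (IsTm.prod _ fun i => (hx i).pow _)

/-- Compactness for definable conditions with parameters. -/
theorem exists_isPair_realization {M : PrePair L'} (hM : M.IsPair) {J : Type*} {β : Type}
    {α : J → Type} {Q : ∀ j, ∀ N : PrePair L', (α j → N) → Prop} (hQ : ∀ j, IsFO (Q j))
    (f : ∀ j, α j → M ⊕ β)
    (h : ∀ s : Finset J, ∃ w : β → M, ∀ j ∈ s, Q j M (Sum.elim id w ∘ f j)) :
    ∃ N : PrePair L', N.IsPair ∧ ∃ (i : M ↪ₑ[LP L'] N) (w : β → N),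
      ∀ j, Q j N (Sum.elim i w ∘ f j) := by
  classical
  choose φ hφ using hQ
  let Ψ : J → (LP L').Formula (M ⊕ ULift.{max u v} β) := fun j =>
    (φ j).relabel (Sum.map id ULift.up ∘ f j)
  have hΨ : ∀ (j : J) (N : PrePair L') (e : M → N) (w : ULift.{max u v} β → N),
      (Ψ j).Realize (Sum.elim e w) ↔ Q j N (Sum.elim e (w ∘ ULift.up) ∘ f j) := by
    intro j N e w
    rw [Formula.realize_relabel, hφ, ← Function.comp_assoc, Sum.elim_comp_map]
    rfl
  obtain ⟨N, hN, i, w, hw⟩ := exists_pair_realization hM (Set.range Ψ) (by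
    intro s hs
    rw [← Set.image_univ] at hs
    obtain ⟨t, -, rfl⟩ := Finset.subset_set_image_iff.1 hs
    obtain ⟨w, hw⟩ := h t
    refine ⟨w ∘ ULift.down, ?_⟩
    simp only [Finset.mem_image, forall_exists_index, and_imp, forall_apply_eq_imp_iff₂]
    exact fun j hj => (hΨ j M id _).2 (hw j hj))
  exact ⟨N, hN, i, w ∘ ULift.up, fun j => (hΨ j N i w).1 (hw _ ⟨j, rfl⟩)⟩

/-- Every algebraic relation of degree at most `D` in each variable over the predicate that holds
for `x` holds for `y`. -/
def RelationsLE {ι : Type} [Fintype ι] (D : ℕ) (N : PrePair L') (x y : ι → N) : Prop :=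
  ∀ q : (ι → Fin (D + 1)) → N, (∀ e, q e ∈ PSet L' N) → boxEval D q x = 0 → boxEval D q y = 0

theorem isFO_relationsLE {α ι : Type} [Fintype ι] (D : ℕ) (f g : ι → α) :
    IsFO fun (N : PrePair L') (v : α → N) => RelationsLE D N (v ∘ f) (v ∘ g) :=
  IsFO.all (β := ι → Fin (D + 1)) <|
    (IsFO.forall_index fun e => IsFO.mem (IsTm.var (Sum.inr e))).imp <|
      (IsFO.eq (IsTm.boxEval (fun e => IsTm.var (Sum.inr e))
        fun i => IsTm.var (Sum.inl (f i))) IsTm.zero).imp <|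
      IsFO.eq (IsTm.boxEval (fun e => IsTm.var (Sum.inr e))
        fun i => IsTm.var (Sum.inl (g i))) IsTm.zero

end Determinacy

section StableEmbeddedness

variable {L' : FirstOrder.Language.{u, v}}

theorem relationsLE_of_subfield {N : PrePair L'} (hN : N.IsPair) {ι : Type} [Fintype ι] {D : ℕ}
    {x y : ι → N} (h : ∀ f : MvPolynomial ι hN.subfield, (∀ i, f.degreeOf i ≤ D) →
      MvPolynomial.aeval x f = 0 → MvPolynomial.aeval y f = 0) : RelationsLE D N x y := by
  intro q hq hx
  have := h (boxPoly D fun e => ⟨q e, hq e⟩) (degreeOf_boxPoly_le D _)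
  simp only [aeval_boxPoly] at this
  exact this hx

theorem RelationsLE.aeval_eq_zero {N : PrePair L'} (hN : N.IsPair) {ι : Type} [Fintype ι] {D : ℕ}
    {x y : ι → N} (h : RelationsLE D N x y) {f : MvPolynomial ι hN.subfield}
    (hf : ∀ i, f.degreeOf i ≤ D) (hx : MvPolynomial.aeval x f = 0) :
    MvPolynomial.aeval y f = 0 := by
  obtain ⟨q, rfl⟩ := exists_boxPoly_eq hf
  rw [aeval_boxPoly] at hx ⊢
  exact h _ (fun e => (q e).2) hx

theorem RelationsLE.mono {N : PrePair L'} (hN : N.IsPair) {ι : Type} [Fintype ι] {D D' : ℕ}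
    (hD : D ≤ D') {x y : ι → N} (h : RelationsLE D' N x y) : RelationsLE D N x y :=
  relationsLE_of_subfield hN fun _ hf => h.aeval_eq_zero hN fun i => (hf i).trans hD

/-- Tuples satisfying the same algebraic relations over the predicate satisfy the same formulas. -/
theorem realize_of_relationsLE {N : PrePair L'} (hN : N.IsPair) {ι : Type} [Fintype ι]
    {x y : ι → N} (hxy : ∀ D, RelationsLE D N x y) (hyx : ∀ D, RelationsLE D N y x)
    (φ : (LP L').Formula ι) (h : φ.Realize x) : φ.Realize y := by
  have := hN.isAlgClosed
  have hle : ∀ f : MvPolynomial ι hN.subfield, ∀ i, f.degreeOf i ≤ f.totalDegree := fun f i =>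
    f.degreeOf_le_totalDegree i
  obtain ⟨τ, hτ, hxy⟩ := exists_ringEquiv_of_same_relations hN.subfield x y fun f =>
    ⟨(hxy f.totalDegree).aeval_eq_zero hN (hle f), (hyx f.totalDegree).aeval_eq_zero hN (hle f)⟩
  have hy : y = τ ∘ x := funext fun i => (hxy i).symm
  rw [hy]
  exact (realize_comp_ringEquiv hN (FirstOrder.Language.Equiv.refl _ _) τ hτ φ x).2 h

/-- The truth of a formula depends only on the algebraic relations of bounded degree over the
predicate. -/
theorem exists_relationsLE_determines {M : PrePair L'} (hM : M.IsPair) {ι : Type} [Fintype ι]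
    (φ : (LP L').Formula ι) : ∃ D, ∀ x y : ι → M, RelationsLE D M x y → RelationsLE D M y x →
      φ.Realize x → φ.Realize y := by
  by_contra! hcon
  let Q : ℕ → ∀ N : PrePair L', (ι ⊕ ι → N) → Prop := fun D N v =>
    (RelationsLE D N (v ∘ Sum.inl) (v ∘ Sum.inr) ∧ RelationsLE D N (v ∘ Sum.inr) (v ∘ Sum.inl)) ∧
      φ.Realize (v ∘ Sum.inl) ∧ ¬ φ.Realize (v ∘ Sum.inr)
  have hQ : ∀ D, IsFO (Q D) := fun D =>
    ((isFO_relationsLE D Sum.inl Sum.inr).and (isFO_relationsLE D Sum.inr Sum.inl)).and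
      (((IsFO.formula φ).relabel Sum.inl).and ((IsFO.formula φ).relabel Sum.inr).not)
  obtain ⟨N, hN, i, w, hw⟩ := exists_isPair_realization hM hQ (fun _ => Sum.inr) fun s => by
    obtain ⟨x, y, hxy, hyx, hx, hy⟩ := hcon (s.sup id)
    refine ⟨Sum.elim x y, fun D hD => ?_⟩
    have hle : D ≤ s.sup id := Finset.le_sup (f := id) hD
    exact ⟨⟨hxy.mono hM hle, hyx.mono hM hle⟩, hx, hy⟩
  exact (hw 0).2.2 (realize_of_relationsLE hN (fun D => (hw D).1.1) (fun D => (hw D).1.2) φ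
    (hw 0).2.1)

theorem exists_base_formula_fin {M : PrePair L'} (hM : M.IsPair) {n : ℕ}
    (φ : (LP L').Formula (Fin n)) : ∃ θ : (ringLang' L').Formula (Fin n),
      ∀ p : Fin n → M.Base, φ.Realize (fun i => (p i : M)) ↔ θ.Realize p := by
  classical
  obtain ⟨F, hF⟩ : ∃ F : Finset ((ringLang' L').Formula (Fin n)), ∀ p p' : Fin n → M.Base,
      (∀ θ ∈ F, θ.Realize p ↔ θ.Realize p') → φ.Realize (fun i => (p i : M)) →
        φ.Realize fun i => (p' i : M) := by
    by_contra! hcon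
    let Q : (ringLang' L').Formula (Fin n) → ∀ N : PrePair L', (Fin n ⊕ Fin n → N) → Prop :=
      fun θ N v => ((∀ i, v i ∈ PSet L' N) ∧
        ((relativizeFormula θ).Realize (v ∘ Sum.inl) ↔
          (relativizeFormula θ).Realize (v ∘ Sum.inr))) ∧
            φ.Realize (v ∘ Sum.inl) ∧ ¬ φ.Realize (v ∘ Sum.inr)
    have hQ : ∀ θ, IsFO (Q θ) := fun θ =>
      ((IsFO.forall_index fun i => IsFO.mem (IsTm.var i)).and
        (((IsFO.formula _).relabel Sum.inl).iff ((IsFO.formula _).relabel Sum.inr))).and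
          (((IsFO.formula φ).relabel Sum.inl).and ((IsFO.formula φ).relabel Sum.inr).not)
    obtain ⟨N, hN, i, w, hw⟩ := exists_isPair_realization hM hQ (fun _ => Sum.inr) fun s => by
      obtain ⟨p, p', h, hp, hp'⟩ := hcon s
      refine ⟨Sum.elim (fun i => p i) fun i => p' i, fun θ hθ => ⟨⟨?_, ?_⟩, hp, hp'⟩⟩
      · rintro (i | i)
        exacts [(p i).2, (p' i).2]
      · exact (realize_relativizeFormula M θ p).trans
          ((h θ hθ).trans (realize_relativizeFormula M θ p').symm)
    have hP := (hw ⊤).1.1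
    let p : Fin n → N.Base := fun i => ⟨w (Sum.inl i), hP (Sum.inl i)⟩
    let p' : Fin n → N.Base := fun i => ⟨w (Sum.inr i), hP (Sum.inr i)⟩
    have hpp' : SameType p p' := fun θ => (realize_relativizeFormula N θ p).symm.trans
      ((hw θ).1.2.trans (realize_relativizeFormula N θ p'))
    have := realize_iff_of_sameType hN hpp' φ
    exact (hw ⊤).2.2 (this.1 (hw ⊤).2.1)
  let B := {b : F → Prop // ∃ p : Fin n → M.Base, φ.Realize (fun i => (p i : M)) ∧
    ∀ θ : F, b θ ↔ θ.1.Realize p}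
  refine ⟨Formula.iSup fun b : B => Formula.iInf fun θ : F => if b.1 θ then θ.1 else θ.1.not,
    fun p => ?_⟩
  simp only [Formula.realize_iSup, Formula.realize_iInf]
  have key : ∀ (b : Prop) (θ : (ringLang' L').Formula (Fin n)),
      (if b then θ else θ.not).Realize p ↔ (b ↔ θ.Realize p) := fun b θ => by
    split_ifs with h <;> simp [h]
  simp only [key]
  constructor
  · exact fun hp => ⟨⟨fun θ => θ.1.Realize p, p, hp, fun _ => Iff.rfl⟩, fun _ => Iff.rfl⟩
  · rintro ⟨⟨b, p', hp', hb⟩, h⟩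
    exact hF p' p (fun θ hθ => (hb ⟨θ, hθ⟩).symm.trans (h ⟨θ, hθ⟩)) hp'

/-- Every formula with variables in the predicate is equivalent to a formula of the structure on
the predicate. -/
theorem exists_base_formula {M : PrePair L'} (hM : M.IsPair) {α : Type} [Finite α]
    (φ : (LP L').Formula α) : ∃ θ : (ringLang' L').Formula α,
      ∀ p : α → M.Base, φ.Realize (fun i => (p i : M)) ↔ θ.Realize p := by
  obtain ⟨n, ⟨e⟩⟩ := Finite.exists_equiv_fin α
  obtain ⟨θ, hθ⟩ := exists_base_formula_fin hM (φ.relabel e)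
  refine ⟨θ.relabel e.symm, fun p => ?_⟩
  have := hθ (p ∘ e.symm)
  rw [Formula.realize_relabel] at this
  rw [Formula.realize_relabel, ← this]
  exact iff_of_eq (congrArg φ.Realize (funext fun a => by simp))

theorem exists_matrix_mem_iff {K ι : Type*} [Field K] [Fintype ι] (W : Submodule K (ι → K)) :
    ∃ A : ι → ι → K, ∀ q : ι → K, q ∈ W ↔ ∀ m, ∑ j, q j * A j m = q m := by
  classical
  obtain ⟨g, hg⟩ := LinearMap.exists_leftInverse_of_injective W.subtype W.ker_subtype
  refine ⟨fun j => g fun i => if j = i then 1 else 0, fun q => ?_⟩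
  have hsum : ∀ m, ∑ j, q j * (g fun i => if j = i then 1 else 0 : ι → K) m = (g q : ι → K) m := fun m => by
    have := congrFun ((W.subtype ∘ₗ g).pi_apply_eq_sum_univ q) m
    simpa using this.symm
  simp only [hsum, ← funext_iff]
  constructor
  · exact fun hq => congrArg Subtype.val (LinearMap.congr_fun hg ⟨q, hq⟩)
  · exact fun h => h ▸ (g q).2

open scoped Classical in
/-- The predicate is stably embedded, with a defining formula that does not depend on the
parameters. -/
theorem exists_base_formula_parameters {M : PrePair L'} (hM : M.IsPair) {κ η : Type} [Fintype κ]
    [Fintype η] (ψ : (LP L').Formula (κ ⊕ η)) :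
    ∃ (γ : Type) (_ : Finite γ) (θ : (ringLang' L').Formula (κ ⊕ γ)), ∀ c : η → M,
      ∃ e : γ → M.Base, ∀ p : κ → M.Base,
        ψ.Realize (Sum.elim (fun i => (p i : M)) c) ↔ θ.Realize (Sum.elim p e) := by
  obtain ⟨D, hD⟩ := exists_relationsLE_determines hM ψ
  let Mon := η → Fin (D + 1)
  let Q₀ : ∀ N : PrePair L', (Mon × Mon → N) → (η → N) → Prop := fun N A c =>
    ∀ q : Mon → N, (∀ j, q j ∈ PSet L' N) →
      (boxEval D q c = 0 ↔ ∀ m, ∑ j, q j * A (j, m) = q m)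
  let Q : ∀ N : PrePair L', (κ ⊕ Mon × Mon → N) → Prop := fun N v =>
    ∃ c : η → N, Q₀ N (v ∘ Sum.inr) c ∧ ψ.Realize (Sum.elim (v ∘ Sum.inl) c)
  have hQ : IsFO Q := by
    refine IsFO.ex (IsFO.and ?_ ?_)
    · refine IsFO.all ((IsFO.forall_index fun j => IsFO.mem (IsTm.var (Sum.inr j))).imp
        (IsFO.iff ?_ ?_))
      · exact IsFO.eq (IsTm.boxEval (fun e => IsTm.var (Sum.inr e))
          fun i => IsTm.var (Sum.inl (Sum.inr i))) IsTm.zero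
      · exact IsFO.forall_index fun m => IsFO.eq (IsTm.sum _ fun j =>
          (IsTm.var (Sum.inr j)).mul (IsTm.var (Sum.inl (Sum.inl (Sum.inr (j, m))))))
            (IsTm.var (Sum.inr m))
    · exact ((IsFO.formula ψ).relabel (Sum.map Sum.inl id)).congr fun N v => by
        rw [← Sum.elim_comp_inl_inr (v ∘ Sum.map Sum.inl id)]
        rfl
  obtain ⟨φ, hφ⟩ := hQ
  obtain ⟨θ, hθ⟩ := exists_base_formula hM φ
  refine ⟨Mon × Mon, inferInstance, θ, fun c => ?_⟩
  let W : Submodule hM.subfield (Mon → hM.subfield) :=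
    { carrier := {q | boxEval D (fun e => (q e : M)) c = 0}
      add_mem' := fun {q r} hq hr => by
        simp only [Set.mem_ofPred_eq, boxEval] at hq hr ⊢
        simp [add_mul, Finset.sum_add_distrib, hq, hr]
      zero_mem' := by simp [boxEval]
      smul_mem' := fun a q hq => by
        simp only [Set.mem_ofPred_eq, boxEval] at hq ⊢
        simp [mul_assoc, ← Finset.mul_sum, hq] }
  obtain ⟨A, hA⟩ := exists_matrix_mem_iff W
  have hc : Q₀ M (fun t => ((A t.1 t.2 : hM.subfield) : M)) c := fun q hq => by
    refine (hA fun j => ⟨q j, hq j⟩).trans (forall_congr' fun m => ?_)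
    rw [Subtype.ext_iff]
    simp
  refine ⟨fun t => A t.1 t.2, fun p => ?_⟩
  rw [← hθ, hφ]
  constructor
  · exact fun h => ⟨c, hc, h⟩
  · rintro ⟨c', hc', h⟩
    have hrel : ∀ {c₁ c₂ : η → M}, Q₀ M (fun t => ((A t.1 t.2 : hM.subfield) : M)) c₁ →
        Q₀ M (fun t => ((A t.1 t.2 : hM.subfield) : M)) c₂ →
          RelationsLE D M (Sum.elim (fun i => (p i : M)) c₁)
            (Sum.elim (fun i => (p i : M)) c₂) := by
      intro c₁ c₂ h₁ h₂ q hq h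
      rw [boxEval_sum] at h ⊢
      have hmem : ∀ e, boxEval D (fun d => q (Sum.elim d e)) (fun i => (p i : M)) ∈ PSet L' M :=
        fun e => hM.subfield.sum_mem fun d _ => hM.subfield.mul_mem (hq _)
          (hM.subfield.prod_mem fun i _ => hM.subfield.pow_mem (p i).2 _)
      exact (h₂ _ hmem).2 ((h₁ _ hmem).1 h)
    exact hD _ _ (hrel hc' hc) (hrel hc hc') h

end StableEmbeddedness

section GenericPoints

variable {L' : FirstOrder.Language.{u, v}} {ν μ η : Type} [Fintype ν] [Fintype μ] [Fintype η]

/-- The common zeros of `s` polynomials with coefficients `p` and parameters `c`. -/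
def InZeroLocus {s d : ℕ} (N : PrePair L') (p : Fin s × (η ⊕ ν → Fin (d + 1)) → N) (c : η → N)
    (x : ν → N) : Prop :=
  ∀ i, boxEval d (fun e => p (i, e)) (Sum.elim c x) = 0

/-- A point of the zero locus outside some hypersurface, such that each relation of degree at most
`D` that it satisfies over the predicate and `a` holds everywhere outside the hypersurface. -/
def IsGenericPoint {s d : ℕ} (D l : ℕ) (N : PrePair L')
    (p : Fin s × (η ⊕ ν → Fin (d + 1)) → N) (c : η → N) (b : ν → N) (a : μ → N) : Prop :=
  InZeroLocus N p c b ∧ ∃ g : (ν → Fin (l + 1)) → N, boxEval l g b ≠ 0 ∧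
    ∀ q : (ν ⊕ μ → Fin (D + 1)) → N, (∀ e, q e ∈ PSet L' N) → boxEval D q (Sum.elim b a) = 0 →
      ∀ x, InZeroLocus N p c x → boxEval l g x ≠ 0 → boxEval D q (Sum.elim x a) = 0

/-- The generic points of a zero locus satisfy the formula, and any two parameters have a common
generic point. -/
def GenericallyRealizes {s d : ℕ} (φ : (LP L').Formula (ν ⊕ μ)) (D l : ℕ) (N : PrePair L')
    (p : Fin s × (η ⊕ ν → Fin (d + 1)) → N) (c : η → N) (a : μ → N) : Prop :=
  (∀ b, IsGenericPoint D l N p c b a → φ.Realize (Sum.elim b a)) ∧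
    ∀ r r' : μ → N, ∃ b, IsGenericPoint D l N p c b r ∧ IsGenericPoint D l N p c b r'

theorem isFO_inZeroLocus {α : Type} {s d : ℕ} (fp : Fin s × (η ⊕ ν → Fin (d + 1)) → α)
    (fc : η → α) (fx : ν → α) :
    IsFO fun (N : PrePair L') (v : α → N) => InZeroLocus N (v ∘ fp) (v ∘ fc) (v ∘ fx) := by
  refine IsFO.forall_index fun i => ?_
  refine (IsFO.eq (IsTm.boxEval (D := d) (q := fun e N v => v (fp (i, e)))
    (x := fun k N v => v (Sum.elim fc fx k)) (fun e => IsTm.var _) fun i => IsTm.var _)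
      IsTm.zero).congr fun N v => ?_
  have : (fun k => v (Sum.elim fc fx k)) = Sum.elim (v ∘ fc) (v ∘ fx) := by
    ext (k | k) <;> rfl
  rw [this]
  rfl

theorem isFO_boxEval_eq_zero {α : Type} {D : ℕ} (fq : (ν ⊕ μ → Fin (D + 1)) → α) (fb : ν → α)
    (fa : μ → α) : IsFO fun (N : PrePair L') (v : α → N) =>
      boxEval D (v ∘ fq) (Sum.elim (v ∘ fb) (v ∘ fa)) = 0 := by
  refine (IsFO.eq (IsTm.boxEval (D := D) (q := fun e N v => v (fq e))
    (x := fun k N v => v (Sum.elim fb fa k)) (fun e => IsTm.var _) fun i => IsTm.var _)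
      IsTm.zero).congr fun N v => ?_
  have : (fun k => v (Sum.elim fb fa k)) = Sum.elim (v ∘ fb) (v ∘ fa) := by
    ext (k | k) <;> rfl
  rw [this]
  rfl

open scoped Classical in
theorem isFO_isGenericPoint {α : Type} {s d : ℕ} (D l : ℕ)
    (fp : Fin s × (η ⊕ ν → Fin (d + 1)) → α) (fc : η → α) (fb : ν → α) (fa : μ → α) :
    IsFO fun (N : PrePair L') (v : α → N) =>
      IsGenericPoint D l N (v ∘ fp) (v ∘ fc) (v ∘ fb) (v ∘ fa) := by
  refine (isFO_inZeroLocus fp fc fb).and (IsFO.ex (β := ν → Fin (l + 1)) (IsFO.and ?_ ?_))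
  · exact (IsFO.eq (IsTm.boxEval (fun e => IsTm.var (Sum.inr e))
      fun i => IsTm.var (Sum.inl (fb i))) IsTm.zero).not
  · refine IsFO.all (β := ν ⊕ μ → Fin (D + 1))
      ((IsFO.forall_index fun e => IsFO.mem (IsTm.var (Sum.inr e))).imp (IsFO.imp ?_ ?_))
    · exact isFO_boxEval_eq_zero Sum.inr (Sum.inl ∘ Sum.inl ∘ fb) (Sum.inl ∘ Sum.inl ∘ fa)
    · refine IsFO.all (β := ν) (IsFO.imp ?_ (IsFO.imp ?_ ?_))
      · exact isFO_inZeroLocus (Sum.inl ∘ Sum.inl ∘ Sum.inl ∘ fp) (Sum.inl ∘ Sum.inl ∘ Sum.inl ∘ fc)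
          Sum.inr
      · exact (IsFO.eq (IsTm.boxEval (fun e => IsTm.var (Sum.inl (Sum.inl (Sum.inr e))))
          fun i => IsTm.var (Sum.inr i)) IsTm.zero).not
      · exact isFO_boxEval_eq_zero (Sum.inl ∘ Sum.inr) Sum.inr
          (Sum.inl ∘ Sum.inl ∘ Sum.inl ∘ fa)

theorem isFO_genericallyRealizes {α : Type} {s d : ℕ} (φ : (LP L').Formula (ν ⊕ μ)) (D l : ℕ)
    (fp : Fin s × (η ⊕ ν → Fin (d + 1)) → α) (fc : η → α) (fa : μ → α) :
    IsFO fun (N : PrePair L') (v : α → N) =>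
      GenericallyRealizes φ D l N (v ∘ fp) (v ∘ fc) (v ∘ fa) := by
  refine IsFO.and (IsFO.all (β := ν) (IsFO.imp ?_ ?_)) (IsFO.all (β := μ) (IsFO.all (β := μ)
    (IsFO.ex (β := ν) (IsFO.and ?_ ?_))))
  · exact isFO_isGenericPoint D l (Sum.inl ∘ fp) (Sum.inl ∘ fc) Sum.inr (Sum.inl ∘ fa)
  · refine ((IsFO.formula φ).relabel (Sum.elim Sum.inr (Sum.inl ∘ fa))).congr fun N v => ?_
    rw [Sum.comp_elim]
    rfl
  · exact isFO_isGenericPoint D l (Sum.inl ∘ Sum.inl ∘ Sum.inl ∘ fp)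
      (Sum.inl ∘ Sum.inl ∘ Sum.inl ∘ fc) Sum.inr (Sum.inl ∘ Sum.inl ∘ Sum.inr)
  · exact isFO_isGenericPoint D l (Sum.inl ∘ Sum.inl ∘ Sum.inl ∘ fp)
      (Sum.inl ∘ Sum.inl ∘ Sum.inl ∘ fc) Sum.inr (Sum.inl ∘ Sum.inr)

theorem GenericallyRealizes.exists_realize {s d : ℕ} {φ : (LP L').Formula (ν ⊕ μ)} {D l : ℕ}
    {N : PrePair L'} {p : Fin s × (η ⊕ ν → Fin (d + 1)) → N} {c : η → N} {a a' : μ → N}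
    (h : GenericallyRealizes φ D l N p c a) (h' : GenericallyRealizes φ D l N p c a') :
    ∃ b, φ.Realize (Sum.elim b a) ∧ φ.Realize (Sum.elim b a') := by
  obtain ⟨b, hb, hb'⟩ := h.2 a a'
  exact ⟨b, h.1 b hb, h'.1 b hb'⟩

theorem exists_genericallyRealizes {N : PrePair L'} (hN : N.IsPair) {φ : (LP L').Formula (ν ⊕ μ)}
    {D : ℕ} (hD : ∀ x y : ν ⊕ μ → N, RelationsLE D N x y → RelationsLE D N y x →
      φ.Realize x → φ.Realize y) (K : IntermediateField hN.subfield N)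
    (hK : Cardinal.aleph0 ≤ Algebra.trdeg K N) (b : ν → N) {s d : ℕ}
    {p : Fin s × (η ⊕ ν → Fin (d + 1)) → N} {c : η → N}
    (hV : ∀ x : ν → N, InZeroLocus N p c x ↔
      ∀ f : MvPolynomial ν K, MvPolynomial.aeval b f = 0 → MvPolynomial.aeval x f = 0) :
    ∃ l, ∀ a : μ → N, (∀ k, a k ∈ K) → φ.Realize (Sum.elim b a) →
      GenericallyRealizes φ D l N p c a := by
  have := hN.isAlgClosed
  let I : Ideal (MvPolynomial ν K) := RingHom.ker (MvPolynomial.aeval (R := K) b)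
  have hI : I.IsPrime := RingHom.ker_isPrime _
  have hVI : ∀ x : ν → N, InZeroLocus N p c x ↔ ∀ f ∈ I, MvPolynomial.aeval x f = 0 := hV
  obtain ⟨f, hf⟩ := exists_generic_points hK hI.ne_top
  have hpoly : ∀ q : (ν ⊕ μ → Fin (D + 1)) → N, (∀ e, q e ∈ PSet L' N) →
      ∃ Q : MvPolynomial (ν ⊕ μ) K, ∀ z : ν ⊕ μ → N, MvPolynomial.aeval z Q = boxEval D q z :=
    fun q hq => ⟨boxPoly D fun e => algebraMap hN.subfield K ⟨q e, hq e⟩, fun z => by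
      rw [aeval_boxPoly]
      rfl⟩
  obtain ⟨l, hl⟩ : ∃ l, ∀ i, f.degreeOf i ≤ l := ⟨f.totalDegree, fun i => f.degreeOf_le_totalDegree i⟩
  obtain ⟨g, rfl⟩ := exists_boxPoly_eq hl
  simp only [eval_boxPoly] at hf
  refine ⟨l, fun a ha hφ => ⟨?_, ?_⟩⟩
  · rintro b' ⟨hb', g', hg', hb'g⟩
    have hrel : ∀ q : (ν ⊕ μ → Fin (D + 1)) → N, (∀ e, q e ∈ PSet L' N) →
        ∃ h : MvPolynomial ν K, ∀ x : ν → N,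
          MvPolynomial.aeval x h = boxEval D q (Sum.elim x a) := fun q hq => by
      obtain ⟨Q, hQ⟩ := hpoly q hq
      refine ⟨MvPolynomial.aeval (Sum.elim MvPolynomial.X fun k => MvPolynomial.C ⟨a k, ha k⟩) Q,
        fun x => ?_⟩
      rw [← hQ, MvPolynomial.comp_aeval_apply]
      congr 2
      ext (k | k)
      · simp
      · simp [IntermediateField.algebraMap_apply]
    refine hD _ _ ?_ ?_ hφ
    · intro q hq h0
      obtain ⟨h, hh⟩ := hrel q hq
      rw [← hh] at h0 ⊢
      exact (hV b').1 hb' h h0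
    · intro q hq h0
      obtain ⟨h, hh⟩ := hrel q hq
      rw [← hh]
      refine mem_of_mul_vanishes hI (b := b') (q := boxPoly l g') ((hVI b').1 hb')
        (by rwa [eval_boxPoly]) fun x hx => ?_
      rw [eval_boxPoly, hh]
      by_cases hx' : boxEval l g' x = 0
      · rw [hx', zero_mul]
      · rw [hb'g q hq h0 x ((hVI x).2 hx) hx', mul_zero]
  · intro r r'
    obtain ⟨b', hb', hg, h⟩ := hf (μ ⊕ μ) (Sum.elim r r')
    have hgen : ∀ (e : μ → μ ⊕ μ), IsGenericPoint D l N p c b' (Sum.elim r r' ∘ e) := by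
      refine fun e => ⟨(hVI b').2 hb', g, hg, fun q hq h0 x hx hx' => ?_⟩
      obtain ⟨Q, hQ⟩ := hpoly q hq
      have key : ∀ y : ν → N, MvPolynomial.aeval (Sum.elim y (Sum.elim r r'))
          (MvPolynomial.rename (Sum.map id e) Q) =
            boxEval D q (Sum.elim y (Sum.elim r r' ∘ e)) := fun y => by
        rw [MvPolynomial.aeval_rename, hQ, Sum.elim_comp_map, Function.comp_id]
      rw [← key]
      exact h _ ((key b').trans h0) x ((hVI x).1 hx) hx'
    exact ⟨b', hgen Sum.inl, hgen Sum.inr⟩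

end GenericPoints

section ClearDenominators

variable {k N : Type*} [Field k] [Field N] [Algebra k N] {X ν : Type} (x : X → N)

/-- Clearing denominators in a polynomial over a field generated by `x`. -/
theorem exists_aeval_sumElim_eq_mul (f : MvPolynomial ν (IntermediateField.adjoin k (Set.range x))) :
    ∃ (U : MvPolynomial X k) (G : MvPolynomial (X ⊕ ν) k), MvPolynomial.aeval x U ≠ 0 ∧
      ∀ z : ν → N, MvPolynomial.aeval (Sum.elim x z) G =
        MvPolynomial.aeval x U * MvPolynomial.aeval z f := by
  have hleft : ∀ (U : MvPolynomial X k) (z : ν → N), MvPolynomial.aeval (Sum.elim x z)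
      (MvPolynomial.rename Sum.inl U) = MvPolynomial.aeval x U := fun U z => by
    rw [MvPolynomial.aeval_rename, Sum.elim_comp_inl]
  induction f using MvPolynomial.induction_on with
  | C a =>
    obtain ⟨a, ha⟩ := a
    obtain ⟨r, s, rfl⟩ := (IntermediateField.mem_adjoin_range_iff k x _).1 ha
    by_cases hs : MvPolynomial.aeval x s = 0
    · exact ⟨1, 0, by simp, fun z => by
        simp [hs, IntermediateField.algebraMap_apply]⟩
    · refine ⟨s, MvPolynomial.rename Sum.inl r, hs, fun z => ?_⟩
      rw [hleft, MvPolynomial.aeval_C, IntermediateField.algebraMap_apply]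
      exact (mul_div_cancel₀ _ hs).symm
  | add f₁ f₂ h₁ h₂ =>
    obtain ⟨U₁, G₁, hU₁, hG₁⟩ := h₁
    obtain ⟨U₂, G₂, hU₂, hG₂⟩ := h₂
    refine ⟨U₁ * U₂, MvPolynomial.rename Sum.inl U₂ * G₁ + MvPolynomial.rename Sum.inl U₁ * G₂,
      by simp [hU₁, hU₂], fun z => ?_⟩
    simp only [map_add, map_mul, hleft, hG₁, hG₂]
    ring
  | mul_X f i h =>
    obtain ⟨U, G, hU, hG⟩ := h
    refine ⟨U, G * MvPolynomial.X (Sum.inr i), hU, fun z => ?_⟩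
    simp only [map_mul, hG, MvPolynomial.aeval_X, Sum.elim_inr]
    ring

/-- Finitely many polynomials over a field generated by `x` involve only finitely many
coordinates of `x` and have bounded degree. -/
theorem exists_boxEval_sumElim_eq_mul [Fintype ν] {s : ℕ}
    (f : Fin s → MvPolynomial ν (IntermediateField.adjoin k (Set.range x))) :
    ∃ (S : Finset X) (d : ℕ) (p : Fin s × (S ⊕ ν → Fin (d + 1)) → k) (u : Fin s → N),
      (∀ i, u i ≠ 0) ∧ ∀ i (z : ν → N),
        boxEval d (fun e => algebraMap k N (p (i, e))) (Sum.elim (fun t : S => x t) z) =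
          u i * MvPolynomial.aeval z (f i) := by
  classical
  choose U G hU hG using fun i => exists_aeval_sumElim_eq_mul x (f i)
  let S : Finset X := Finset.univ.biUnion fun i => (G i).vars.toLeft
  have hS : ∀ i, ∃ H : MvPolynomial (S ⊕ ν) k,
      MvPolynomial.rename (Sum.map Subtype.val id) H = G i := fun i => by
    refine MvPolynomial.exists_rename_eq_of_vars_subset_range _ _
      (Subtype.val_injective.sumMap Function.injective_id) ?_
    rintro (t | t) ht
    · exact ⟨Sum.inl ⟨t, Finset.mem_biUnion.2 ⟨i, Finset.mem_univ _, Finset.mem_toLeft.2 ht⟩⟩, rfl⟩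
    · exact ⟨Sum.inr t, rfl⟩
  choose H hH using hS
  let d := Finset.univ.sup fun i => (H i).totalDegree
  choose q hq using fun i => exists_boxPoly_eq (D := d) (f := H i) fun t =>
    ((H i).degreeOf_le_totalDegree t).trans
      (Finset.le_sup (f := fun i => (H i).totalDegree) (Finset.mem_univ i))
  refine ⟨S, d, fun e => q e.1 e.2, fun i => MvPolynomial.aeval x (U i), hU, fun i z => ?_⟩
  rw [← hG, ← aeval_boxPoly, hq, ← hH, MvPolynomial.aeval_rename, Sum.elim_comp_map]
  rfl

end ClearDenominators

section Independence

variable {L' : FirstOrder.Language.{u, v}}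

/-- A polynomial relation of degree at most `D` between `x` and `y` over the predicate is trivial
as a relation in `y`. -/
def IndependentLE {ι κ : Type} [Fintype ι] [Fintype κ] (D : ℕ) (N : PrePair L') (x : ι → N)
    (y : κ → N) : Prop :=
  ∀ q : (ι ⊕ κ → Fin (D + 1)) → N, (∀ e, q e ∈ PSet L' N) → boxEval D q (Sum.elim x y) = 0 →
    ∀ e : κ → Fin (D + 1), boxEval D (fun d => q (Sum.elim d e)) x = 0

open scoped Classical in
theorem isFO_independentLE {α ι κ : Type} [Fintype ι] [Fintype κ] (D : ℕ) (f : ι → α) (g : κ → α) :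
    IsFO fun (N : PrePair L') (v : α → N) => IndependentLE D N (v ∘ f) (v ∘ g) := by
  refine IsFO.all (β := ι ⊕ κ → Fin (D + 1)) ((IsFO.forall_index fun e =>
    IsFO.mem (IsTm.var (Sum.inr e))).imp (IsFO.imp ?_ (IsFO.forall_index fun e => ?_)))
  · exact isFO_boxEval_eq_zero Sum.inr (Sum.inl ∘ f) (Sum.inl ∘ g)
  · exact IsFO.eq (IsTm.boxEval (fun d => IsTm.var (Sum.inr (Sum.elim d e)))
      fun i => IsTm.var (Sum.inl (f i))) IsTm.zero

open scoped Classical in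
/-- Over a finite-dimensional space of coefficients, some sequence satisfies no nontrivial
polynomial relation of bounded degree. -/
theorem exists_forall_boxEval_eq_zero {k N : Type w} [Field k] [Field N] [IsAlgClosed N]
    [Algebra k N] (hinf : ¬ FiniteDimensional k N) (d n : ℕ) (E : Submodule k N)
    [FiniteDimensional k E] : ∃ c : ℕ → N, ∀ n' ≤ n, ∀ d' ≤ d, ∀ r : (Fin n' → Fin (d' + 1)) → N,
      (∀ e, r e ∈ E) → boxEval d' r (fun i => c i) = 0 → ∀ e, r e = 0 := by
  obtain ⟨c, hc⟩ := exists_forall_sum_mul_prod_pow_eq_zero hinf d n E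
  refine ⟨fun i => if h : i < n then c ⟨i, h⟩ else 0, fun n' hn d' hd r hr h e => ?_⟩
  let pad : (Fin n' → Fin (d' + 1)) → Fin n → Fin (d + 1) := fun e i =>
    if h : (i : ℕ) < n' then Fin.castLE (by omega) (e ⟨i, h⟩) else 0
  have hpad : ∀ e i, (pad e (Fin.castLE hn i) : ℕ) = e i := fun e i => by
    simp [pad]
  have hinj : Function.Injective pad := fun e e' he => funext fun i => Fin.ext <| by
    rw [← hpad, ← hpad, he]
  have key : ∀ μ, Function.extend pad r 0 μ = 0 := by
    refine hc _ (fun μ => ?_) ?_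
    · by_cases hμ : ∃ e, pad e = μ
      · obtain ⟨e, rfl⟩ := hμ
        rw [hinj.extend_apply]
        exact hr e
      · rw [Function.extend_apply' _ _ _ hμ]
        exact E.zero_mem
    · refine (Fintype.sum_of_injective pad hinj (fun e => r e * ∏ i : Fin n',
        (if h : (i : ℕ) < n then c ⟨i, h⟩ else 0) ^ (e i : ℕ)) _ (fun μ hμ => ?_)
          fun e => ?_).symm.trans ?_
      · rw [Function.extend_apply' _ _ _ hμ, Pi.zero_apply, zero_mul]
      · rw [hinj.extend_apply]
        refine congrArg _ (Fintype.prod_of_injective (Fin.castLE hn) (Fin.castLE_injective hn) _ _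
          (fun i hi => ?_) fun i => ?_)
        · have : ¬ (i : ℕ) < n' := fun h => hi ⟨⟨i, h⟩, rfl⟩
          simp [pad, this]
        · rw [hpad]
          simp [i.2.trans_le hn, Fin.castLE]
      · refine Eq.trans ?_ h
        rw [boxEval]
        convert rfl
  rw [← hinj.extend_apply r 0, key]

open scoped Classical in
theorem exists_independentLE {M : PrePair L'} (hM : M.IsPair) {X : Type} (x : X → M)
    (s : Finset (Finset X × ℕ × ℕ)) :
    ∃ c : ℕ → M, ∀ j ∈ s, IndependentLE j.2.1 M (fun t : j.1 => x t) (fun i : Fin j.2.2 => c i) := by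
  have := hM.isAlgClosed
  let B : Set M := ⋃ j ∈ s, Set.range fun e : j.1 → Fin (j.2.1 + 1) => ∏ t : j.1, x t ^ (e t : ℕ)
  have hB : B.Finite := s.finite_toSet.biUnion fun j _ => Set.finite_range _
  let E := Submodule.span hM.subfield B
  have : FiniteDimensional hM.subfield E := FiniteDimensional.span_of_finite _ hB
  obtain ⟨c, hc⟩ := exists_forall_boxEval_eq_zero hM.not_finiteDimensional
    (s.sup fun j => j.2.1) (s.sup fun j => j.2.2) E
  refine ⟨c, fun j hj q hq h => ?_⟩
  rw [boxEval_sum] at h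
  refine hc _ (Finset.le_sup (f := fun j => j.2.2) hj) _ (Finset.le_sup (f := fun j => j.2.1) hj) _
    (fun e => ?_) h
  refine E.sum_mem fun d _ => E.smul_mem ⟨q (Sum.elim d e), hq _⟩ (Submodule.subset_span ?_)
  exact Set.mem_biUnion hj ⟨d, rfl⟩

theorem aleph0_le_trdeg_of_independentLE {N : PrePair L'} (hN : N.IsPair) {X : Type} (x : X → N)
    (c : ℕ → N) (h : ∀ (S : Finset X) (D n : ℕ),
      IndependentLE D N (fun t : S => x t) (fun i : Fin n => c i)) :
    Cardinal.aleph0 ≤ Algebra.trdeg (IntermediateField.adjoin hN.subfield (Set.range x)) N := by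
  have := hN.isAlgClosed
  have : Infinite N := IsAlgClosed.instInfinite
  refine Cardinal.aleph0_le.2 fun n => ?_
  have hc : AlgebraicIndependent (IntermediateField.adjoin hN.subfield (Set.range x))
      fun i : Fin n => c i := by
    rw [algebraicIndependent_iff]
    intro f hf
    obtain ⟨S, d, p, u, hu, hp⟩ := exists_boxEval_sumElim_eq_mul x fun _ : Fin 1 => f
    have h0 := h S d n (fun e => p (0, e)) (fun e => (p (0, e)).2)
      ((hp 0 _).trans (by rw [hf, mul_zero]))
    refine MvPolynomial.map_injective (algebraMap _ N)
      (FaithfulSMul.algebraMap_injective _ N) ?_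
    rw [map_zero]
    refine MvPolynomial.funext fun z => ?_
    rw [MvPolynomial.eval_map, ← MvPolynomial.aeval_def, map_zero]
    refine (mul_eq_zero.1 ((hp 0 z).symm.trans ?_)).resolve_left (hu 0)
    refine (boxEval_sum d _ _ _).trans ((Finset.sum_congr rfl fun e _ => ?_).trans
      Finset.sum_const_zero)
    rw [mul_eq_zero]
    exact Or.inl (h0 e)
  simpa using hc.lift_cardinalMk_le_trdeg

end Independence

section Realizations

variable {L' : FirstOrder.Language.{u, v}} {ν μ : Type} [Fintype ν]

open scoped Classical in
/-- In an elementary extension of infinite transcendence degree over the parameters of a witness,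
the infinite consistent families are realized. -/
theorem Pattern.Witness.exists_realization {pat : Pattern} {M : PrePair L'} (hM : M.IsPair)
    {φ : (LP L').Formula (ν ⊕ μ)} {a : pat.Index → μ → M} (h : pat.Witness φ a) :
    ∃ N : PrePair L', ∃ hN : N.IsPair, (M ≅[LP L'] N) ∧
      ∃ (a' : pat.Index → μ → N) (b : pat.Branch → ν → N),
        (∀ ξ, ∀ i ∈ pat.cons ξ, φ.Realize (Sum.elim (b ξ) (a' i))) ∧
        (∀ i j, pat.inc i j →
          ¬ ∃ b : ν → N, φ.Realize (Sum.elim b (a' i)) ∧ φ.Realize (Sum.elim b (a' j))) ∧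
        Cardinal.aleph0 ≤ Algebra.trdeg (IntermediateField.adjoin hN.subfield
          (Set.range fun t : pat.Index × μ => a' t.1 t.2)) N := by
  let J := (Σ ξ, pat.cons ξ) ⊕ (Finset (pat.Index × μ) × ℕ × ℕ)
  let x : pat.Index × μ → M := fun t => a t.1 t.2
  let α : J → Type := Sum.elim (fun _ => ν ⊕ μ) fun j => j.1 ⊕ Fin j.2.2
  let Q : ∀ (j : J) (N : PrePair L'), (α j → N) → Prop := fun j => match j with
    | Sum.inl _ => fun N v => φ.Realize v
    | Sum.inr j => fun N v => IndependentLE j.2.1 N (v ∘ Sum.inl) (v ∘ Sum.inr)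
  have hQ : ∀ j, IsFO (Q j) := fun j => match j with
    | Sum.inl _ => IsFO.formula φ
    | Sum.inr j => isFO_independentLE _ _ _
  let f : ∀ j, α j → M ⊕ ((pat.Branch × ν) ⊕ ℕ) := fun j => match j with
    | Sum.inl j => Sum.elim (fun k => Sum.inr (Sum.inl (j.1, k))) fun k => Sum.inl (a j.2 k)
    | Sum.inr j => Sum.elim (fun t => Sum.inl (x t)) fun i => Sum.inr (Sum.inr i)
  obtain ⟨N, hN, i, w, hw⟩ := exists_isPair_realization hM hQ f fun s => by
    have hb : ∀ ξ, ∃ b : ν → M, ∀ j : pat.cons ξ, Sum.inl ⟨ξ, j⟩ ∈ s →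
        φ.Realize (Sum.elim b (a j)) := fun ξ => by
      obtain ⟨b, hb⟩ := h.1 ξ ((s.toLeft.filter fun j => j.1 = ξ).image fun j => (j.2 : pat.Index))
        (by
          intro i hi
          simp only [Finset.coe_image, Finset.coe_filter, Set.mem_image] at hi
          obtain ⟨⟨ξ', j⟩, ⟨-, rfl⟩, rfl⟩ := hi
          exact j.2)
      exact ⟨b, fun j hj => hb j (Finset.mem_image.2 ⟨⟨ξ, j⟩, by simpa using hj, rfl⟩)⟩
    choose b hb using hb
    obtain ⟨c, hc⟩ := exists_independentLE hM x s.toRight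
    refine ⟨Sum.elim (fun t => b t.1 t.2) c, ?_⟩
    rintro (⟨ξ, j⟩ | j) hj
    · refine (congrArg φ.Realize ?_).mp (hb ξ j hj)
      ext (k | k) <;> rfl
    · exact hc j (Finset.mem_toRight.2 hj)
  refine ⟨N, hN, i.elementarilyEquivalent, fun j k => i (a j k), fun ξ k => w (Sum.inl (ξ, k)),
    fun ξ j hj => ?_, fun j j' hj => ?_, ?_⟩
  · refine (congrArg φ.Realize ?_).mp (hw (Sum.inl ⟨ξ, j, hj⟩))
    ext (k | k) <;> rfl
  · have hfo : IsFO fun (N : PrePair L') (v : μ ⊕ μ → N) => ∃ b : ν → N,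
        φ.Realize (Sum.elim b (v ∘ Sum.inl)) ∧ φ.Realize (Sum.elim b (v ∘ Sum.inr)) := by
      refine IsFO.ex (β := ν) (IsFO.and ?_ ?_)
      · refine ((IsFO.formula φ).relabel (Sum.elim Sum.inr (Sum.inl ∘ Sum.inl))).congr fun N v => ?_
        rw [Sum.comp_elim]
        rfl
      · refine ((IsFO.formula φ).relabel (Sum.elim Sum.inr (Sum.inl ∘ Sum.inr))).congr fun N v => ?_
        rw [Sum.comp_elim]
        rfl
    exact fun hex => h.2 j j' hj ((hfo.map i (Sum.elim (a j) (a j'))).1 hex)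
  · exact aleph0_le_trdeg_of_independentLE hN _ (fun n => w (Sum.inr n)) fun S D n =>
      hw (Sum.inr (S, D, n))

end Realizations

section Preservation

variable {L' : FirstOrder.Language.{u, v}} {ν μ : Type} [Fintype ν] [Fintype μ]

/-- Formulas over a field generated by `x` that hold at `b` hold at the generic points of the locus
of `b`, which is cut out by finitely many equations. -/
theorem exists_genericallyRealizes_adjoin {N : PrePair L'} (hN : N.IsPair)
    {φ : (LP L').Formula (ν ⊕ μ)} {D : ℕ} (hD : ∀ x y : ν ⊕ μ → N, RelationsLE D N x y →
      RelationsLE D N y x → φ.Realize x → φ.Realize y) {X : Type} (x : X → N)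
    (hK : Cardinal.aleph0 ≤
      Algebra.trdeg (IntermediateField.adjoin hN.subfield (Set.range x)) N) (b : ν → N) :
    ∃ (γ : Finset X × ℕ × ℕ × ℕ) (p : Fin γ.2.1 × (γ.1 ⊕ ν → Fin (γ.2.2.1 + 1)) → N.Base),
      ∀ t : μ → X, φ.Realize (Sum.elim b (x ∘ t)) →
        GenericallyRealizes φ D γ.2.2.2 N (fun e => (p e : N)) (fun t : γ.1 => x t) (x ∘ t) := by
  obtain ⟨G, hG⟩ := IsNoetherian.noetherian (RingHom.ker (MvPolynomial.aeval
    (R := IntermediateField.adjoin hN.subfield (Set.range x)) b))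
  let f : Fin G.card → MvPolynomial ν (IntermediateField.adjoin hN.subfield (Set.range x)) :=
    fun i => G.equivFin.symm i
  obtain ⟨S, d, p, u, hu, hp⟩ := exists_boxEval_sumElim_eq_mul x f
  obtain ⟨l, hl⟩ := exists_genericallyRealizes hN hD _ hK b (p := fun e => (p e : N))
    (c := fun t : S => x t) fun z => by
      refine ⟨fun h f' hf' => ?_, fun h i => (hp i z).trans ?_⟩
      · have hle : Ideal.span (G : Set (MvPolynomial ν _)) ≤ RingHom.ker (MvPolynomial.aeval
            (R := IntermediateField.adjoin hN.subfield (Set.range x)) z) := by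
          refine Ideal.span_le.2 fun y hy => ?_
          have := (mul_eq_zero.1 ((hp (G.equivFin ⟨y, hy⟩) z).symm.trans (h _))).resolve_left (hu _)
          simpa [f] using this
        exact hle (hG.ge hf')
      · rw [h _ (hG.le (Ideal.subset_span (G.equivFin.symm i).2)), mul_zero]
  exact ⟨(S, _, d, l), p, fun t h =>
    hl _ (fun k => IntermediateField.subset_adjoin _ _ ⟨t k, rfl⟩) h⟩

/-- A pattern in an algebraically closed field with a predicate descends to the predicate. -/
theorem Pattern.Witness.exists_base_witness {pat : Pattern} (hpat : pat.Baire) {M : PrePair L'}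
    (hM : M.IsPair) {φ : (LP L').Formula (ν ⊕ μ)} {a : pat.Index → μ → M} (h : pat.Witness φ a) :
    ∃ N : PrePair L', (M ≅[LP L'] N) ∧ ∃ (κ γ : Type) (_ : Finite κ) (_ : Finite γ)
      (θ : (ringLang' L').Formula (κ ⊕ γ)) (e : pat.Index → γ → N.Base), pat.Witness θ e := by
  obtain ⟨N, hN, hMN, a', b, hcons, hinc, hK⟩ := h.exists_realization hM
  obtain ⟨D, hD⟩ := exists_relationsLE_determines hN φ
  choose col hp using fun ξ => exists_genericallyRealizes_adjoin hN hD
    (fun t : pat.Index × μ => a' t.1 t.2) hK (b ξ)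
  have := pat.countable
  obtain ⟨⟨S, s, d, l⟩, g, hg, hgc⟩ := hpat (Finset (pat.Index × μ) × ℕ × ℕ × ℕ) col
  classical
  let κ := Fin s × (S ⊕ ν → Fin (d + 1))
  have : Fintype κ := inferInstanceAs (Fintype (Fin s × (S ⊕ ν → Fin (d + 1))))
  obtain ⟨ψ, hψ⟩ := isFO_genericallyRealizes (L' := L') (α := κ ⊕ (S ⊕ μ)) φ D l Sum.inl
    (Sum.inr ∘ Sum.inl) (Sum.inr ∘ Sum.inr)
  obtain ⟨γ, hγ, θ, hθ⟩ := exists_base_formula_parameters (κ := κ) (η := S ⊕ μ) hN ψ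
  choose e he using hθ
  let c : S → N := fun t => a' t.1.1 t.1.2
  have key : ∀ i (q : κ → N.Base), θ.Realize (Sum.elim q (e (Sum.elim c (a' i)))) ↔
      GenericallyRealizes φ D l N (fun j => (q j : N)) c (a' i) := fun i q =>
    (he _ q).symm.trans (hψ _ _)
  refine ⟨N, hMN, κ, γ, inferInstance, hγ, θ, fun i => e (Sum.elim c (a' (g i))),
    fun ξ Y hY => ?_, fun i j hij ⟨q, hi, hj⟩ => ?_⟩
  · obtain ⟨ξ', hξ', hY'⟩ := hgc ξ Y hY
    have hp' := hp ξ'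
    rw [hξ'] at hp'
    obtain ⟨q, hq⟩ := hp'
    exact ⟨q, fun i hi => (key _ _).2 (hq (fun k => (g i, k)) (hcons ξ' _ (hY' i hi)))⟩
  · exact hinc _ _ (hg i j hij)
      (((key _ _).1 hi).exists_realize ((key _ _).1 hj))

theorem Pattern.Has.of_witness {L : FirstOrder.Language.{u, v}} {T : L.Theory} {pat : Pattern}
    {N : Type (max u v)} [L.Structure N] [Nonempty N] [N ⊨ T] {κ γ : Type} [Finite κ] [Finite γ]
    {θ : L.Formula (κ ⊕ γ)} {e : pat.Index → γ → N} (h : pat.Witness θ e) : pat.Has T := by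
  obtain ⟨n, ⟨f⟩⟩ := Finite.exists_equiv_fin κ
  obtain ⟨m, ⟨f'⟩⟩ := Finite.exists_equiv_fin γ
  have key : ∀ (b : Fin n → N) i, (θ.relabel (Sum.map f f')).Realize
      (Sum.elim b (e i ∘ f'.symm)) ↔ θ.Realize (Sum.elim (b ∘ f) (e i)) := fun b i => by
    rw [Formula.realize_relabel, Sum.elim_comp_map, Function.comp_assoc, f'.symm_comp_self,
      Function.comp_id]
  refine ⟨Theory.ModelType.of T N, n, m, θ.relabel (Sum.map f f'), fun i => e i ∘ f'.symm,
    fun ξ Y hY => ?_, fun i j hij ⟨b, hi, hj⟩ => ?_⟩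
  · obtain ⟨b, hb⟩ := h.1 ξ Y hY
    have hbf : (b ∘ f.symm) ∘ f = b := by
      rw [Function.comp_assoc, f.symm_comp_self, Function.comp_id]
    exact ⟨b ∘ f.symm, fun i hi => (key _ i).2 (hbf.symm ▸ hb i hi)⟩
  · exact h.2 i j hij ⟨b ∘ f, (key b i).1 hi, (key b j).1 hj⟩

theorem Pattern.has_of_has_completeTheory {pat : Pattern} (hpat : pat.Baire)
    {T : (ringLang' L').Theory}
    (hfield : (LHom.sumInl : Language.ring →ᴸ ringLang' L').onTheory Theory.field ⊆ T)
    {M : Type (max u v)} [(LP L').Structure M] [Field M] [IsAlgClosed M] (hM : IsACFTModel L' M T)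
    (h : pat.Has ((LP L').completeTheory M)) : pat.Has T := by
  obtain ⟨N, n, m, φ, a, ha⟩ := h
  have hMN : M ≅[LP L'] N := elementarilyEquivalent_iff.2 fun φ =>
    (realize_iff_of_model_completeTheory M N φ).symm
  let N₀ := PrePair.ofEquiv (M := hM.toPrePair) N hMN
  have hMN₀ : hM.toPrePair ≅[LP L'] N₀ := hMN
  obtain ⟨N', hN', κ, γ, _, _, θ, e, he⟩ :=
    Pattern.Witness.exists_base_witness hpat (M := N₀) ((hM.isPair hfield).of_equiv hMN₀) ha
  have := model_base_of_equiv (hMN₀.trans hN') T hM.p_models_T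
  exact Pattern.Has.of_witness he

end Preservation

/-- **Theorem 6.10**: Let `T` be a theory of fields in a language `L` expanding the language of
rings.  If `T` is NTP₁ (resp. NTP₂, resp. NATP), then `ACF_T` is NTP₁ (resp. NTP₂, resp. NATP):
the complete theory of any model of `ACF_T` has the corresponding property. -/
theorem ACF_T_preserves_tree_properties
    (L' : FirstOrder.Language.{u, v}) (T : (ringLang' L').Theory)
    (hfield : (LHom.sumInl : Language.ring →ᴸ ringLang' L').onTheory Theory.field ⊆ T) :
    (T.IsNTP1 → ∀ (M : Type (max u v)) [(LP L').Structure M] [Field M] [IsAlgClosed M],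
      IsACFTModel L' M T → ((LP L').completeTheory M).IsNTP1) ∧
    (T.IsNTP2 → ∀ (M : Type (max u v)) [(LP L').Structure M] [Field M] [IsAlgClosed M],
      IsACFTModel L' M T → ((LP L').completeTheory M).IsNTP2) ∧
    (T.IsNATP → ∀ (M : Type (max u v)) [(LP L').Structure M] [Field M] [IsAlgClosed M],
      IsACFTModel L' M T → ((LP L').completeTheory M).IsNATP) := by
  refine ⟨fun hT M _ _ _ hM h => hT ?_, fun hT M _ _ _ hM h => hT ?_, fun hT M _ _ _ hM h => hT ?_⟩
  · exact (has_patternTP1_iff T).1 (Pattern.has_of_has_completeTheory patternTP1_baire hfield hM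
      ((has_patternTP1_iff _).2 h))
  · exact (has_patternTP2_iff T).1 (Pattern.has_of_has_completeTheory patternTP2_baire hfield hM
      ((has_patternTP2_iff _).2 h))
  · exact (has_patternATP_iff T).1 (Pattern.has_of_has_completeTheory patternATP_baire hfield hM
      ((has_patternATP_iff _).2 h))

end NATPPaper
end

section
/- Let Ω be an algebraically closed field, K an algebraically closed subfield of Ω, and E_1, …, E_n algebraically closed intermediate fields K ⊆ E_i ⊆ Ω for a positive integer n. Let t ∈ Ω be an element not in the (field-theoretic) algebraic closure of the composite field E_1⋯E_n, and for each i let E_i' be the relative algebraic closure in Ω of the rational function field E_i(t). Then (E_1'·…·E_n') ∩ (E_1⋯E_n) = E_1·…·E_n, where for fields M_1, …, M_n inside Ω, M_1·…·M_n := {x_1·…·x_n : x_i ∈ M_i for i ≤ n} denotes the set of products and E_1⋯E_n denotes the composite field. -/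
universe u

namespace NATPPaper

variable {Ω : Type u} [Field Ω] [IsAlgClosed Ω]

/-- `x` is (field-theoretically) algebraic over the subfield of `Ω` generated by `S`. -/
def AlgOver (S : Set Ω) (x : Ω) : Prop :=
  ∃ p : Polynomial Ω, p ≠ 0 ∧ (∀ k, p.coeff k ∈ Subfield.closure S) ∧ Polynomial.eval x p = 0

/-- The relative algebraic closure in `Ω` of the subfield generated by `S`. -/
def relAlgClosure (S : Set Ω) : Set Ω := {x | AlgOver S x}

/-- A subfield `E` of the algebraically closed field `Ω` is algebraically closed iff it is
relatively algebraically closed in `Ω`. -/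
def IsAlgClosedSubfield (E : Subfield Ω) : Prop :=
  ∀ x : Ω, AlgOver (E : Set Ω) x → x ∈ E

/-- The set of products `M_1 ⋅ … ⋅ M_n = {x_1 ⋅ … ⋅ x_n : x_i ∈ M_i}`. -/
def setProd {n : ℕ} (E : Fin n → Set Ω) : Set Ω :=
  {x | ∃ a : Fin n → Ω, (∀ i, a i ∈ E i) ∧ x = ∏ i, a i}

open Polynomial

theorem algOver_coe_iff {F : Type*} [Field F] {E : Subfield F} {x : F} :
    AlgOver (E : Set F) x ↔ IsAlgebraic E x := by
  constructor
  · rintro ⟨p, hp, hc, hx⟩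
    rw [Subfield.closure_eq] at hc
    obtain ⟨q, rfl⟩ := (lifts_iff_coeff_lifts (f := E.subtype) p).2 fun k => ⟨⟨_, hc k⟩, rfl⟩
    refine ⟨q, fun h => hp (by simp [h]), ?_⟩
    rwa [coe_mapRingHom, eval_map] at hx
  · rintro ⟨q, hq, hx⟩
    refine ⟨q.map E.subtype, (Polynomial.map_ne_zero_iff E.subtype.injective).2 hq, fun k => ?_, ?_⟩
    · rw [Subfield.closure_eq, coeff_map]
      exact (q.coeff k).2
    · rwa [eval_map]

theorem algOver_closure_iff {F : Type*} [Field F] {S : Set F} {x : F} :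
    AlgOver (Subfield.closure S : Set F) x ↔ AlgOver S x := by
  simp only [AlgOver, Subfield.closure_eq]

theorem subset_relAlgClosure {F : Type*} [Field F] {S : Set F} : S ⊆ relAlgClosure S := fun x hx =>
  algOver_closure_iff.1 <| algOver_coe_iff.2 <|
    isAlgebraic_algebraMap (⟨x, Subfield.subset_closure hx⟩ : Subfield.closure S)

theorem IsAlgClosedSubfield.isAlgClosed {E : Subfield Ω}
    (hE : IsAlgClosedSubfield E) : IsAlgClosed E := by
  refine IsAlgClosed.of_exists_root E fun p hp hirr => ?_
  obtain ⟨x, hx⟩ := IsAlgClosed.exists_aeval_eq_zero Ω p hirr.degree_pos.ne'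
  refine ⟨⟨x, hE x (algOver_coe_iff.2 ⟨p, hp.ne_zero, hx⟩)⟩, E.subtype.injective ?_⟩
  rw [map_zero, ← Polynomial.eval₂_at_apply]
  exact hx

open scoped IntermediateField.algebraAdjoinAdjoin in
theorem exists_bivariate_of_algOver {F : Type*} [Field F] {E : Subfield F} {t x : F}
    (hx : AlgOver ((E : Set F) ∪ {t}) x) :
    ∃ G : E[X][X], G ≠ 0 ∧ eval₂ (aeval t : E[X] →ₐ[E] F).toRingHom x G = 0 := by
  have hcl : (IntermediateField.adjoin E {t}).toSubfield =
      Subfield.closure ((E : Set F) ∪ {t}) := by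
    rw [IntermediateField.adjoin_toSubfield]
    congr 2
    exact Subtype.range_coe
  rw [← algOver_closure_iff, ← hcl, algOver_coe_iff] at hx
  have hx' : IsAlgebraic (IntermediateField.adjoin E {t}) x := hx
  rw [← IsFractionRing.isAlgebraic_iff (Algebra.adjoin E {t})] at hx'
  obtain ⟨p, hp, hpx⟩ := hx'
  obtain ⟨G, hG⟩ := (lifts_iff_coeff_lifts (f := (aeval t : E[X] →ₐ[E] F).toRingHom)
    (p.map (algebraMap (Algebra.adjoin E {t}) F))).2 fun k => by
      rw [coeff_map]
      exact (Algebra.adjoin_singleton_eq_range_aeval E t).le (p.coeff k).2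
  refine ⟨G, ?_, ?_⟩
  · rintro rfl
    refine hp ((Polynomial.map_eq_zero_iff
      (FaithfulSMul.algebraMap_injective (Algebra.adjoin E {t}) F)).1 ?_)
    simpa using hG.symm
  · rw [coe_mapRingHom] at hG
    rw [← eval_map, hG]
    rwa [eval_map_algebraMap]

/-- If `t` is transcendental over `L` and `c ∈ L`, some place that is finite on `L` sends `t`
to `c`. -/
theorem exists_valuationSubring {F : Type*} [Field F] {L : Subfield F} {t : F}
    (ht : Transcendental L t) (c : L) :
    ∃ V : ValuationSubring F, (∀ a ∈ L, a ∈ V) ∧ t - c ∈ V.nonunits := by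
  let A : Subring F := (Algebra.adjoin L {t}).toSubring
  have htA : t ∈ A := Algebra.self_mem_adjoin_singleton L t
  have hLA : ∀ a ∈ L, a ∈ A := fun a ha => (Algebra.adjoin L {t}).algebraMap_mem ⟨a, ha⟩
  let s : A := ⟨t - c, A.sub_mem htA (hLA c c.2)⟩
  have hs : Ideal.span {s} ≠ ⊤ := by
    rw [Ne, Ideal.span_singleton_eq_top, isUnit_iff_exists_inv]
    rintro ⟨⟨b, hb⟩, h⟩
    have hb' : b ∈ Algebra.adjoin L {t} := hb
    rw [Algebra.adjoin_singleton_eq_range_aeval] at hb'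
    obtain ⟨g, rfl⟩ := hb'
    have h1 : (t - c) * aeval t g = 1 := congrArg Subtype.val h
    have h2 : (X - C c) * g = 1 := by
      refine transcendental_iff_injective.1 ht ?_
      rw [map_mul, map_sub, aeval_X, aeval_C, map_one]
      exact h1
    simpa using congrArg (eval c) h2
  obtain ⟨V, hAV, hV⟩ := Ideal.image_subset_nonunits_valuationSubring _ hs
  exact ⟨V, fun a ha => hAV (hLA a ha), hV ⟨s, Ideal.mem_span_singleton_self s, rfl⟩⟩

/-- A place that is finite on an algebraically closed field `E` and sends `t` to `c ∈ E` maps each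
root of a polynomial over `E[t]` whose leading coefficient survives at `c` into the image of `E`. -/
theorem exists_residue_eq {F : Type*} [Field F] {E : Subfield F} [IsAlgClosed E]
    {V : ValuationSubring F}
    (hEV : ∀ a ∈ E, a ∈ V) {t : F} {c : E} (htc : t - c ∈ V.nonunits) {G : E[X][X]}
    (hc : G.leadingCoeff.eval c ≠ 0) {x : F}
    (hx : eval₂ (aeval t : E[X] →ₐ[E] F).toRingHom x G = 0) :
    ∃ (hxV : x ∈ V) (y : E), IsLocalRing.residue V ⟨x, hxV⟩ =
      IsLocalRing.residue V ⟨y, hEV y y.2⟩ := by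
  let ι : E →+* V := E.subtype.codRestrict V fun a => hEV a a.2
  have htV : t ∈ V := by
    simpa using V.add_mem _ _ (V.nonunits_subset htc) (hEV c c.2)
  let σ : E[X] →+* V := eval₂RingHom ι ⟨t, htV⟩
  let ρ := IsLocalRing.residue V
  have hσ : (algebraMap V F).comp σ = (aeval t : E[X] →ₐ[E] F).toRingHom := by
    apply Polynomial.ringHom_ext
    · intro a; simp [σ, ι]; rfl
    · simp [σ]
  have hρ : ρ.comp σ = (ρ.comp ι).comp (evalRingHom c) := by
    apply Polynomial.ringHom_ext
    · intro a; simp [σ]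
    · suffices h : ρ (⟨t, htV⟩ - ι c) = 0 by simpa [σ, sub_eq_zero] using h
      rw [IsLocalRing.residue_eq_zero_iff]
      exact V.coe_mem_nonunits_iff.1 htc
  have hlc : IsUnit (σ G.leadingCoeff) := by
    rw [← IsLocalRing.residue_ne_zero_iff_isUnit]
    have := RingHom.congr_fun hρ G.leadingCoeff
    simp only [RingHom.comp_apply] at this
    erw [this]
    exact (map_ne_zero_iff _ (ρ.comp ι).injective).2 hc
  have hlc' : (G.map σ).leadingCoeff = σ G.leadingCoeff :=
    leadingCoeff_map_of_leadingCoeff_ne_zero σ hlc.ne_zero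
  have hroot : aeval x (G.map σ) = 0 := by
    rw [aeval_def, eval₂_map, hσ, hx]
  have hint : IsIntegral V x := by
    have := isIntegral_leadingCoeff_smul (G.map σ) x hroot
    rw [hlc'] at this
    simpa [smul_smul] using this.smul ((hlc.unit⁻¹ : Vˣ) : V)
  obtain ⟨x', rfl⟩ := IsIntegrallyClosed.isIntegral_iff.1 hint
  have hroot' : eval x' (G.map σ) = 0 := by
    rw [aeval_algebraMap_apply] at hroot
    exact (FaithfulSMul.algebraMap_eq_zero_iff V F).1 hroot
  refine ⟨x'.2, ?_⟩
  have hQ : ((G.map (evalRingHom c)).map (ρ.comp ι)).IsRoot (ρ x') := by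
    rw [map_map, ← hρ, ← map_map, IsRoot, eval_map_apply, hroot', map_zero]
  have hQ0 : G.map (evalRingHom c) ≠ 0 := fun h => hc <| by
    simpa using congrArg (coeff · G.natDegree) h
  obtain ⟨y, hy⟩ := (IsAlgClosed.splits (G.map (evalRingHom c))).mem_range_of_isRoot hQ0 hQ
  exact ⟨y, hy.symm⟩

/-- **Lemma 6.12**: Let `E_1, …, E_n` be algebraically closed fields containing an algebraically
closed field `K` (all inside an algebraically closed field `Ω`), and let `t` be an element not
algebraic over the composite field `E_1 ⋯ E_n`.  Let `E_i'` be the (relative) algebraic closure of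
the rational function field `E_i(t)`.  Then
`(E_1' ⋅ … ⋅ E_n') ∩ (E_1 ⋯ E_n) = E_1 ⋅ … ⋅ E_n`. -/
theorem prod_relAlgClosure_inter_composite
    (K : Subfield Ω) (hK : IsAlgClosedSubfield K)
    (n : ℕ) (hn : 0 < n) (E : Fin n → Subfield Ω)
    (hKE : ∀ i, K ≤ E i) (hE : ∀ i, IsAlgClosedSubfield (E i))
    (t : Ω) (ht : ¬ AlgOver ((⨆ i, E i : Subfield Ω) : Set Ω) t) :
    setProd (fun i => relAlgClosure (↑(E i) ∪ {t})) ∩ ↑(⨆ i, E i : Subfield Ω)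
      = setProd (fun i => (↑(E i) : Set Ω)) := by
  have hEL : ∀ i, E i ≤ ⨆ i, E i := le_iSup E
  apply Set.Subset.antisymm
  · rintro x ⟨⟨a, ha, rfl⟩, hxL⟩
    choose G hG hGa using fun i => exists_bivariate_of_algOver (ha i)
    have := hK.isAlgClosed
    have := fun i => (hE i).isAlgClosed
    classical
    let P : Polynomial Ω := ∏ i, ((G i).leadingCoeff.map (E i).subtype)
    have hP : P ≠ 0 := Finset.prod_ne_zero_iff.2 fun i _ =>
      (Polynomial.map_ne_zero_iff (E i).subtype.injective).2 (leadingCoeff_ne_zero.2 (hG i))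
    obtain ⟨c, hcK, hc⟩ :=
      (Set.infinite_coe_iff.1 (inferInstance : Infinite K)).exists_notMem_finset P.roots.toFinset
    have hc' : ∀ i, (G i).leadingCoeff.eval ⟨c, hKE i hcK⟩ ≠ 0 := by
      intro i h
      refine hc ?_
      rw [Multiset.mem_toFinset, mem_roots hP, IsRoot, eval_prod]
      refine Finset.prod_eq_zero (Finset.mem_univ i) ?_
      have := congrArg (E i).subtype h
      rwa [← eval_map_apply, map_zero] at this
    have ht' : Transcendental (⨆ i, E i : Subfield Ω) t := fun h => ht (algOver_coe_iff.2 h)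
    obtain ⟨V, hLV, hV⟩ : ∃ V : ValuationSubring Ω,
        (∀ a ∈ (⨆ i, E i : Subfield Ω), a ∈ V) ∧ t - c ∈ V.nonunits :=
      exists_valuationSubring ht' ⟨c, hEL ⟨0, hn⟩ (hKE _ hcK)⟩
    choose haV y hy using fun i =>
      exists_residue_eq (fun b hb => hLV b (hEL i hb)) (c := ⟨c, hKE i hcK⟩) hV (hc' i) (hGa i)
    have hyL : ∏ i, (y i : Ω) ∈ (⨆ i, E i : Subfield Ω) := prod_mem fun i _ => hEL i (y i).2
    let φ : (⨆ i, E i : Subfield Ω) →+* IsLocalRing.ResidueField V :=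
      (IsLocalRing.residue V).comp
        ((⨆ i, E i : Subfield Ω).subtype.codRestrict V fun b => hLV b b.2)
    have hφ : φ ⟨_, hxL⟩ = φ ⟨_, hyL⟩ := by
      have h := Finset.prod_congr (s₁ := Finset.univ) rfl fun i _ => hy i
      rw [← map_prod, ← map_prod] at h
      have hprod (b : Fin n → V) (hb : ∏ i, (b i : Ω) ∈ (⨆ i, E i : Subfield Ω)) :
          φ ⟨_, hb⟩ = IsLocalRing.residue V (∏ i, b i) :=
        congrArg (IsLocalRing.residue V) (Subtype.ext (map_prod V.subtype b _).symm)
      exact (hprod _ hxL).trans (h.trans (hprod _ hyL).symm)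
    exact ⟨fun i => y i, fun i => (y i).2, congrArg Subtype.val (φ.injective hφ)⟩
  · rintro x ⟨a, ha, rfl⟩
    exact ⟨⟨a, fun i => subset_relAlgClosure (Or.inl (ha i)), rfl⟩,
      prod_mem fun i _ => hEL i (ha i)⟩

end NATPPaper
end
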